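/- (Unconditional Bonnesen-type inequality for H².) Let K be a compact geodesically convex subset of the hyperbolic plane H² (of constant curvature −1) with nonempty interior. Then P_K² − A_K·(4π + A_K) ≥ min( 4π², (sinh R_K − sinh r_K)²·((2π + A_K)² − P_K²)² / (4·(2π + A_K)²) ). -/

import Mathlib

open MeasureTheory Metric Real UpperHalfPlane

open scoped UpperHalfPlane

noncomputable section

instance : MeasurableSpace ℍ := borel ℍ

instance : BorelSpace ℍ := ⟨rfl⟩

/-- The hyperbolic area measure on the upper half-plane: the measure with density
`y⁻²` with respect to the planar Lebesgue measure. -/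
def hypAreaMeasure : Measure ℍ :=
  (Measure.comap (fun z : ℍ => (z : ℂ)) volume).withDensity
    (fun z => ENNReal.ofReal ((z.im ^ 2)⁻¹))

/-- The hyperbolic area of a subset of the hyperbolic plane. -/
def hypArea (K : Set ℍ) : ℝ := (hypAreaMeasure K).toReal

/-- The hyperbolic perimeter: one-dimensional Hausdorff measure (with respect to the
hyperbolic metric) of the topological boundary. -/
def hypPerim (K : Set ℍ) : ℝ := (μH[1] (frontier K)).toReal

/-- Geodesic convexity in the hyperbolic plane. -/
def HypConvex (K : Set ℍ) : Prop :=
  ∀ x ∈ K, ∀ y ∈ K, ∀ z : ℍ, dist x z + dist z y = dist x y → z ∈ K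

/-- The hyperbolic circumradius of `K`. -/
def hypCircumradius (K : Set ℍ) : ℝ :=
  sInf {R : ℝ | ∃ c : ℍ, K ⊆ Metric.closedBall c R}

/-- The hyperbolic inradius of `K`. -/
def hypInradius (K : Set ℍ) : ℝ :=
  sSup {r : ℝ | ∃ c : ℍ, Metric.closedBall c r ⊆ K}

/-- `K` is a closed hyperbolic disc of positive radius. -/
def IsHypDisc (K : Set ℍ) : Prop :=
  ∃ (c : ℍ) (r : ℝ), 0 < r ∧ K = Metric.closedBall c r

end

noncomputable section
open MeasureTheory Metric Real UpperHalfPlane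
open scoped UpperHalfPlane
namespace HB

/-- hyperboloid coordinates -/
def tt (z : ℍ) : ℝ := (z.re ^ 2 + z.im ^ 2 + 1) / (2 * z.im)
def aa (z : ℍ) : ℝ := (z.re ^ 2 + z.im ^ 2 - 1) / (2 * z.im)
def bb (z : ℍ) : ℝ := z.re / z.im

lemma tt_pos (z : ℍ) : 0 < tt z := by
  have := z.im_pos
  unfold tt; positivity

lemma tt_sq (z : ℍ) : tt z ^ 2 = 1 + aa z ^ 2 + bb z ^ 2 := by
  have := z.im_pos
  unfold tt aa bb; field_simp; ring

lemma tt_eq (z : ℍ) : tt z = √(1 + aa z ^ 2 + bb z ^ 2) := by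
  rw [← tt_sq, Real.sqrt_sq (tt_pos z).le]

lemma one_le_tt (z : ℍ) : 1 ≤ tt z := by
  nlinarith [tt_sq z, tt_pos z, sq_nonneg (aa z), sq_nonneg (bb z)]

lemma tt_sub_aa (z : ℍ) : tt z - aa z = 1 / z.im := by
  have := z.im_pos
  unfold tt aa; field_simp; ring

lemma ext' {z w : ℍ} (ha : aa z = aa w) (hb : bb z = bb w) : z = w := by
  have ht : tt z = tt w := by rw [tt_eq, tt_eq, ha, hb]
  have h1 := tt_sub_aa z
  have h2 := tt_sub_aa w
  rw [ht, ha, h2] at h1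
  have hz := z.im_pos
  have hw := w.im_pos
  have him : z.im = w.im := by
    field_simp at h1; linarith
  have hre : z.re = w.re := by
    unfold bb at hb; rw [him] at hb; field_simp at hb; exact hb
  exact UpperHalfPlane.ext (Complex.ext hre him)

lemma sqrt_sub_pos (a b : ℝ) : 0 < √(1 + a ^ 2 + b ^ 2) - a := by
  have : a < √(1 + a ^ 2 + b ^ 2) := by
    apply Real.lt_sqrt_of_sq_lt; nlinarith [sq_nonneg b]
  linarith

/-- inverse of the hyperboloid chart -/
def mk (a b : ℝ) : ℍ :=
  ⟨⟨b / (√(1 + a ^ 2 + b ^ 2) - a), 1 / (√(1 + a ^ 2 + b ^ 2) - a)⟩, by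
    have := sqrt_sub_pos a b
    change 0 < 1 / (√(1 + a ^ 2 + b ^ 2) - a)
    positivity⟩

lemma mk_re (a b : ℝ) : (mk a b).re = b / (√(1 + a ^ 2 + b ^ 2) - a) := rfl
lemma mk_im (a b : ℝ) : (mk a b).im = 1 / (√(1 + a ^ 2 + b ^ 2) - a) := rfl

@[simp] lemma bb_mk (a b : ℝ) : bb (mk a b) = b := by
  have := sqrt_sub_pos a b
  unfold bb; rw [mk_re, mk_im]; field_simp

@[simp] lemma aa_mk (a b : ℝ) : aa (mk a b) = a := by
  have := sqrt_sub_pos a b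
  have h2 : √(1 + a ^ 2 + b ^ 2) ^ 2 = 1 + a ^ 2 + b ^ 2 := Real.sq_sqrt (by positivity)
  unfold aa; rw [mk_re, mk_im]; field_simp
  generalize √(1 + a ^ 2 + b ^ 2) = t at *
  nlinarith

lemma tt_mk (a b : ℝ) : tt (mk a b) = √(1 + a ^ 2 + b ^ 2) := by
  rw [tt_eq]; simp

@[simp] lemma mk_aa_bb (z : ℍ) : mk (aa z) (bb z) = z := ext' (by simp) (by simp)

lemma tt_mk_of {t a b : ℝ} (ht : 0 ≤ t) (h : t ^ 2 = 1 + a ^ 2 + b ^ 2) : tt (mk a b) = t := by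
  rw [tt_mk, ← h, Real.sqrt_sq ht]

/-- Lorentz form -/
def B (z w : ℍ) : ℝ := tt z * tt w - aa z * aa w - bb z * bb w

lemma cosh_dist_eq (z w : ℍ) : Real.cosh (dist z w) = B z w := by
  rw [UpperHalfPlane.cosh_dist, Complex.dist_eq, Complex.sq_norm, Complex.normSq_apply]
  have := z.im_pos
  have := w.im_pos
  simp only [Complex.sub_re, Complex.sub_im, UpperHalfPlane.coe_re, UpperHalfPlane.coe_im]
  unfold B tt aa bb
  field_simp; ring

lemma B_comm (z w : ℍ) : B z w = B w z := by unfold B; ring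
lemma B_self (z : ℍ) : B z z = 1 := by unfold B; nlinarith [tt_sq z]
lemma one_le_B (z w : ℍ) : 1 ≤ B z w := by rw [← cosh_dist_eq]; exact Real.one_le_cosh _

lemma eq_of_B_le_one {z w : ℍ} (h : B z w ≤ 1) : z = w := by
  have h1 : Real.cosh (dist z w) = 1 := le_antisymm (by rw [cosh_dist_eq]; exact h) (Real.one_le_cosh _)
  by_contra hne
  have := Real.one_lt_cosh.2 (dist_pos.2 hne).ne'
  linarith

lemma dist_le_iff {z w z' w' : ℍ} : dist z w ≤ dist z' w' ↔ B z w ≤ B z' w' := by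
  rw [← cosh_dist_eq, ← cosh_dist_eq, Real.cosh_le_cosh, abs_of_nonneg dist_nonneg, abs_of_nonneg dist_nonneg]

lemma dist_le_iff' {z w : ℍ} {r : ℝ} (hr : 0 ≤ r) : dist z w ≤ r ↔ B z w ≤ Real.cosh r := by
  rw [← cosh_dist_eq, Real.cosh_le_cosh, abs_of_nonneg dist_nonneg, abs_of_nonneg hr]

lemma dist_lt_iff' {z w : ℍ} {r : ℝ} (hr : 0 ≤ r) : dist z w < r ↔ B z w < Real.cosh r := by
  rw [← cosh_dist_eq, Real.cosh_lt_cosh, abs_of_nonneg dist_nonneg, abs_of_nonneg hr]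

lemma dist_eq_of_B {z w : ℍ} {r : ℝ} (hr : 0 ≤ r) (h : B z w = Real.cosh r) : dist z w = r :=
  le_antisymm ((dist_le_iff' hr).2 h.le) (by
    by_contra hh; push Not at hh
    have := (dist_lt_iff' hr).1 hh
    linarith)

/-- determinant -/
def D (p q z : ℍ) : ℝ := tt z * (aa p * bb q - bb p * aa q) - aa z * (tt p * bb q - bb p * tt q)
  + bb z * (tt p * aa q - aa p * tt q)

/-- `f = α p + β q` as vectors -/
structure Comb (f : ℍ) (α : ℝ) (p : ℍ) (β : ℝ) (q : ℍ) : Prop where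
  t : tt f = α * tt p + β * tt q
  a : aa f = α * aa p + β * aa q
  b : bb f = α * bb p + β * bb q

lemma Comb.B {f p q : ℍ} {α β : ℝ} (h : Comb f α p β q) (y : ℍ) : B f y = α * B p y + β * B q y := by
  unfold HB.B; rw [h.t, h.a, h.b]; ring

lemma Comb.B' {f p q : ℍ} {α β : ℝ} (h : Comb f α p β q) (y : ℍ) : HB.B y f = α * HB.B y p + β * HB.B y q := by
  unfold HB.B; rw [h.t, h.a, h.b]; ring

lemma Comb.D {f p q : ℍ} {α β : ℝ} (h : Comb f α p β q) (x y : ℍ) :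
    D x y f = α * D x y p + β * D x y q := by
  unfold HB.D; rw [h.t, h.a, h.b]; ring

/-- origin -/
def o : ℍ := mk 0 0
@[simp] lemma aa_o : aa o = 0 := by simp [o]
@[simp] lemma bb_o : bb o = 0 := by simp [o]
@[simp] lemma tt_o : tt o = 1 := by simp [o, tt_mk]

lemma comb_of_B {f p q : ℍ} {α β : ℝ} (h : ∀ y, HB.B f y = α * HB.B p y + β * HB.B q y) :
    Comb f α p β q := by
  have h0 := h o
  have h1 := h (mk 1 0)
  have h2 := h (mk 0 1)
  unfold HB.B at h0 h1 h2
  simp only [aa_o, bb_o, tt_o, aa_mk, bb_mk] at h0 h1 h2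
  have ht : tt f = α * tt p + β * tt q := by linarith
  refine ⟨ht, ?_, ?_⟩
  · have : tt f * tt (mk 1 0) = (α * tt p + β * tt q) * tt (mk 1 0) := by rw [ht]
    linarith
  · have : tt f * tt (mk 0 1) = (α * tt p + β * tt q) * tt (mk 0 1) := by rw [ht]
    linarith

lemma Comb.norm {f p q : ℍ} {α β : ℝ} (h : Comb f α p β q) : α ^ 2 + β ^ 2 + 2 * α * β * HB.B p q = 1 := by
  have h1 := h.B f
  rw [h.B' p, h.B' q, B_self, B_self, B_self, B_comm q p] at h1
  linarith

lemma Comb.sum_le {f p q : ℍ} {α β : ℝ} (h : Comb f α p β q) (hα : 0 ≤ α) (hβ : 0 ≤ β) : α + β ≤ 1 := by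
  have := h.norm
  have h2 := one_le_B p q
  have h3 := mul_nonneg hα hβ
  nlinarith

/-- balls are convex -/
lemma Comb.dist_le {f p q c : ℍ} {α β r : ℝ} (h : Comb f α p β q) (hα : 0 ≤ α) (hβ : 0 ≤ β)
    (hp : dist c p ≤ r) (hq : dist c q ≤ r) : dist c f ≤ r := by
  have hr : 0 ≤ r := dist_nonneg.trans hp
  rw [dist_le_iff' hr] at *
  rw [h.B']
  have := h.sum_le hα hβ
  have := Real.cosh_pos r
  nlinarith

lemma Comb.between {f p q : ℍ} {α β : ℝ} (h : Comb f α p β q) (hα : 0 ≤ α) (hβ : 0 ≤ β) :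
    dist p f + dist f q = dist p q := by
  have hs : 0 ≤ Real.sinh (dist p q) := Real.sinh_nonneg_iff.2 dist_nonneg
  have hn := h.norm
  have e1 : Real.cosh (dist p f) = α + β * Real.cosh (dist p q) := by
    rw [cosh_dist_eq, cosh_dist_eq, h.B', B_self]; ring
  have e2 : Real.cosh (dist f q) = α * Real.cosh (dist p q) + β := by
    rw [cosh_dist_eq, cosh_dist_eq, h.B, B_self]; ring
  rw [← cosh_dist_eq] at hn
  have s0 := Real.cosh_sq (dist p q)
  have s1 : Real.sinh (dist p f) = β * Real.sinh (dist p q) := by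
    have h1 := Real.cosh_sq (dist p f)
    rw [e1] at h1
    have : Real.sinh (dist p f) ^ 2 = (β * Real.sinh (dist p q)) ^ 2 := by
      have : (β * Real.sinh (dist p q)) ^ 2 = β ^ 2 * (Real.cosh (dist p q) ^ 2 - 1) := by rw [s0]; ring
      nlinarith
    exact (pow_left_inj₀ (Real.sinh_nonneg_iff.2 dist_nonneg) (mul_nonneg hβ hs) two_ne_zero).1 this
  have s2 : Real.sinh (dist f q) = α * Real.sinh (dist p q) := by
    have h1 := Real.cosh_sq (dist f q)
    rw [e2] at h1
    have : Real.sinh (dist f q) ^ 2 = (α * Real.sinh (dist p q)) ^ 2 := by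
      have : (α * Real.sinh (dist p q)) ^ 2 = α ^ 2 * (Real.cosh (dist p q) ^ 2 - 1) := by rw [s0]; ring
      nlinarith
    exact (pow_left_inj₀ (Real.sinh_nonneg_iff.2 dist_nonneg) (mul_nonneg hα hs) two_ne_zero).1 this
  have : Real.cosh (dist p f + dist f q) = Real.cosh (dist p q) := by
    rw [Real.cosh_add, e1, e2, s1, s2]
    have : Real.cosh (dist p q) ^ 2 - Real.sinh (dist p q) ^ 2 = 1 := by rw [s0]; ring
    generalize Real.cosh (dist p q) = C at *
    generalize Real.sinh (dist p q) = S at *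
    have hS : S ^ 2 = C ^ 2 - 1 := by linarith
    calc (α + β * C) * (α * C + β) + β * S * (α * S) 
        = (α + β * C) * (α * C + β) + α * β * S ^ 2 := by ring
      _ = C * (α ^ 2 + β ^ 2 + 2 * α * β * C) := by rw [hS]; ring
      _ = C := by rw [hn, mul_one]
  exact Real.cosh_injOn (add_nonneg dist_nonneg dist_nonneg) dist_nonneg this

lemma HypConvex.comb {K : Set ℍ} (hK : HypConvex K) {f p q : ℍ} {α β : ℝ} (hp : p ∈ K) (hq : q ∈ K)
    (h : Comb f α p β q) (hα : 0 ≤ α) (hβ : 0 ≤ β) : f ∈ K :=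
  hK p hp q hq f (h.between hα hβ)

/-- normalisation of timelike vectors -/
lemma exists_norm {t a b : ℝ} (ht : 0 < t) (h : a ^ 2 + b ^ 2 < t ^ 2) :
    ∃ N : ℝ, 0 < N ∧ N ^ 2 = t ^ 2 - a ^ 2 - b ^ 2 ∧ ∃ x : ℍ, tt x = t / N ∧ aa x = a / N ∧ bb x = b / N := by
  have hp : 0 < t ^ 2 - a ^ 2 - b ^ 2 := by linarith
  have hN := Real.sqrt_pos.2 hp
  have hN2 := Real.sq_sqrt hp.le
  refine ⟨√(t ^ 2 - a ^ 2 - b ^ 2), hN, hN2, mk (a / √(t ^ 2 - a ^ 2 - b ^ 2)) (b / √(t ^ 2 - a ^ 2 - b ^ 2)), ?_, by simp, by simp⟩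
  apply tt_mk_of (by positivity)
  field_simp
  rw [hN2]; ring

lemma exists_comb (p q : ℍ) {α β : ℝ} (hα : 0 ≤ α) (hβ : 0 ≤ β) (h : 0 < α + β) :
    ∃ N : ℝ, 0 < N ∧ ∃ x : ℍ, Comb x (α / N) p (β / N) q := by
  have hpq := one_le_B p q
  have ht : 0 < α * tt p + β * tt q := by
    have := one_le_tt p; have := one_le_tt q; nlinarith
  obtain ⟨N, hN, -, x, h1, h2, h3⟩ := exists_norm (t := α * tt p + β * tt q) (a := α * aa p + β * aa q)
    (b := α * bb p + β * bb q) ht (by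
      have e : (α * tt p + β * tt q) ^ 2 - ((α * aa p + β * aa q) ^ 2 + (α * bb p + β * bb q) ^ 2)
        = α ^ 2 + β ^ 2 + 2 * α * β * B p q := by
        have := tt_sq p; have := tt_sq q
        unfold B
        linear_combination α ^ 2 * tt_sq p + β ^ 2 * tt_sq q
      have := mul_nonneg hα hβ
      nlinarith)
  refine ⟨N, hN, x, ?_, ?_, ?_⟩
  · rw [h1]; ring
  · rw [h2]; ring
  · rw [h3]; ring

/-! ### Rotations and boosts -/

def rot (φ : ℝ) (z : ℍ) : ℍ := mk (cos φ * aa z - sin φ * bb z) (sin φ * aa z + cos φ * bb z)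
def boost (s : ℝ) (z : ℍ) : ℍ := mk (Real.cosh s * aa z + Real.sinh s * tt z) (bb z)

@[simp] lemma aa_rot (φ z) : aa (rot φ z) = cos φ * aa z - sin φ * bb z := by simp [rot]
@[simp] lemma bb_rot (φ z) : bb (rot φ z) = sin φ * aa z + cos φ * bb z := by simp [rot]
@[simp] lemma tt_rot (φ z) : tt (rot φ z) = tt z := by
  apply tt_mk_of (tt_pos z).le
  rw [tt_sq]; linear_combination (- aa z ^ 2 - bb z ^ 2) * (Real.sin_sq_add_cos_sq φ)

@[simp] lemma aa_boost (s z) : aa (boost s z) = Real.cosh s * aa z + Real.sinh s * tt z := by simp [boost]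
@[simp] lemma bb_boost (s z) : bb (boost s z) = bb z := by simp [boost]
@[simp] lemma tt_boost (s z) : tt (boost s z) = Real.cosh s * tt z + Real.sinh s * aa z := by
  apply tt_mk_of
  · have h1 : |aa z| ≤ tt z := by
      apply abs_le_of_sq_le_sq _ (tt_pos z).le
      rw [tt_sq]; nlinarith [sq_nonneg (bb z)]
    have h2 : |Real.sinh s| ≤ Real.cosh s := by
      apply abs_le_of_sq_le_sq _ (Real.cosh_pos s).le
      rw [Real.cosh_sq]; linarith
    have h3 : |Real.sinh s * aa z| ≤ Real.cosh s * tt z := by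
      rw [abs_mul]; exact mul_le_mul h2 h1 (abs_nonneg _) (Real.cosh_pos s).le
    have := neg_abs_le (Real.sinh s * aa z)
    linarith
  · linear_combination tt_sq z + (tt z ^ 2 - aa z ^ 2) * Real.cosh_sq s

lemma rot_rot (φ ψ : ℝ) (z) : rot φ (rot ψ z) = rot (φ + ψ) z := by
  apply ext' <;> simp [cos_add, sin_add] <;> ring
lemma boost_boost (s r : ℝ) (z) : boost s (boost r z) = boost (s + r) z := by
  apply ext' <;> simp [Real.cosh_add, Real.sinh_add] ; ring
@[simp] lemma rot_zero (z) : rot 0 z = z := by apply ext' <;> simp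
@[simp] lemma boost_zero (z) : boost 0 z = z := by apply ext' <;> simp

lemma B_rot (φ z w) : B (rot φ z) (rot φ w) = B z w := by
  unfold B; simp only [tt_rot, aa_rot, bb_rot]
  linear_combination (- aa z * aa w - bb z * bb w) * (Real.sin_sq_add_cos_sq φ)
lemma B_boost (s z w) : B (boost s z) (boost s w) = B z w := by
  unfold B; simp only [tt_boost, aa_boost, bb_boost]
  linear_combination (tt z * tt w - aa z * aa w) * Real.cosh_sq s
lemma D_rot (φ x y z) : D (rot φ x) (rot φ y) (rot φ z) = D x y z := by
  unfold D; simp only [tt_rot, aa_rot, bb_rot]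
  linear_combination (tt z * (aa x * bb y - bb x * aa y) - aa z * (tt x * bb y - bb x * tt y) + bb z * (tt x * aa y - aa x * tt y)) * (Real.sin_sq_add_cos_sq φ)
lemma D_boost (s x y z) : D (boost s x) (boost s y) (boost s z) = D x y z := by
  unfold D; simp only [tt_boost, aa_boost, bb_boost]
  linear_combination (tt z * (aa x * bb y - bb x * aa y) - aa z * (tt x * bb y - bb x * tt y) + bb z * (tt x * aa y - aa x * tt y)) * Real.cosh_sq s

/-- polar coordinates -/
def pol (s θ : ℝ) : ℍ := mk (Real.sinh s * cos θ) (Real.sinh s * sin θ)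
@[simp] lemma aa_pol (s θ) : aa (pol s θ) = Real.sinh s * cos θ := by simp [pol]
@[simp] lemma bb_pol (s θ) : bb (pol s θ) = Real.sinh s * sin θ := by simp [pol]
@[simp] lemma tt_pol (s θ) : tt (pol s θ) = Real.cosh s := by
  apply tt_mk_of (Real.cosh_pos s).le
  rw [Real.cosh_sq]; linear_combination (- Real.sinh s ^ 2) * Real.sin_sq_add_cos_sq θ

lemma rot_pol (φ s θ) : rot φ (pol s θ) = pol s (φ + θ) := by
  apply ext' <;> simp [cos_add, sin_add] <;> ring
@[simp] lemma pol_zero (θ) : pol 0 θ = o := by apply ext' <;> simp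
lemma boost_pol (s r) : boost s (pol r 0) = pol (s + r) 0 := by
  apply ext' <;> simp [Real.sinh_add]; ring

lemma dist_o_pol {s : ℝ} (hs : 0 ≤ s) (θ : ℝ) : dist o (pol s θ) = s := by
  apply dist_eq_of_B hs; simp [B]

lemma exists_pol (z : ℍ) : ∃ θ ∈ Set.Ico 0 (2 * π), z = pol (dist o z) θ := by
  have h1 : Real.cosh (dist o z) = tt z := by rw [cosh_dist_eq]; simp [B]
  have h2 : Real.sinh (dist o z) = ‖(⟨aa z, bb z⟩ : ℂ)‖ := by
    have h3 := Real.cosh_sq (dist o z)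
    rw [h1, tt_sq] at h3
    rw [Complex.norm_def, Complex.normSq_mk]
    rw [← Real.sqrt_sq (Real.sinh_nonneg_iff.2 dist_nonneg)]
    congr 1; linarith
  set w : ℂ := ⟨aa z, bb z⟩
  have hc : ‖w‖ * cos (Complex.arg w) = aa z := Complex.norm_mul_cos_arg w
  have hs : ‖w‖ * sin (Complex.arg w) = bb z := Complex.norm_mul_sin_arg w
  have hm := Complex.arg_mem_Ioc w
  by_cases h0 : 0 ≤ Complex.arg w
  · refine ⟨Complex.arg w, ⟨h0, by linarith [hm.2, Real.pi_pos]⟩, ?_⟩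
    apply ext' <;> simp [h2, hc, hs]
  · refine ⟨Complex.arg w + 2 * π, ⟨by linarith [hm.1, Real.pi_pos], by linarith⟩, ?_⟩
    apply ext' <;> simp [h2, hc, hs]

lemma continuous_tt : Continuous tt := by
  unfold tt
  refine Continuous.div ?_ ?_ (fun z => by have := z.im_pos; positivity)
  · exact ((UpperHalfPlane.continuous_re.pow 2).add (UpperHalfPlane.continuous_im.pow 2)).add continuous_const
  · exact continuous_const.mul UpperHalfPlane.continuous_im
lemma continuous_aa : Continuous aa := by
  unfold aa
  refine Continuous.div ?_ ?_ (fun z => by have := z.im_pos; positivity)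
  · exact ((UpperHalfPlane.continuous_re.pow 2).add (UpperHalfPlane.continuous_im.pow 2)).sub continuous_const
  · exact continuous_const.mul UpperHalfPlane.continuous_im
lemma continuous_bb : Continuous bb := by
  unfold bb
  exact UpperHalfPlane.continuous_re.div UpperHalfPlane.continuous_im (fun z => z.im_pos.ne')

lemma continuous_mk : Continuous (fun p : ℝ × ℝ => mk p.1 p.2) := by
  rw [UpperHalfPlane.isEmbedding_coe.continuous_iff]
  have h : Continuous (fun p : ℝ × ℝ => √(1 + p.1 ^ 2 + p.2 ^ 2) - p.1) := by fun_prop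
  have hne : ∀ p : ℝ × ℝ, √(1 + p.1 ^ 2 + p.2 ^ 2) - p.1 ≠ 0 := fun p => (sqrt_sub_pos _ _).ne'
  have h1 : Continuous (fun p : ℝ × ℝ => (⟨p.2 / (√(1 + p.1 ^ 2 + p.2 ^ 2) - p.1), 1 / (√(1 + p.1 ^ 2 + p.2 ^ 2) - p.1)⟩ : ℂ)) := by
    have := Complex.equivRealProdCLM.symm.continuous.comp
      ((continuous_snd.div h hne).prodMk (continuous_const.div h hne) : Continuous (fun p : ℝ × ℝ => (p.2 / (√(1 + p.1 ^ 2 + p.2 ^ 2) - p.1), (1:ℝ) / (√(1 + p.1 ^ 2 + p.2 ^ 2) - p.1))))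
    exact this
  exact h1

lemma continuous_D (p q : ℍ) : Continuous (D p q) := by
  unfold D
  exact ((continuous_tt.mul continuous_const).sub (continuous_aa.mul continuous_const)).add
    (continuous_bb.mul continuous_const)
lemma continuous_rot (φ) : Continuous (rot φ) := by
  have := continuous_mk.comp (((continuous_const (y := cos φ)).mul continuous_aa |>.sub ((continuous_const (y := sin φ)).mul continuous_bb)).prodMk
     ((continuous_const (y := sin φ)).mul continuous_aa |>.add ((continuous_const (y := cos φ)).mul continuous_bb)))
  exact this
lemma continuous_boost (s) : Continuous (boost s) := by
  have := continuous_mk.comp (((continuous_const (y := Real.cosh s)).mul continuous_aa |>.add ((continuous_const (y := Real.sinh s)).mul continuous_tt)).prodMk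
     continuous_bb)
  exact this

end HB
end

noncomputable section
open MeasureTheory Metric Real UpperHalfPlane
open scoped UpperHalfPlane ENNReal
namespace HB

/-- the linear map of a planar matrix -/
def lin2 (α β γ δ : ℝ) : ℝ × ℝ →L[ℝ] ℝ × ℝ :=
  (α • ContinuousLinearMap.fst ℝ ℝ ℝ + β • ContinuousLinearMap.snd ℝ ℝ ℝ).prod
    (γ • ContinuousLinearMap.fst ℝ ℝ ℝ + δ • ContinuousLinearMap.snd ℝ ℝ ℝ)

lemma det_lin2 (α β γ δ : ℝ) : (lin2 α β γ δ).det = α * δ - β * γ := by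
  unfold lin2
  rw [← Matrix.toLin_finTwoProd_toContinuousLinearMap]
  simp only [LinearMap.det_toContinuousLinearMap, LinearMap.det_toLin, Matrix.det_fin_two_of]

lemma measurableEmbedding_coe' : MeasurableEmbedding (fun z : ℍ => (z : ℂ)) :=
  UpperHalfPlane.isOpenEmbedding_coe.measurableEmbedding

/-- the hyperboloid parametrization in half-plane coordinates -/
def Fch (p : ℝ × ℝ) : ℝ × ℝ :=
  (p.2 / (√(1 + p.1 ^ 2 + p.2 ^ 2) - p.1), 1 / (√(1 + p.1 ^ 2 + p.2 ^ 2) - p.1))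

lemma Fch_inj : Function.Injective Fch := by
  intro p q h
  have h1 : mk p.1 p.2 = mk q.1 q.2 := by
    apply UpperHalfPlane.ext
    apply Complex.ext
    · exact congrArg Prod.fst h
    · exact congrArg Prod.snd h
  apply Prod.ext
  · have := congrArg aa h1; simpa using this
  · have := congrArg bb h1; simpa using this

lemma hasFDerivAt_sqrtT (p : ℝ × ℝ) : HasFDerivAt (fun p : ℝ × ℝ => √(1 + p.1 ^ 2 + p.2 ^ 2))
    ((p.1 / √(1 + p.1 ^ 2 + p.2 ^ 2)) • ContinuousLinearMap.fst ℝ ℝ ℝ +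
      (p.2 / √(1 + p.1 ^ 2 + p.2 ^ 2)) • ContinuousLinearMap.snd ℝ ℝ ℝ) p := by
  have h1 : HasFDerivAt (fun p : ℝ × ℝ => 1 + p.1 ^ 2 + p.2 ^ 2)
      ((2 * p.1) • ContinuousLinearMap.fst ℝ ℝ ℝ + (2 * p.2) • ContinuousLinearMap.snd ℝ ℝ ℝ) p := by
    have := ((hasFDerivAt_fst (𝕜 := ℝ) (p := p)).pow 2).const_add 1 |>.add ((hasFDerivAt_snd (𝕜 := ℝ) (p := p)).pow 2)
    exact this.congr_fderiv (by ext <;> simp)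
  have h2 := h1.sqrt (by positivity)
  refine h2.congr_fderiv ?_
  have : √(1 + p.1 ^ 2 + p.2 ^ 2) ≠ 0 := by positivity
  ext <;> simp <;> field_simp

lemma hasFDerivAt_Fch (p : ℝ × ℝ) : HasFDerivAt Fch
    (lin2 (p.2 * ((1 - p.1 / √(1 + p.1 ^ 2 + p.2 ^ 2)) / (√(1 + p.1 ^ 2 + p.2 ^ 2) - p.1) ^ 2))
      (1 / (√(1 + p.1 ^ 2 + p.2 ^ 2) - p.1)
        - p.2 * ((p.2 / √(1 + p.1 ^ 2 + p.2 ^ 2)) / (√(1 + p.1 ^ 2 + p.2 ^ 2) - p.1) ^ 2))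
      ((1 - p.1 / √(1 + p.1 ^ 2 + p.2 ^ 2)) / (√(1 + p.1 ^ 2 + p.2 ^ 2) - p.1) ^ 2)
      (-((p.2 / √(1 + p.1 ^ 2 + p.2 ^ 2)) / (√(1 + p.1 ^ 2 + p.2 ^ 2) - p.1) ^ 2))) p := by
  have hp := sqrt_sub_pos p.1 p.2
  have h1 := (hasFDerivAt_sqrtT p).sub (hasFDerivAt_fst (𝕜 := ℝ) (p := p))
  have h2 := (hasDerivAt_inv hp.ne').comp_hasFDerivAt p h1
  have h3 := (hasFDerivAt_snd (𝕜 := ℝ) (p := p)).mul h2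
  have h4 := h3.prodMk h2
  have hfun : Fch = fun x : ℝ × ℝ => (x.2 * (fun x => x⁻¹) (√(1 + x.1 ^ 2 + x.2 ^ 2) - x.1), (fun x => x⁻¹) (√(1 + x.1 ^ 2 + x.2 ^ 2) - x.1)) := by
    funext x; simp only [Fch, div_eq_mul_inv, one_mul]
  rw [hfun]
  refine h4.congr_fderiv ?_
  unfold lin2
  have : √(1 + p.1 ^ 2 + p.2 ^ 2) ≠ 0 := by positivity
  have := hp.ne'
  ext <;> simp <;> field_simp <;> ring

lemma hyp_apply {S : Set ℍ} (hS : MeasurableSet S) : hypAreaMeasure S =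
    ∫⁻ p in {p : ℝ × ℝ | mk p.1 p.2 ∈ S}, ENNReal.ofReal (1 / √(1 + p.1 ^ 2 + p.2 ^ 2)) := by
  have hT : MeasurableSet {p : ℝ × ℝ | mk p.1 p.2 ∈ S} := continuous_mk.measurable hS
  have e1 : hypAreaMeasure S = ∫⁻ z : ℂ in (fun z : ℍ => (z:ℂ)) '' S, ENNReal.ofReal ((z.im ^ 2)⁻¹) := by
    unfold hypAreaMeasure
    rw [withDensity_apply _ hS]
    have hr : (volume : Measure ℂ).restrict ((fun z : ℍ => (z:ℂ)) '' S)
        = Measure.map (fun z : ℍ => (z:ℂ)) ((Measure.comap (fun z : ℍ => (z:ℂ)) volume).restrict S) := by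
      have := measurableEmbedding_coe'.restrict_map (Measure.comap (fun z : ℍ => (z:ℂ)) volume) ((fun z : ℍ => (z:ℂ)) '' S)
      rw [measurableEmbedding_coe'.injective.preimage_image] at this
      rw [← this, measurableEmbedding_coe'.map_comap, Measure.restrict_restrict_of_subset (Set.image_subset_range _ _)]
    rw [hr, measurableEmbedding_coe'.lintegral_map]
    rfl
  have e2 : ∫⁻ z : ℂ in (fun z : ℍ => (z:ℂ)) '' S, ENNReal.ofReal ((z.im ^ 2)⁻¹)
      = ∫⁻ p in Fch '' {p : ℝ × ℝ | mk p.1 p.2 ∈ S}, ENNReal.ofReal ((p.2 ^ 2)⁻¹) := by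
    rw [← (Complex.volume_preserving_equiv_real_prod.symm).setLIntegral_comp_preimage_emb Complex.measurableEquivRealProd.symm.measurableEmbedding]
    congr 2
    ext p
    simp only [Set.mem_preimage, Set.mem_image, Set.mem_ofPred_eq]
    constructor
    · rintro ⟨z, hz, he⟩
      refine ⟨(aa z, bb z), by simpa using hz, ?_⟩
      have : mk (aa z) (bb z) = z := mk_aa_bb z
      have h1 : (mk (aa z) (bb z) : ℂ) = Complex.measurableEquivRealProd.symm p := by rw [this, he]
      apply Prod.ext
      · exact congrArg Complex.re h1
      · exact congrArg Complex.im h1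
    · rintro ⟨q, hq, rfl⟩
      exact ⟨_, hq, Complex.ext rfl rfl⟩
  rw [e1, e2, lintegral_image_eq_lintegral_abs_det_fderiv_mul volume hT
    (fun p _ => (hasFDerivAt_Fch p).hasFDerivWithinAt) (Fch_inj.injOn)]
  apply lintegral_congr
  intro p
  rw [← ENNReal.ofReal_mul (abs_nonneg _), det_lin2]
  congr 1
  have hp := sqrt_sub_pos p.1 p.2
  have ht : 0 < √(1 + p.1 ^ 2 + p.2 ^ 2) := by positivity
  simp only [Fch]
  generalize √(1 + p.1 ^ 2 + p.2 ^ 2) = t at *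
  have : p.2 * ((1 - p.1 / t) / (t - p.1) ^ 2) * -(p.2 / t / (t - p.1) ^ 2) -
          (1 / (t - p.1) - p.2 * (p.2 / t / (t - p.1) ^ 2)) * ((1 - p.1 / t) / (t - p.1) ^ 2)
      = - (1 / (t * (t - p.1) ^ 2)) := by
    field_simp; ring
  rw [this, abs_neg, abs_of_pos (by positivity)]
  field_simp

/-- Fermi (equidistant) coordinates -/
def st (u w : ℝ) : ℍ := mk (√(1 + w ^ 2) * Real.sinh u) w

@[simp] lemma aa_st (u w) : aa (st u w) = √(1 + w ^ 2) * Real.sinh u := by simp [st]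
@[simp] lemma bb_st (u w) : bb (st u w) = w := by simp [st]
@[simp] lemma tt_st (u w) : tt (st u w) = √(1 + w ^ 2) * Real.cosh u := by
  apply tt_mk_of (by have := Real.cosh_pos u; positivity)
  have : √(1 + w ^ 2) ^ 2 = 1 + w ^ 2 := Real.sq_sqrt (by positivity)
  rw [mul_pow, mul_pow, this, Real.cosh_sq]; ring

lemma boost_st (s u w) : boost s (st u w) = st (s + u) w := by
  apply ext' <;> simp [Real.sinh_add]; ring

lemma exists_st (z : ℍ) : ∃ u, z = st u (bb z) := by
  refine ⟨Real.arsinh (aa z / √(1 + bb z ^ 2)), ?_⟩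
  apply ext' <;> simp
  have : √(1 + bb z ^ 2) ≠ 0 := by positivity
  field_simp

/-- Fermi chart to hyperboloid chart -/
def Gch (p : ℝ × ℝ) : ℝ × ℝ := (√(1 + p.2 ^ 2) * Real.sinh p.1, p.2)

lemma Gch_inj : Function.Injective Gch := by
  intro p q h
  have h1 : √(1 + p.2 ^ 2) * Real.sinh p.1 = √(1 + q.2 ^ 2) * Real.sinh q.1 := congrArg (fun x : ℝ × ℝ => x.1) h
  have h2 : p.2 = q.2 := (Prod.ext_iff.1 h).2
  rw [h2] at h1
  exact Prod.ext (Real.sinh_injective (mul_left_cancel₀ (by positivity) h1)) h2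

lemma hasDerivAt_sqrt1 (x : ℝ) : HasDerivAt (fun w : ℝ => √(1 + w ^ 2)) (x / √(1 + x ^ 2)) x := by
  have h0 : HasDerivAt (fun w : ℝ => 1 + w ^ 2) (2 * x) x := by
    simpa using (hasDerivAt_pow 2 x).const_add 1
  have := h0.sqrt (by positivity)
  refine this.congr_deriv ?_
  field_simp

lemma hasFDerivAt_Gch (p : ℝ × ℝ) : HasFDerivAt Gch
    (lin2 (√(1 + p.2 ^ 2) * Real.cosh p.1) (Real.sinh p.1 * (p.2 / √(1 + p.2 ^ 2))) 0 1) p := by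
  have h1 := hasDerivAt_sqrt1 p.2
  have h2 := h1.comp_hasFDerivAt p (hasFDerivAt_snd (𝕜 := ℝ) (p := p))
  have h3 := (Real.hasDerivAt_sinh p.1).comp_hasFDerivAt p (hasFDerivAt_fst (𝕜 := ℝ) (p := p))
  have h4 := (h2.mul h3).prodMk (hasFDerivAt_snd (𝕜 := ℝ) (p := p))
  refine h4.congr_fderiv ?_
  unfold lin2
  ext <;> simp

lemma uw_apply {S : Set ℍ} (hS : MeasurableSet S) : hypAreaMeasure S =
    volume {p : ℝ × ℝ | st p.1 p.2 ∈ S} := by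
  have hc : Continuous (fun p : ℝ × ℝ => st p.1 p.2) := by
    have : Continuous (fun p : ℝ × ℝ => (√(1 + p.2 ^ 2) * Real.sinh p.1, p.2)) := by fun_prop
    exact continuous_mk.comp this
  have hT : MeasurableSet {p : ℝ × ℝ | st p.1 p.2 ∈ S} := hc.measurable hS
  have e : {p : ℝ × ℝ | mk p.1 p.2 ∈ S} = Gch '' {p : ℝ × ℝ | st p.1 p.2 ∈ S} := by
    ext p
    simp only [Set.mem_image, Set.mem_ofPred_eq]
    constructor
    · intro h
      obtain ⟨u, hu⟩ := exists_st (mk p.1 p.2)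
      simp only [bb_mk] at hu
      refine ⟨(u, p.2), by simpa [← hu] using h, ?_⟩
      have := congrArg aa hu
      simp only [aa_mk, aa_st] at this
      exact Prod.ext this.symm rfl
    · rintro ⟨q, hq, rfl⟩
      exact hq
  rw [hyp_apply hS, e, lintegral_image_eq_lintegral_abs_det_fderiv_mul volume hT
    (fun p _ => (hasFDerivAt_Gch p).hasFDerivWithinAt) (Gch_inj.injOn), ← setLIntegral_one]
  apply lintegral_congr
  intro p
  rw [← ENNReal.ofReal_mul (abs_nonneg _), det_lin2, ← ENNReal.ofReal_one]
  congr 1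
  have h1 : 0 < √(1 + p.2 ^ 2) * Real.cosh p.1 := by have := Real.cosh_pos p.1; positivity
  have h2 := tt_st p.1 p.2
  rw [tt_eq, aa_st, bb_st] at h2
  simp only [Gch]
  rw [h2, mul_zero, sub_zero, mul_one, abs_of_pos h1]
  field_simp

lemma measure_boost (s : ℝ) {S : Set ℍ} (hS : MeasurableSet S) :
    hypAreaMeasure (boost s ⁻¹' S) = hypAreaMeasure S := by
  rw [uw_apply hS, uw_apply ((continuous_boost s).measurable hS)]
  have : {p : ℝ × ℝ | st p.1 p.2 ∈ boost s ⁻¹' S} = (fun p : ℝ × ℝ => ((s, 0) : ℝ × ℝ) + p) ⁻¹' {p : ℝ × ℝ | st p.1 p.2 ∈ S} := by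
    ext p
    simp [boost_st]
  rw [this, measure_preimage_add]

lemma measure_rot (φ : ℝ) {S : Set ℍ} (hS : MeasurableSet S) :
    hypAreaMeasure (rot φ ⁻¹' S) = hypAreaMeasure S := by
  rw [hyp_apply hS, hyp_apply ((continuous_rot φ).measurable hS)]
  set L : ℝ × ℝ →L[ℝ] ℝ × ℝ := lin2 (cos φ) (-sin φ) (sin φ) (cos φ)
  have hdet : L.det = 1 := by rw [det_lin2]; nlinarith [Real.sin_sq_add_cos_sq φ]
  have hmp : MeasurePreserving (L : ℝ × ℝ → ℝ × ℝ) volume volume := by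
    refine ⟨L.continuous.measurable, ?_⟩
    ext s hs
    rw [Measure.map_apply L.continuous.measurable hs]
    have := Measure.addHaar_preimage_linearMap (volume : Measure (ℝ × ℝ)) (f := (L : ℝ × ℝ →ₗ[ℝ] ℝ × ℝ)) (by
      change L.det ≠ 0; rw [hdet]; norm_num) s
    have h2 : LinearMap.det (L : ℝ × ℝ →ₗ[ℝ] ℝ × ℝ) = 1 := hdet
    rw [h2] at this
    simpa using this
  have hf : Measurable (fun p : ℝ × ℝ => ENNReal.ofReal (1 / √(1 + p.1 ^ 2 + p.2 ^ 2))) := by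
    fun_prop
  have hM : MeasurableSet {p : ℝ × ℝ | mk p.1 p.2 ∈ S} := continuous_mk.measurable hS
  rw [← hmp.setLIntegral_comp_preimage hM hf]
  have hL : ∀ p, L p = (cos φ * p.1 - sin φ * p.2, sin φ * p.1 + cos φ * p.2) := by
    intro p
    simp [L, lin2]; ring
  have : {p : ℝ × ℝ | mk p.1 p.2 ∈ rot φ ⁻¹' S} = (L : ℝ × ℝ → ℝ × ℝ) ⁻¹' {p : ℝ × ℝ | mk p.1 p.2 ∈ S} := by
    ext p
    simp [hL, rot]
  rw [this]
  apply lintegral_congr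
  intro p
  rw [hL]
  congr 3
  simp only
  linear_combination (-(p.1 ^ 2 + p.2 ^ 2)) * (Real.sin_sq_add_cos_sq φ)

/-- polar coordinates formula -/
lemma polar_apply {S : Set ℍ} (hS : MeasurableSet S) : hypAreaMeasure S =
    ∫⁻ p in Set.Ioi (0:ℝ) ×ˢ Set.Ioo (-π) π, Set.indicator {p : ℝ × ℝ | mk (p.1 * cos p.2) (p.1 * sin p.2) ∈ S}
      (fun p => ENNReal.ofReal (p.1 / √(1 + p.1 ^ 2))) p := by
  have hM : MeasurableSet {p : ℝ × ℝ | mk p.1 p.2 ∈ S} := continuous_mk.measurable hS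
  rw [hyp_apply hS, ← lintegral_indicator hM, ← lintegral_comp_polarCoord_symm]
  apply setLIntegral_congr_fun polarCoord.open_target.measurableSet
  intro p hp
  have hp1 : 0 < p.1 := hp.1
  beta_reduce
  rw [show polarCoord.symm p = (p.1 * cos p.2, p.1 * sin p.2) from polarCoord_symm_apply p]
  simp only [Set.indicator, smul_eq_mul, Set.mem_ofPred_eq, mul_ite, mul_zero]
  split_ifs
  · rw [← ENNReal.ofReal_mul hp1.le]
    congr 1
    have : 1 + (p.1 * cos p.2) ^ 2 + (p.1 * sin p.2) ^ 2 = 1 + p.1 ^ 2 := by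
      linear_combination p.1 ^ 2 * Real.sin_sq_add_cos_sq p.2
    rw [this]; ring
  · rfl

lemma lint_radial {r : ℝ} (hr : 0 ≤ r) :
    ∫⁻ x in Set.Ioo 0 (Real.sinh r), ENNReal.ofReal (x / √(1 + x ^ 2)) = ENNReal.ofReal (Real.cosh r - 1) := by
  have hs : 0 ≤ Real.sinh r := Real.sinh_nonneg_iff.2 hr
  have hc : Continuous (fun x : ℝ => x / √(1 + x ^ 2)) := by
    apply Continuous.div (by fun_prop) (by fun_prop)
    intro x; positivity
  have hI : IntegrableOn (fun x : ℝ => x / √(1 + x ^ 2)) (Set.Ioc 0 (Real.sinh r)) := by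
    exact (hc.integrableOn_Icc).mono_set Set.Ioc_subset_Icc_self
  rw [← setLIntegral_congr Ioo_ae_eq_Ioc.symm, ← ofReal_integral_eq_lintegral_ofReal hI]
  · congr 1
    rw [← intervalIntegral.integral_of_le hs]
    have hd : ∀ x ∈ Set.uIcc 0 (Real.sinh r), HasDerivAt (fun x : ℝ => √(1 + x ^ 2)) (x / √(1 + x ^ 2)) x := by
      exact fun x _ => hasDerivAt_sqrt1 x
    rw [intervalIntegral.integral_eq_sub_of_hasDerivAt hd (hc.intervalIntegrable _ _)]
    have : 1 + Real.sinh r ^ 2 = Real.cosh r ^ 2 := by rw [Real.cosh_sq]; ring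
    rw [this, Real.sqrt_sq (Real.cosh_pos r).le]; simp
  · filter_upwards [ae_restrict_mem measurableSet_Ioc] with x hx
    have := hx.1
    positivity

lemma mk_pol {r φ : ℝ} : mk (r * cos φ) (r * sin φ) = pol (Real.arsinh r) φ := by
  simp [pol]

lemma lint_prod (r : ℝ) (hr : 0 ≤ r) (J : Set ℝ) :
    ∫⁻ p in Set.Ioo (0:ℝ) (Real.sinh r) ×ˢ J, ENNReal.ofReal (p.1 / √(1 + p.1 ^ 2))
      = ENNReal.ofReal (Real.cosh r - 1) * volume J := by
  rw [Measure.volume_eq_prod, ← Measure.prod_restrict]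
  rw [lintegral_prod]
  · simp only [lintegral_const, Measure.restrict_apply_univ]
    rw [lintegral_mul_const _ (by fun_prop), lint_radial hr]
  · apply Measurable.aemeasurable; fun_prop

lemma polar_lower {S : Set ℍ} (hS : MeasurableSet S) {r : ℝ} (hr : 0 ≤ r) {J : Set ℝ} (hJ : MeasurableSet J)
    (hJ' : J ⊆ Set.Ioo (-π) π) (h : ∀ s φ, 0 < s → s < r → φ ∈ J → pol s φ ∈ S) :
    ENNReal.ofReal (Real.cosh r - 1) * volume J ≤ hypAreaMeasure S := by
  rw [polar_apply hS, ← lint_prod r hr]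
  have hsub : Set.Ioo (0:ℝ) (Real.sinh r) ×ˢ J ⊆ Set.Ioi (0:ℝ) ×ˢ Set.Ioo (-π) π :=
    Set.prod_mono (fun x hx => hx.1) hJ'
  refine le_trans ?_ (lintegral_mono_set hsub)
  apply setLIntegral_mono_ae' (measurableSet_Ioo.prod hJ)
  filter_upwards with p hp
  rw [Set.indicator_of_mem]
  simp only [Set.mem_ofPred_eq, mk_pol]
  apply h _ _ _ _ hp.2
  · exact Real.arsinh_pos_iff.2 hp.1.1
  · rw [← Real.arsinh_sinh r]; exact Real.arsinh_lt_arsinh.2 hp.1.2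

lemma polar_upper {S : Set ℍ} (hS : MeasurableSet S) {r : ℝ} (hr : 0 ≤ r) {J : Set ℝ} (hJ : MeasurableSet J)
    (h : ∀ s φ, 0 < s → φ ∈ Set.Ioo (-π) π → pol s φ ∈ S → s ≤ r ∧ φ ∈ J) :
    hypAreaMeasure S ≤ ENNReal.ofReal (Real.cosh r - 1) * volume J := by
  have hae : (Set.Ioo (0:ℝ) (Real.sinh r) ×ˢ J : Set (ℝ × ℝ)) =ᵐ[volume] (Set.Ioc (0:ℝ) (Real.sinh r) ×ˢ J : Set (ℝ × ℝ)) := by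
    rw [Measure.volume_eq_prod]
    exact Measure.set_prod_ae_eq Ioo_ae_eq_Ioc (Filter.EventuallyEq.refl _ _)
  rw [polar_apply hS, ← lint_prod r hr, setLIntegral_congr hae]
  rw [← lintegral_indicator (measurableSet_Ioc.prod hJ), ← lintegral_indicator (measurableSet_Ioi.prod measurableSet_Ioo)]
  apply lintegral_mono
  intro p
  simp only [Set.indicator]
  split_ifs with h1 h2 h3 <;> try simp
  exfalso
  simp only [Set.mem_ofPred_eq, mk_pol] at h2
  obtain ⟨h4, h5⟩ := h _ _ (Real.arsinh_pos_iff.2 h1.1) h1.2 h2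
  refine h3 ⟨⟨h1.1, ?_⟩, h5⟩
  rw [← Real.sinh_arsinh p.1]; exact Real.sinh_le_sinh.2 h4

end HB
end

noncomputable section
open MeasureTheory Metric Real UpperHalfPlane
open scoped UpperHalfPlane ENNReal
namespace HB

/-- orientation preserving motions -/
structure Mot where
  f : ℍ → ℍ
  g : ℍ → ℍ
  fg : ∀ z, f (g z) = z
  gf : ∀ z, g (f z) = z
  hB : ∀ z w, B (f z) (f w) = B z w
  hD : ∀ x y z, D (f x) (f y) (f z) = D x y z
  hc : Continuous f
  hcg : Continuous g
  hμ : ∀ S : Set ℍ, MeasurableSet S → hypAreaMeasure (f ⁻¹' S) = hypAreaMeasure S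

namespace Mot

def comp (T U : Mot) : Mot where
  f := fun z => T.f (U.f z)
  g := fun z => U.g (T.g z)
  fg z := by rw [U.fg, T.fg]
  gf z := by rw [T.gf, U.gf]
  hB z w := by rw [T.hB, U.hB]
  hD x y z := by rw [T.hD, U.hD]
  hc := T.hc.comp U.hc
  hcg := U.hcg.comp T.hcg
  hμ S hS := by
    have := U.hμ (T.f ⁻¹' S) (T.hc.measurable hS)
    rw [T.hμ S hS] at this
    exact this

def rotM (φ : ℝ) : Mot where
  f := rot φ
  g := rot (-φ)
  fg z := by rw [rot_rot]; simp
  gf z := by rw [rot_rot]; simp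
  hB := B_rot φ
  hD := D_rot φ
  hc := continuous_rot φ
  hcg := continuous_rot (-φ)
  hμ S hS := measure_rot φ hS

def boostM (s : ℝ) : Mot where
  f := boost s
  g := boost (-s)
  fg z := by rw [boost_boost]; simp
  gf z := by rw [boost_boost]; simp
  hB := B_boost s
  hD := D_boost s
  hc := continuous_boost s
  hcg := continuous_boost (-s)
  hμ S hS := measure_boost s hS

lemma dist_f (T : Mot) (z w : ℍ) : dist (T.f z) (T.f w) = dist z w := by
  apply le_antisymm <;> rw [dist_le_iff, T.hB]

lemma dist_g (T : Mot) (z w : ℍ) : dist (T.g z) (T.g w) = dist z w := by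
  rw [← T.dist_f, T.fg, T.fg]

lemma inj (T : Mot) {z w : ℍ} (h : T.f z = T.f w) : z = w := by
  rw [← T.gf z, h, T.gf]

lemma comb (T : Mot) {f p q : ℍ} {α β : ℝ} (h : Comb f α p β q) : Comb (T.f f) α (T.f p) β (T.f q) := by
  apply comb_of_B
  intro y
  rw [← T.fg y, T.hB, T.hB, T.hB, h.B]

lemma comb' (T : Mot) {f p q : ℍ} {α β : ℝ} (h : Comb (T.f f) α (T.f p) β (T.f q)) : Comb f α p β q := by
  apply comb_of_B
  intro y
  rw [← T.hB f y, h.B, T.hB, T.hB]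

end Mot

lemma exists_mot (c : ℍ) : ∃ T : Mot, T.f c = o := by
  obtain ⟨θ, -, h⟩ := exists_pol c
  refine ⟨(Mot.boostM (-dist o c)).comp (Mot.rotM (-θ)), ?_⟩
  change boost (-dist o c) (rot (-θ) c) = o
  conv_lhs => rw [h]
  rw [rot_pol, neg_add_cancel, boost_pol]
  rw [← h]; simp

lemma exists_mot2 (p q : ℍ) : ∃ T : Mot, T.f p = o ∧ T.f q = pol (dist p q) 0 := by
  obtain ⟨T, hT⟩ := exists_mot p
  obtain ⟨θ, -, h⟩ := exists_pol (T.f q)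
  rw [← hT, T.dist_f] at h
  refine ⟨(Mot.rotM (-θ)).comp T, ?_, ?_⟩
  · change rot (-θ) (T.f p) = o
    rw [hT]; apply ext' <;> simp
  · change rot (-θ) (T.f q) = _
    rw [h, rot_pol]; simp

/-! ### areas of the model regions -/

def Sec (α β r : ℝ) : Set ℍ :=
  {z | 0 < cos α * bb z - sin α * aa z ∧ 0 < sin β * aa z - cos β * bb z ∧ tt z < Real.cosh r}

def CSec (α β r : ℝ) : Set ℍ :=
  {z | 0 ≤ cos α * bb z - sin α * aa z ∧ 0 ≤ sin β * aa z - cos β * bb z ∧ tt z ≤ Real.cosh r}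

lemma continuous_lf (a b : ℝ) : Continuous (fun z => a * bb z - b * aa z) :=
  (continuous_const.mul continuous_bb).sub (continuous_const.mul continuous_aa)
lemma continuous_lf' (a b : ℝ) : Continuous (fun z => a * aa z - b * bb z) :=
  (continuous_const.mul continuous_aa).sub (continuous_const.mul continuous_bb)

lemma measurable_Sec (α β r) : MeasurableSet (Sec α β r) :=
  ((isOpen_lt continuous_const (continuous_lf _ _)).inter
    ((isOpen_lt continuous_const (continuous_lf' _ _)).inter (isOpen_lt continuous_tt continuous_const))).measurableSet

lemma measurable_CSec (α β r) : MeasurableSet (CSec α β r) :=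
  ((isClosed_le continuous_const (continuous_lf _ _)).inter
    ((isClosed_le continuous_const (continuous_lf' _ _)).inter (isClosed_le continuous_tt continuous_const))).measurableSet

lemma rot_Sec (φ α β r : ℝ) : rot φ ⁻¹' (Sec (φ + α) (φ + β) r) = Sec α β r := by
  ext z
  have h1 : cos (φ + α) * bb (rot φ z) - sin (φ + α) * aa (rot φ z) = cos α * bb z - sin α * aa z := by
    rw [cos_add, sin_add, aa_rot, bb_rot]
    linear_combination (cos α * bb z - sin α * aa z) * Real.sin_sq_add_cos_sq φ
  have h2 : sin (φ + β) * aa (rot φ z) - cos (φ + β) * bb (rot φ z) = sin β * aa z - cos β * bb z := by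
    rw [cos_add, sin_add, aa_rot, bb_rot]
    linear_combination (- cos β * bb z + sin β * aa z) * Real.sin_sq_add_cos_sq φ
  simp only [Sec, Set.mem_preimage, Set.mem_ofPred_eq, h1, h2, tt_rot]

lemma rot_CSec (φ α β r : ℝ) : rot φ ⁻¹' (CSec (φ + α) (φ + β) r) = CSec α β r := by
  ext z
  have h1 : cos (φ + α) * bb (rot φ z) - sin (φ + α) * aa (rot φ z) = cos α * bb z - sin α * aa z := by
    rw [cos_add, sin_add, aa_rot, bb_rot]
    linear_combination (cos α * bb z - sin α * aa z) * Real.sin_sq_add_cos_sq φ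
  have h2 : sin (φ + β) * aa (rot φ z) - cos (φ + β) * bb (rot φ z) = sin β * aa z - cos β * bb z := by
    rw [cos_add, sin_add, aa_rot, bb_rot]
    linear_combination (- cos β * bb z + sin β * aa z) * Real.sin_sq_add_cos_sq φ
  simp only [CSec, Set.mem_preimage, Set.mem_ofPred_eq, h1, h2, tt_rot]

lemma Sec_area {α β r : ℝ} (hβ : β - α < π) (hr : 0 ≤ r) :
    ENNReal.ofReal ((β - α) * (Real.cosh r - 1)) ≤ hypAreaMeasure (Sec α β r) := by
  have h0 := rot_Sec α 0 (β - α) r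
  rw [add_zero, add_sub_cancel] at h0
  rw [← measure_rot α (measurable_Sec α β r), h0]
  have hcr := Real.one_le_cosh r
  have := polar_lower (measurable_Sec 0 (β - α) r) hr (J := Set.Ioo 0 (β - α)) measurableSet_Ioo
    (Set.Ioo_subset_Ioo (by linarith [pi_pos]) hβ.le) (by
      intro s φ hs hsr hφ
      have hsinh := Real.sinh_pos_iff.2 hs
      refine ⟨?_, ?_, ?_⟩
      · have := Real.sin_pos_of_pos_of_lt_pi hφ.1 (hφ.2.trans hβ)
        simp; positivity
      · have := Real.sin_pos_of_pos_of_lt_pi (x := β - α - φ) (by linarith [hφ.2]) (by linarith [hφ.1])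
        rw [sin_sub] at this
        rw [aa_pol, bb_pol]
        nlinarith
      · rw [tt_pol, Real.cosh_lt_cosh, abs_of_pos hs, abs_of_pos (hs.trans hsr)]; exact hsr)
  refine le_trans (le_of_eq ?_) this
  rw [Real.volume_Ioo, sub_zero, mul_comm, ENNReal.ofReal_mul (by linarith)]

lemma CSec_area {α β r : ℝ} (hβ0 : 0 < β - α) (hβ : β - α < π) (hr : 0 ≤ r) :
    hypAreaMeasure (CSec α β r) ≤ ENNReal.ofReal ((β - α) * (Real.cosh r - 1)) := by
  have h0 := rot_CSec α 0 (β - α) r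
  rw [add_zero, add_sub_cancel] at h0
  rw [← measure_rot α (measurable_CSec α β r), h0]
  have hcr := Real.one_le_cosh r
  have := polar_upper (measurable_CSec 0 (β - α) r) hr (J := Set.Icc 0 (β - α)) measurableSet_Icc
    (by
      rintro s φ hs hφ ⟨h1, h2, h3⟩
      have hsinh := Real.sinh_pos_iff.2 hs
      rw [tt_pol, Real.cosh_le_cosh, abs_of_pos hs, abs_of_nonneg hr] at h3
      have h0 : 0 ≤ φ := by
        by_contra hh; push Not at hh
        have := Real.sin_neg_of_neg_of_neg_pi_lt hh hφ.1
        simp at h1; nlinarith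
      refine ⟨h3, h0, ?_⟩
      by_contra hh; push Not at hh
      have := Real.sin_neg_of_neg_of_neg_pi_lt (x := β - α - φ) (by linarith) (by linarith [hφ.2])
      rw [sin_sub] at this
      rw [aa_pol, bb_pol] at h2
      nlinarith)
  refine le_trans this (le_of_eq ?_)
  rw [Real.volume_Icc, sub_zero, mul_comm, ENNReal.ofReal_mul (by linarith)]

lemma ball_area (c : ℍ) {r : ℝ} (hr : 0 ≤ r) :
    hypAreaMeasure (closedBall c r) ≤ ENNReal.ofReal (2 * π * (Real.cosh r - 1)) := by
  obtain ⟨T, hT⟩ := exists_mot c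
  have h : T.f ⁻¹' closedBall o r = closedBall c r := by
    ext z
    rw [Set.mem_preimage, mem_closedBall, mem_closedBall, ← hT, T.dist_f]
  have hm : MeasurableSet (closedBall o r) := isClosed_closedBall.measurableSet
  rw [← h, T.hμ _ hm]
  have := polar_upper hm hr (J := Set.Ioo (-π) π) measurableSet_Ioo (by
    intro s φ hs hφ h
    rw [mem_closedBall, dist_comm, dist_o_pol hs.le] at h
    exact ⟨h, hφ⟩)
  refine le_trans this (le_of_eq ?_)
  rw [Real.volume_Ioo, mul_comm, ← ENNReal.ofReal_mul (by linarith [pi_pos])]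
  congr 1; ring

def S0 (l ε : ℝ) : Set ℍ :=
  {z | 0 < aa z ∧ aa z < √(1 + bb z ^ 2) * Real.sinh l ∧ - Real.sinh ε < bb z ∧ bb z < 0}

lemma continuous_sqb : Continuous (fun z : ℍ => √(1 + bb z ^ 2)) :=
  (continuous_const.add (continuous_bb.pow 2)).sqrt

lemma measurable_S0 (l ε) : MeasurableSet (S0 l ε) :=
  ((isOpen_lt continuous_const continuous_aa).inter
    ((isOpen_lt continuous_aa (continuous_sqb.mul continuous_const)).inter
    ((isOpen_lt continuous_const continuous_bb).inter (isOpen_lt continuous_bb continuous_const)))).measurableSet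

lemma S0_st {u w l ε : ℝ} : st u w ∈ S0 l ε ↔ (0 < u ∧ u < l) ∧ - Real.sinh ε < w ∧ w < 0 := by
  have h : 0 < √(1 + w ^ 2) := by positivity
  simp only [S0, Set.mem_ofPred_eq, aa_st, bb_st, mul_lt_mul_iff_right₀ h, mul_pos_iff_of_pos_left h,
    Real.sinh_pos_iff, Real.sinh_lt_sinh, and_assoc]

lemma S0_area {l ε : ℝ} (hl : 0 ≤ l) :
    hypAreaMeasure (S0 l ε) = ENNReal.ofReal (l * Real.sinh ε) := by
  rw [uw_apply (measurable_S0 l ε)]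
  have : {p : ℝ × ℝ | st p.1 p.2 ∈ S0 l ε} = Set.Ioo 0 l ×ˢ Set.Ioo (-Real.sinh ε) 0 := by
    ext p
    simp only [S0_st, Set.mem_ofPred_eq, Set.mem_prod, Set.mem_Ioo]
  rw [this, Measure.volume_eq_prod, Measure.prod_prod, Real.volume_Ioo, Real.volume_Ioo, ENNReal.ofReal_mul hl]
  simp

/-- half width -/
def hh (ε w : ℝ) : ℝ := Real.arcosh (Real.cosh ε / √(1 + w ^ 2))

lemma measurable_hh (ε) : Measurable (hh ε) := by
  unfold hh Real.arcosh
  fun_prop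

def E0 (l ε : ℝ) : Set ℍ :=
  {z | |bb z| ≤ Real.sinh ε ∧ 0 < Real.arsinh (aa z / √(1 + bb z ^ 2)) + hh ε (bb z) ∧
    Real.arsinh (aa z / √(1 + bb z ^ 2)) + hh ε (bb z) ≤ l}

lemma E0_st {u w l ε : ℝ} : st u w ∈ E0 l ε ↔ |w| ≤ Real.sinh ε ∧ 0 < u + hh ε w ∧ u + hh ε w ≤ l := by
  have h : √(1 + w ^ 2) ≠ 0 := by positivity
  simp only [E0, Set.mem_ofPred_eq, aa_st, bb_st, mul_div_cancel_left₀ _ h, Real.arsinh_sinh]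

lemma measurable_E0 (l ε) : MeasurableSet (E0 l ε) := by
  have hm : Measurable (fun z : ℍ => Real.arsinh (aa z / √(1 + bb z ^ 2)) + hh ε (bb z)) := by
    refine Measurable.add ?_ ((measurable_hh ε).comp continuous_bb.measurable)
    exact (Real.continuous_arsinh.comp (continuous_aa.div continuous_sqb (fun z => by positivity))).measurable
  have h1 : MeasurableSet {z : ℍ | |bb z| ≤ Real.sinh ε} := (isClosed_le continuous_bb.abs continuous_const).measurableSet
  exact h1.inter ((measurableSet_lt measurable_const hm).inter (measurableSet_le hm measurable_const))

lemma E0_area {l ε : ℝ} (hl : 0 ≤ l) (hε : 0 ≤ ε) :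
    hypAreaMeasure (E0 l ε) ≤ ENNReal.ofReal (2 * l * Real.sinh ε) := by
  have hs := Real.sinh_nonneg_iff.2 hε
  have hM : MeasurableSet {p : ℝ × ℝ | st p.1 p.2 ∈ E0 l ε} := by
    have : Continuous (fun p : ℝ × ℝ => (√(1 + p.2 ^ 2) * Real.sinh p.1, p.2)) := by fun_prop
    exact (continuous_mk.comp this).measurable (measurable_E0 l ε)
  rw [uw_apply (measurable_E0 l ε), Measure.volume_eq_prod, Measure.prod_apply_symm hM]
  have hle : ∀ w : ℝ, volume ((fun x : ℝ => (x, w)) ⁻¹' {p : ℝ × ℝ | st p.1 p.2 ∈ E0 l ε}) ≤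
      (Set.Icc (-Real.sinh ε) (Real.sinh ε)).indicator (fun _ => ENNReal.ofReal l) w := by
    intro w
    by_cases hw : |w| ≤ Real.sinh ε
    · rw [Set.indicator_of_mem (show w ∈ Set.Icc (-Real.sinh ε) (Real.sinh ε) from abs_le.1 hw)]
      have : (fun x : ℝ => (x, w)) ⁻¹' {p : ℝ × ℝ | st p.1 p.2 ∈ E0 l ε} ⊆ Set.Ioc (- hh ε w) (l - hh ε w) := by
        intro u hu
        have := (E0_st.1 hu).2
        constructor <;> linarith [this.1, this.2]
      refine (measure_mono this).trans ?_
      rw [Real.volume_Ioc]; apply le_of_eq; congr 1; ring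
    · have : (fun x : ℝ => (x, w)) ⁻¹' {p : ℝ × ℝ | st p.1 p.2 ∈ E0 l ε} = ∅ := by
        ext u
        simp only [Set.mem_preimage, Set.mem_ofPred_eq, E0_st]
        simp [hw]
      rw [this]; simp
  refine (lintegral_mono hle).trans ?_
  rw [lintegral_indicator measurableSet_Icc, setLIntegral_const, Real.volume_Icc, ← ENNReal.ofReal_mul hl]
  apply le_of_eq; congr 1; ring

lemma B_st_pol (u w x : ℝ) : B (st u w) (pol x 0) = √(1 + w ^ 2) * Real.cosh (u - x) := by
  simp only [B, aa_st, bb_st, tt_st, aa_pol, bb_pol, tt_pol, Real.cosh_sub]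
  simp; ring

/-- crossing lemma -/
lemma mem_E0 {l ε x : ℝ} {c : ℍ} (hε : 0 < ε) (hx0 : 0 ≤ x) (hx : x ≤ l) (h1 : dist c (pol x 0) < ε)
    (h2 : ε ≤ dist c (pol l 0)) : c ∈ E0 l ε := by
  obtain ⟨u, hu⟩ := exists_st c
  generalize bb c = w at hu
  subst hu
  have hs : 0 < √(1 + w ^ 2) := by positivity
  have hs2 : √(1 + w ^ 2) ^ 2 = 1 + w ^ 2 := Real.sq_sqrt (by positivity)
  rw [dist_lt_iff' hε.le, B_st_pol] at h1
  have h2' : Real.cosh ε ≤ √(1 + w ^ 2) * Real.cosh (u - l) := by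
    rw [← B_st_pol, ← cosh_dist_eq, Real.cosh_le_cosh, abs_of_pos hε, abs_of_nonneg dist_nonneg]; exact h2
  have hlt : √(1 + w ^ 2) < Real.cosh ε := by
    have := Real.one_le_cosh (u - x)
    nlinarith
  have h3 : 1 ≤ Real.cosh ε / √(1 + w ^ 2) := by rw [le_div_iff₀ hs]; linarith
  have hc : Real.cosh (hh ε w) = Real.cosh ε / √(1 + w ^ 2) := Real.cosh_arcosh h3
  have hn : 0 ≤ hh ε w := Real.arcosh_nonneg h3
  have h4 : |u - x| < hh ε w := by
    rw [← abs_of_nonneg hn, ← Real.cosh_lt_cosh, hc, lt_div_iff₀ hs]; linarith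
  have h5 : hh ε w ≤ |u - l| := by
    rw [← abs_of_nonneg hn, ← Real.cosh_le_cosh, hc, div_le_iff₀ hs]; linarith
  rw [abs_lt] at h4
  rw [E0_st]
  refine ⟨?_, by linarith, ?_⟩
  · apply abs_le_of_sq_le_sq _ (Real.sinh_nonneg_iff.2 hε.le)
    have := Real.cosh_sq ε
    nlinarith
  · rcases le_abs.1 h5 with h | h <;> linarith

lemma st_zero (u : ℝ) : st u 0 = pol u 0 := by apply ext' <;> simp

/-- foot of perpendicular for strips -/
lemma S0_foot {l ε : ℝ} {c : ℍ} (hε : 0 < ε) (hc : c ∈ S0 l ε) :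
    ∃ x, 0 < x ∧ x < l ∧ dist c (pol x 0) < ε ∧ 1 < B c (pol x 0) ∧
      ∀ y, 0 ≤ bb y → B c (pol x 0) * B (pol x 0) y ≤ B c y := by
  obtain ⟨u, hu⟩ := exists_st c
  generalize bb c = w at hu
  subst hu
  obtain ⟨⟨h1, h2⟩, h3, h4⟩ := S0_st.1 hc
  have hs2 : √(1 + w ^ 2) ^ 2 = 1 + w ^ 2 := Real.sq_sqrt (by positivity)
  refine ⟨u, h1, h2, ?_, ?_, ?_⟩
  · rw [dist_lt_iff' hε.le, B_st_pol, sub_self, Real.cosh_zero, mul_one]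
    apply lt_of_pow_lt_pow_left₀ 2 (Real.cosh_pos ε).le
    rw [hs2, Real.cosh_sq]; nlinarith
  · rw [B_st_pol, sub_self, Real.cosh_zero, mul_one]
    apply Real.lt_sqrt_of_sq_lt; nlinarith
  · intro y hy
    rw [B_st_pol, sub_self, Real.cosh_zero, mul_one]
    simp only [B, aa_st, bb_st, tt_st, aa_pol, bb_pol, tt_pol, cos_zero, sin_zero]
    nlinarith

end HB
end

noncomputable section
open MeasureTheory Metric Real UpperHalfPlane
open scoped UpperHalfPlane ENNReal
namespace HB

/-- data of the triangle `o, pol ρ 0, pol ρ' γ` -/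
lemma tri {ρ ρ' γ : ℝ} (hρ : 0 < ρ) (hρ' : 0 < ρ') (hγ : 0 < γ) (hγ' : γ < π) :
    ∃ b b' : ℝ, 0 < b ∧ b < π ∧ 0 < b' ∧ b' < π ∧
      boost (-ρ) (pol ρ' γ) = pol (dist (pol ρ 0) (pol ρ' γ)) (π - b) ∧
      boost (-ρ') (pol ρ (-γ)) = pol (dist (pol ρ 0) (pol ρ' γ)) (π + b') ∧
      sin γ * (Real.cosh ρ + Real.cosh ρ') / (Real.cosh (dist (pol ρ 0) (pol ρ' γ)) + 1) ≤ π - b - b' := by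
  have hsγ : 0 < sin γ := Real.sin_pos_of_pos_of_lt_pi hγ hγ'
  have hS := Real.sinh_pos_iff.2 hρ
  have hS' := Real.sinh_pos_iff.2 hρ'
  have hC2 := Real.cosh_sq ρ
  have hC2' := Real.cosh_sq ρ'
  have hC := Real.cosh_pos ρ
  have hC' := Real.cosh_pos ρ'
  set l := dist (pol ρ 0) (pol ρ' γ) with hl
  have hcl : Real.cosh l = Real.cosh ρ * Real.cosh ρ' - Real.sinh ρ * Real.sinh ρ' * cos γ := by
    rw [hl, cosh_dist_eq]; simp [B]; ring
  -- first base angle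
  have key : ∀ z : ℍ, dist o z = l → bb z ≠ 0 → ∃ φ, z = pol l φ ∧ Real.sinh l ≠ 0 ∧
      ((0 < bb z → 0 < φ ∧ φ < π) ∧ (bb z < 0 → π < φ ∧ φ < 2 * π)) := by
    intro z hz hb
    obtain ⟨φ, hφ, h⟩ := exists_pol z
    rw [hz] at h
    have hsl : 0 ≤ Real.sinh l := Real.sinh_nonneg_iff.2 dist_nonneg
    have hbz : bb z = Real.sinh l * sin φ := by rw [h, bb_pol]
    refine ⟨φ, h, ?_, ?_, ?_⟩
    · intro h0; rw [h0, zero_mul] at hbz; exact hb hbz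
    · intro hpos
      rw [hbz] at hpos
      have hsin : 0 < sin φ := pos_of_mul_pos_right hpos hsl
      refine ⟨lt_of_le_of_ne hφ.1 (by rintro rfl; simp at hsin), ?_⟩
      by_contra hh; push Not at hh
      have := Real.sin_nonneg_of_nonneg_of_le_pi (x := φ - π) (by linarith) (by linarith [hφ.2])
      rw [Real.sin_sub_pi] at this; linarith
    · intro hneg
      rw [hbz] at hneg
      have hsin : sin φ < 0 := by
        by_contra hh; push Not at hh; nlinarith [mul_nonneg hsl hh]
      refine ⟨?_, hφ.2⟩
      by_contra hh; push Not at hh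
      have := Real.sin_nonneg_of_nonneg_of_le_pi hφ.1 hh
      linarith
  have e0 : boost (-ρ) (pol ρ 0) = o := by rw [boost_pol]; simp
  have e0' : boost (-ρ') (pol ρ' 0) = o := by rw [boost_pol]; simp
  have d1 : dist o (boost (-ρ) (pol ρ' γ)) = l := by
    rw [← e0]; exact (Mot.boostM (-ρ)).dist_f _ _
  have d2 : dist o (boost (-ρ') (pol ρ (-γ))) = l := by
    have hd := (Mot.boostM (-ρ')).dist_f (pol ρ' 0) (pol ρ (-γ))
    change dist (boost (-ρ') (pol ρ' 0)) (boost (-ρ') (pol ρ (-γ))) = _ at hd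
    rw [← e0', hd, hl, dist_comm]
    apply le_antisymm <;> rw [dist_le_iff] <;> apply le_of_eq <;> simp [B] <;> ring
  have b1 : 0 < bb (boost (-ρ) (pol ρ' γ)) := by simp; positivity
  have b2 : bb (boost (-ρ') (pol ρ (-γ))) < 0 := by simp; positivity
  obtain ⟨φ, h1, hsl, h2, -⟩ := key _ d1 b1.ne'
  obtain ⟨ψ, h3, -, -, h4⟩ := key _ d2 b2.ne
  obtain ⟨h2, h2'⟩ := h2 b1
  obtain ⟨h4, h4'⟩ := h4 b2
  refine ⟨π - φ, ψ - π, by linarith, by linarith, by linarith, by linarith, ?_, ?_, ?_⟩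
  · rw [h1]; congr 1; ring
  · rw [h3]; congr 1; ring
  · have a1 := congrArg aa h1
    have a2 := congrArg bb h1
    have a3 := congrArg aa h3
    have a4 := congrArg bb h3
    simp only [aa_boost, bb_boost, aa_pol, bb_pol, tt_pol, Real.cosh_neg, Real.sinh_neg, cos_neg, sin_neg] at a1 a2 a3 a4
    have hsum : Real.sinh l ^ 2 * sin (ψ - φ) = sin γ * (Real.cosh ρ + Real.cosh ρ') * (Real.cosh l - 1) := by
      rw [sin_sub, hcl]
      have : Real.sinh l ^ 2 * (sin ψ * cos φ - cos ψ * sin φ) = (Real.sinh l * sin ψ) * (Real.sinh l * cos φ) - (Real.sinh l * cos ψ) * (Real.sinh l * sin φ) := by ring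
      rw [this, ← a1, ← a2, ← a3, ← a4]
      have e1 := Real.cosh_sq ρ
      have e2 := Real.cosh_sq ρ'
      linear_combination (- sin γ * Real.cosh ρ') * e1 - sin γ * Real.cosh ρ * e2
    have hc2 : Real.sinh l ^ 2 = (Real.cosh l - 1) * (Real.cosh l + 1) := by rw [Real.sinh_sq]; ring
    have hne : Real.cosh l - 1 ≠ 0 := by
      intro h; rw [h, zero_mul] at hc2; exact hsl (pow_eq_zero_iff two_ne_zero |>.1 hc2)
    have hp1 : 0 < Real.cosh l + 1 := by have := Real.cosh_pos l; linarith
    have hval : sin γ * (Real.cosh ρ + Real.cosh ρ') / (Real.cosh l + 1) = sin (ψ - φ) := by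
      rw [div_eq_iff hp1.ne']
      apply mul_right_cancel₀ hne
      rw [← hsum, hc2]; ring
    have hpos : 0 < sin (ψ - φ) := by rw [← hval]; positivity
    rw [hval]
    have e : sin (ψ - φ) = sin (π - (ψ - φ)) := (Real.sin_pi_sub _).symm
    have hle : ψ - φ ≤ π := by
      by_contra hh; push Not at hh
      have := Real.sin_nonneg_of_nonneg_of_le_pi (x := ψ - φ - π) (by linarith) (by linarith)
      rw [Real.sin_sub_pi] at this; linarith
    rw [e]
    have := Real.sin_le (x := π - (ψ - φ)) (by linarith)
    linarith

/-- The vertices -/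
def vx (n : ℕ) (ρ : ℕ → ℝ) (i : ℕ) : ℍ := pol (ρ i) (i * (2 * π / n))

structure Poly (n : ℕ) (ρ : ℕ → ℝ) : Prop where
  n3 : 3 ≤ n
  pos : ∀ i, 0 < ρ i
  per : ∀ i, ρ (i + n) = ρ i
  conv : ∀ i j, 0 ≤ D (vx n ρ i) (vx n ρ (i + 1)) (vx n ρ j)

def PQ (n : ℕ) (ρ : ℕ → ℝ) : Set ℍ := {z | ∀ i, 0 ≤ D (vx n ρ i) (vx n ρ (i + 1)) z}

def edge (p q : ℍ) : Set ℍ := {f | ∃ α β : ℝ, 0 ≤ α ∧ 0 ≤ β ∧ Comb f α p β q}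

lemma pol_add_two_pi (s θ : ℝ) : pol s (θ + 2 * π) = pol s θ := by
  apply ext' <;> simp

section
variable {n : ℕ} {ρ : ℕ → ℝ}

lemma Poly.npos (P : Poly n ρ) : (0:ℝ) < n := by
  have := P.n3
  have : (3:ℝ) ≤ n := by exact_mod_cast this
  linarith

lemma Poly.γpos (P : Poly n ρ) : 0 < 2 * π / n := div_pos (by positivity) P.npos

lemma Poly.γlt (P : Poly n ρ) : 2 * π / n < π := by
  have h : (3:ℝ) ≤ n := by exact_mod_cast P.n3
  rw [div_lt_iff₀ P.npos]; nlinarith [pi_pos]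

lemma Poly.nγ (P : Poly n ρ) : (n:ℝ) * (2 * π / n) = 2 * π := by
  have := P.npos
  field_simp

lemma Poly.vx_per (P : Poly n ρ) (i : ℕ) : vx n ρ (i + n) = vx n ρ i := by
  unfold vx
  rw [P.per]
  push_cast
  rw [add_mul, P.nγ, pol_add_two_pi]

lemma Poly.sinγ (P : Poly n ρ) : 0 < sin (2 * π / n) := Real.sin_pos_of_pos_of_lt_pi P.γpos P.γlt

lemma Poly.D_o (P : Poly n ρ) (i : ℕ) : 0 < D (vx n ρ i) (vx n ρ (i + 1)) o := by
  have h1 := Real.sinh_pos_iff.2 (P.pos i)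
  have h2 := Real.sinh_pos_iff.2 (P.pos (i + 1))
  have h3 := P.sinγ
  have : D (vx n ρ i) (vx n ρ (i + 1)) o = Real.sinh (ρ i) * Real.sinh (ρ (i+1)) * sin (2 * π / n) := by
    have e : 2 * π / n = ((i + 1 : ℕ) : ℝ) * (2 * π / n) - i * (2 * π / n) := by push_cast; ring
    conv_rhs => rw [e, sin_sub]
    simp [D, vx]; ring
  rw [this]; positivity

/-- sector decomposition -/
lemma Poly.decomp (P : Poly n ρ) (z : ℍ) : ∃ j < n, ∃ lam mu nu : ℝ, 0 ≤ lam ∧ 0 ≤ mu ∧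
    tt z = lam * tt (vx n ρ j) + mu * tt (vx n ρ (j + 1)) + nu ∧
    aa z = lam * aa (vx n ρ j) + mu * aa (vx n ρ (j + 1)) ∧
    bb z = lam * bb (vx n ρ j) + mu * bb (vx n ρ (j + 1)) := by
  obtain ⟨φ, hφ, hz⟩ := exists_pol z
  have hγ := P.γpos
  have hs := P.sinγ
  set γ := 2 * π / (n:ℝ) with hγdef
  have hdiv : 0 ≤ φ / γ := div_nonneg hφ.1 hγ.le
  set j := ⌊φ / γ⌋₊ with hj
  have hj1 : (j:ℝ) * γ ≤ φ := by
    have := Nat.floor_le hdiv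
    rwa [le_div_iff₀ hγ] at this
  have hj2 : φ < (j + 1) * γ := by
    have := Nat.lt_floor_add_one (φ / γ)
    rwa [div_lt_iff₀ hγ] at this
  have hjn : j < n := by
    rw [hj, Nat.floor_lt hdiv, div_lt_iff₀ hγ, P.nγ]; exact hφ.2
  have hr := Real.sinh_nonneg_iff.2 (dist_nonneg (x := o) (y := z))
  have h1 := Real.sinh_pos_iff.2 (P.pos j)
  have h2 := Real.sinh_pos_iff.2 (P.pos (j + 1))
  have hγl : γ < π := P.γlt
  have s1 : 0 ≤ sin ((j + 1) * γ - φ) := Real.sin_nonneg_of_nonneg_of_le_pi (by linarith) (by linarith)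
  have s2 : 0 ≤ sin (φ - j * γ) := Real.sin_nonneg_of_nonneg_of_le_pi (by linarith) (by linarith)
  generalize hR : dist o z = R at *
  refine ⟨j, hjn, Real.sinh R * sin ((j + 1) * γ - φ) / (sin γ * Real.sinh (ρ j)),
    Real.sinh R * sin (φ - j * γ) / (sin γ * Real.sinh (ρ (j + 1))), _, by positivity, by positivity,
    (add_sub_cancel _ _).symm, ?_, ?_⟩
  · rw [hz]
    simp only [vx, aa_pol, ← hγdef]
    push_cast
    field_simp
    have : sin γ = sin ((j + 1) * γ - j * γ) := by congr 1; ring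
    rw [this, sin_sub, sin_sub, sin_sub]
    ring
  · rw [hz]
    simp only [vx, bb_pol, ← hγdef]
    push_cast
    field_simp
    have : sin γ = sin ((j + 1) * γ - j * γ) := by congr 1; ring
    rw [this, sin_sub, sin_sub, sin_sub]
    ring

lemma D_lin {p q z x y : ℍ} {lam mu nu : ℝ} (ht : tt z = lam * tt x + mu * tt y + nu)
    (ha : aa z = lam * aa x + mu * aa y) (hb : bb z = lam * bb x + mu * bb y) :
    D p q z = lam * D p q x + mu * D p q y + nu * D p q o := by
  unfold D; rw [ht, ha, hb]; simp; ring

lemma D_self1 (p q : ℍ) : D p q p = 0 := by unfold D; ring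
lemma D_self2 (p q : ℍ) : D p q q = 0 := by unfold D; ring

lemma isClosed_PQ : IsClosed (PQ n ρ) := by
  have : PQ n ρ = ⋂ i, {z | 0 ≤ D (vx n ρ i) (vx n ρ (i + 1)) z} := by
    ext z; simp [PQ]
  rw [this]
  exact isClosed_iInter fun i => isClosed_le continuous_const (continuous_D _ _)

lemma Poly.vx_mod (P : Poly n ρ) (i : ℕ) : vx n ρ (i % n) = vx n ρ i ∧ vx n ρ (i % n + 1) = vx n ρ (i + 1) := by
  have h : ∀ k m : ℕ, vx n ρ (m + n * k) = vx n ρ m := by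
    intro k
    induction k with
    | zero => intro m; simp
    | succ k ih => intro m; rw [mul_add, mul_one, ← add_assoc, P.vx_per, ih]
  constructor
  · conv_rhs => rw [← Nat.mod_add_div i n]
    rw [h]
  · conv_rhs => rw [← Nat.mod_add_div i n]
    rw [add_right_comm, h]

lemma Poly.frontier_sub (P : Poly n ρ) : frontier (PQ n ρ) ⊆ ⋃ j : ℕ, edge (vx n ρ j) (vx n ρ (j + 1)) := by
  intro z hz
  have hzQ : z ∈ PQ n ρ := isClosed_PQ.frontier_subset hz
  obtain ⟨j, hj, lam, mu, nu, hl, hm, ht, ha, hb⟩ := P.decomp z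
  have hD := fun i => D_lin (p := vx n ρ i) (q := vx n ρ (i + 1)) ht ha hb
  have hjj := hD j
  rw [D_self1, D_self2] at hjj
  have hz0 := hzQ j
  have hnu : 0 ≤ nu := by
    by_contra hh; push Not at hh
    have := P.D_o j
    nlinarith
  rcases hnu.eq_or_lt with h0 | h0
  · subst h0
    simp only [Set.mem_iUnion]
    exact ⟨j, lam, mu, hl, hm, by linarith, ha, hb⟩
  · exfalso
    have hopen : IsOpen (⋂ i ∈ Finset.range n, {w | 0 < D (vx n ρ i) (vx n ρ (i + 1)) w}) :=
      isOpen_biInter_finset fun i _ => isOpen_lt continuous_const (continuous_D _ _)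
    have hsub : (⋂ i ∈ Finset.range n, {w | 0 < D (vx n ρ i) (vx n ρ (i + 1)) w}) ⊆ PQ n ρ := by
      intro w hw i
      simp only [Set.mem_iInter, Finset.mem_range, Set.mem_ofPred_eq] at hw
      have := hw (i % n) (Nat.mod_lt _ (by have := P.n3; omega))
      rw [(P.vx_mod i).1, (P.vx_mod i).2] at this
      exact this.le
    have hmem : z ∈ ⋂ i ∈ Finset.range n, {w | 0 < D (vx n ρ i) (vx n ρ (i + 1)) w} := by
      simp only [Set.mem_iInter, Finset.mem_range, Set.mem_ofPred_eq]
      intro i _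
      rw [hD]
      have := mul_nonneg hl (P.conv i j)
      have := mul_nonneg hm (P.conv i (j + 1))
      have := mul_pos h0 (P.D_o i)
      linarith
    exact hz.2 (mem_interior.2 ⟨_, hsub, hopen, hmem⟩)

lemma Poly.vx_mem (P : Poly n ρ) (j : ℕ) : vx n ρ j ∈ PQ n ρ := fun i => P.conv i j

lemma Poly.edge_sub (P : Poly n ρ) (j : ℕ) : edge (vx n ρ j) (vx n ρ (j + 1)) ⊆ PQ n ρ := by
  rintro f ⟨α, β, hα, hβ, hf⟩ i
  rw [hf.D]
  have := mul_nonneg hα (P.conv i j)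
  have := mul_nonneg hβ (P.conv i (j + 1))
  linarith

/-- half-open edges are disjoint -/
lemma Poly.half_disj (P : Poly n ρ) {i j : ℕ} (hi : i < n) (hj : j < n) {f : ℍ} {α β α' β' : ℝ} (hα : 0 ≤ α) (hβ : 0 < β)
    (hα' : 0 ≤ α') (hβ' : 0 < β') (hf : Comb f α (vx n ρ i) β (vx n ρ (i + 1)))
    (hf' : Comb f α' (vx n ρ j) β' (vx n ρ (j + 1))) : i = j := by
  have hγ := P.γpos
  have hs := P.sinγ
  have hγl : 2 * π / (n:ℝ) < π := P.γlt
  have hnγ := P.nγ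
  set γ := 2 * π / (n:ℝ) with hγdef
  have key : ∀ k : ℕ, ∀ α β : ℝ, 0 ≤ α → 0 < β → Comb f α (vx n ρ k) β (vx n ρ (k + 1)) →
      ∃ φ, 0 < φ ∧ φ ≤ γ ∧ f = pol (dist o f) (k * γ + φ) := by
    intro k α β hα hβ h
    obtain ⟨φ, hφ, hz⟩ := exists_pol (rot (-(k * γ)) f)
    have h1 := Real.sinh_pos_iff.2 (P.pos k)
    have h2 := Real.sinh_pos_iff.2 (P.pos (k + 1))
    have hd : dist o (rot (-(k * γ)) f) = dist o f := by
      have : o = rot (-(k * γ)) o := by apply ext' <;> simp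
      conv_lhs => rw [this]
      exact (Mot.rotM _).dist_f _ _
    rw [hd] at hz
    have hR := Real.sinh_nonneg_iff.2 (dist_nonneg (x := o) (y := f))
    generalize dist o f = R at *
    have hrot := (Mot.rotM (-(k * γ))).comb h
    change Comb (rot (-(k * γ)) f) α (rot (-(k * γ)) (pol _ _)) β (rot (-(k * γ)) (pol _ _)) at hrot
    rw [rot_pol, rot_pol] at hrot
    have e1 : -(k * γ) + k * γ = 0 := by ring
    have e2 : -(k * γ) + ((k + 1 : ℕ) : ℝ) * γ = γ := by push_cast; ring
    rw [← hγdef, e1, e2, hz] at hrot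
    have ha := hrot.a
    have hb := hrot.b
    simp only [aa_pol, bb_pol, cos_zero, sin_zero, mul_zero, zero_add, mul_one] at ha hb
    have hb1 : 0 < Real.sinh R * sin φ := by rw [hb]; positivity
    have hsφ : 0 < sin φ := pos_of_mul_pos_right hb1 hR
    have hRp : 0 < Real.sinh R := pos_of_mul_pos_left hb1 hsφ.le
    have hφ0 : 0 < φ := lt_of_le_of_ne hφ.1 (by rintro rfl; simp at hsφ)
    have hφπ : φ < π := by
      by_contra hh; push Not at hh
      have := Real.sin_nonneg_of_nonneg_of_le_pi (x := φ - π) (by linarith) (by linarith [hφ.2])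
      rw [Real.sin_sub_pi] at this; linarith
    refine ⟨φ, hφ0, ?_, ?_⟩
    · by_contra hh; push Not at hh
      have h5 := Real.sin_neg_of_neg_of_neg_pi_lt (x := γ - φ) (by linarith) (by linarith)
      rw [sin_sub] at h5
      have h6 : 0 ≤ Real.sinh R * (sin γ * cos φ - cos γ * sin φ) := by
        have : Real.sinh R * (sin γ * cos φ - cos γ * sin φ) = sin γ * (Real.sinh R * cos φ) - cos γ * (Real.sinh R * sin φ) := by ring
        rw [this, ha, hb]
        have : sin γ * (α * Real.sinh (ρ k) + β * (Real.sinh (ρ (k + 1)) * cos γ)) - cos γ * (β * (Real.sinh (ρ (k + 1)) * sin γ)) = sin γ * (α * Real.sinh (ρ k)) := by ring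
        rw [this]; positivity
      nlinarith
    · rw [← rot_pol, ← hz, rot_rot]; simp
  obtain ⟨φ, p1, p2, p3⟩ := key i α β hα hβ hf
  obtain ⟨φ', p1', p2', p3'⟩ := key j α' β' hα' hβ' hf'
  have hfo : Real.sinh (dist o f) ≠ 0 := by
    intro h0
    have hao : aa f = 0 := by rw [p3, aa_pol, h0, zero_mul]
    have hbo : bb f = 0 := by rw [p3, bb_pol, h0, zero_mul]
    have : f = o := ext' (by simp [hao]) (by simp [hbo])
    have h1 := hf.D (vx n ρ i) (vx n ρ (i + 1))
    rw [D_self1, D_self2, this] at h1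
    have := P.D_o i
    linarith
  have ec : cos (i * γ + φ) = cos (j * γ + φ') := by
    have := p3.symm.trans p3'
    have := congrArg aa this
    rw [aa_pol, aa_pol] at this
    exact mul_left_cancel₀ hfo this
  have es : sin (i * γ + φ) = sin (j * γ + φ') := by
    have := p3.symm.trans p3'
    have := congrArg bb this
    rw [bb_pol, bb_pol] at this
    exact mul_left_cancel₀ hfo this
  have hiγ : ((i:ℝ) + 1) * γ ≤ 2 * π := by
    rw [← hnγ]; apply mul_le_mul_of_nonneg_right _ hγ.le; exact_mod_cast hi
  have hjγ : ((j:ℝ) + 1) * γ ≤ 2 * π := by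
    rw [← hnγ]; apply mul_le_mul_of_nonneg_right _ hγ.le; exact_mod_cast hj
  have hi0 : 0 ≤ (i:ℝ) * γ := by positivity
  have hj0 : 0 ≤ (j:ℝ) * γ := by positivity
  have ed : cos ((i * γ + φ) - (j * γ + φ')) = 1 := by
    rw [cos_sub, ec, es]; nlinarith [Real.sin_sq_add_cos_sq (j * γ + φ')]
  have ee : (i * γ + φ) - (j * γ + φ') = 0 := by
    rwa [Real.cos_eq_one_iff_of_lt_of_lt] at ed
    · linarith
    · linarith
  by_contra hne
  rcases Nat.lt_or_gt_of_ne hne with h | h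
  · have : (i:ℝ) + 1 ≤ j := by exact_mod_cast h
    have := mul_le_mul_of_nonneg_right this hγ.le
    linarith
  · have : (j:ℝ) + 1 ≤ i := by exact_mod_cast h
    have := mul_le_mul_of_nonneg_right this hγ.le
    linarith

end
end HB
end

noncomputable section
open MeasureTheory Metric Real UpperHalfPlane
open scoped UpperHalfPlane ENNReal
namespace HB

/-- standard motion of a pair of points -/
def T2 (p q : ℍ) : Mot := (exists_mot2 p q).choose
lemma T2_p (p q : ℍ) : (T2 p q).f p = o := (exists_mot2 p q).choose_spec.1
lemma T2_q (p q : ℍ) : (T2 p q).f q = pol (dist p q) 0 := (exists_mot2 p q).choose_spec.2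

def SS (ε : ℝ) (p q : ℍ) : Set ℍ := (T2 p q).f ⁻¹' S0 (dist p q) ε
def EE (ε : ℝ) (p q : ℍ) : Set ℍ := (T2 p q).f ⁻¹' E0 (dist p q) ε

lemma SS_meas (ε p q) : MeasurableSet (SS ε p q) := (T2 p q).hc.measurable (measurable_S0 _ _)
lemma SS_area (ε p q) : hypAreaMeasure (SS ε p q) = ENNReal.ofReal (dist p q * Real.sinh ε) := by
  rw [SS, (T2 p q).hμ _ (measurable_S0 _ _), S0_area dist_nonneg]
lemma EE_area {ε} (hε : 0 ≤ ε) (p q) : hypAreaMeasure (EE ε p q) ≤ ENNReal.ofReal (2 * dist p q * Real.sinh ε) := by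
  rw [EE, (T2 p q).hμ _ (measurable_E0 _ _)]
  exact E0_area dist_nonneg hε

lemma comb_seg {x l : ℝ} (hl : 0 < l) :
    Comb (pol x 0) (Real.sinh (l - x) / Real.sinh l) o (Real.sinh x / Real.sinh l) (pol l 0) := by
  have := (Real.sinh_pos_iff.2 hl).ne'
  refine ⟨?_, ?_, ?_⟩
  · simp only [tt_pol, tt_o, Real.sinh_sub]; field_simp; ring
  · simp; field_simp
  · simp

/-- points of the edge in standard position -/
lemma edge_std {p q f : ℍ} (h : f ∈ edge p q) : ∃ x, 0 ≤ x ∧ x ≤ dist p q ∧ (T2 p q).f f = pol x 0 := by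
  obtain ⟨α, β, hα, hβ, hc⟩ := h
  have hd := hc.between hα hβ
  refine ⟨dist p f, dist_nonneg, by linarith [dist_nonneg (x := f) (y := q)], ?_⟩
  have h2 := (T2 p q).comb hc
  rw [T2_p, T2_q] at h2
  have hb : bb ((T2 p q).f f) = 0 := by rw [h2.b]; simp
  have ha : 0 ≤ aa ((T2 p q).f f) := by
    rw [h2.a]; simp
    exact mul_nonneg hβ (Real.sinh_nonneg_iff.2 dist_nonneg)
  have ht : tt ((T2 p q).f f) = Real.cosh (dist p f) := by
    rw [cosh_dist_eq, ← (T2 p q).hB, T2_p]; simp [B]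
  apply ext'
  · rw [aa_pol, cos_zero, mul_one]
    have h3 := tt_sq ((T2 p q).f f)
    rw [hb, ht, Real.cosh_sq] at h3
    have : aa ((T2 p q).f f) ^ 2 = Real.sinh (dist p f) ^ 2 := by linarith
    exact (pow_left_inj₀ ha (Real.sinh_nonneg_iff.2 dist_nonneg) two_ne_zero).1 this
  · rw [hb]; simp

lemma mem_EE {ε : ℝ} {p q c x0 : ℍ} (hε : 0 < ε) (hx : x0 ∈ edge p q) (h1 : dist c x0 < ε) (h2 : ε ≤ dist c q) :
    c ∈ EE ε p q := by
  obtain ⟨x, hx0, hxl, hT⟩ := edge_std hx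
  apply mem_E0 hε hx0 hxl
  · rw [← hT, (T2 p q).dist_f]; exact h1
  · rw [← T2_q, (T2 p q).dist_f]; exact h2

section
variable {n : ℕ} {ρ : ℕ → ℝ}

def Nrm (Q : Set ℍ) (c f : ℍ) : Prop := 1 < B c f ∧ ∀ y ∈ Q, B c f * B f y ≤ B c y

lemma Nrm.unique {Q : Set ℍ} {c f f' : ℍ} (h : Nrm Q c f) (h' : Nrm Q c f') (hf : f ∈ Q) (hf' : f' ∈ Q) : f = f' := by
  apply eq_of_B_le_one
  have h1 := h.2 f' hf'
  have h2 := h'.2 f hf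
  rw [B_comm f' f] at h2
  have h3 := h.1
  have h4 := h'.1
  have h5 := one_le_B f f'
  nlinarith

lemma Nrm.not_mem {Q : Set ℍ} {c f : ℍ} (h : Nrm Q c f) : c ∉ Q := by
  intro hc
  have h1 := h.2 c hc
  rw [B_self, B_comm f c] at h1
  have := h.1
  nlinarith

lemma preconn_frontier {X : Type*} [TopologicalSpace X] {S Q : Set X} (hS : IsPreconnected S) (h1 : (S ∩ Q).Nonempty)
    (h2 : (S ∩ Qᶜ).Nonempty) : (S ∩ frontier Q).Nonempty := by
  by_contra hne
  rw [Set.not_nonempty_iff_eq_empty] at hne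
  have hd : ∀ x ∈ S, x ∉ frontier Q := fun x hx hf => by
    have : x ∈ S ∩ frontier Q := ⟨hx, hf⟩
    rw [hne] at this; exact this
  obtain ⟨x, hx, hxQ⟩ := h1
  obtain ⟨y, hy, hyQ⟩ := h2
  have key := hS (interior Q) (closure Q)ᶜ isOpen_interior isClosed_closure.isOpen_compl (by
    intro z hz
    by_cases hzi : z ∈ interior Q
    · exact Or.inl hzi
    · right; intro hzc; exact hd z hz ⟨hzc, hzi⟩) ⟨x, hx, by
      by_contra hxi; exact hd x hx ⟨subset_closure hxQ, hxi⟩⟩ ⟨y, hy, by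
      intro hyc; exact hd y hy ⟨hyc, fun h => hyQ (interior_subset h)⟩⟩
  obtain ⟨z, -, hz1, hz2⟩ := key
  exact hz2 (subset_closure (interior_subset hz1))

lemma SS_foot {ε : ℝ} (hε : 0 < ε) {c : ℍ} {i : ℕ} (hc : c ∈ SS ε (vx n ρ i) (vx n ρ (i + 1))) :
    ∃ f α β, 0 < α ∧ 0 < β ∧ Comb f α (vx n ρ i) β (vx n ρ (i + 1)) ∧ dist c f < ε ∧ Nrm (PQ n ρ) c f := by
  set p := vx n ρ i
  set q := vx n ρ (i + 1)
  obtain ⟨x, hx0, hxl, h1, h2, h3⟩ := S0_foot hε hc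
  have hl : 0 < dist p q := hx0.trans hxl
  have hsl := Real.sinh_pos_iff.2 hl
  refine ⟨(T2 p q).g (pol x 0), Real.sinh (dist p q - x) / Real.sinh (dist p q), Real.sinh x / Real.sinh (dist p q), ?_, ?_, ?_, ?_, ?_, ?_⟩
  rotate_left 2
  · apply (T2 p q).comb'
    rw [(T2 p q).fg, T2_p, T2_q]
    exact comb_seg hl
  · rw [← (T2 p q).dist_f, (T2 p q).fg]; exact h1
  · rw [← (T2 p q).hB, (T2 p q).fg]; exact h2
  · intro y hy
    rw [← (T2 p q).hB c, ← (T2 p q).hB _ y, ← (T2 p q).hB c, (T2 p q).fg]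
    apply h3
    have := hy i
    change 0 ≤ D p q y at this
    rw [← (T2 p q).hD, T2_p, T2_q] at this
    simp [D] at this
    by_contra hh; push Not at hh
    nlinarith
  · exact div_pos (Real.sinh_pos_iff.2 (by linarith)) hsl
  · exact div_pos (Real.sinh_pos_iff.2 hx0) hsl

/-- the motion centering a vertex -/
def Tv (n : ℕ) (ρ : ℕ → ℝ) (i : ℕ) : Mot := (Mot.boostM (-ρ i)).comp (Mot.rotM (-(i * (2 * π / n))))

lemma Tv_f (i : ℕ) (z : ℍ) : (Tv n ρ i).f z = boost (-ρ i) (rot (-(i * (2 * π / n))) z) := rfl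

lemma Tv_self (i : ℕ) : (Tv n ρ i).f (vx n ρ i) = o := by
  rw [Tv_f, vx, rot_pol, neg_add_cancel, boost_pol]; simp

lemma Tv_next (i : ℕ) : (Tv n ρ i).f (vx n ρ (i + 1)) = boost (-ρ i) (pol (ρ (i + 1)) (2 * π / n)) := by
  rw [Tv_f, vx, rot_pol]; congr 2; push_cast; ring

lemma Tv_prev (i : ℕ) : (Tv n ρ (i + 1)).f (vx n ρ i) = boost (-ρ (i + 1)) (pol (ρ i) (-(2 * π / n))) := by
  rw [Tv_f, vx, rot_pol]; congr 2; push_cast; ring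

lemma dist_vx (i : ℕ) : dist (vx n ρ i) (vx n ρ (i + 1)) = dist (pol (ρ i) 0) (pol (ρ (i + 1)) (2 * π / n)) := by
  rw [← (Mot.rotM (-(i * (2 * π / n)))).dist_f]
  change dist (rot _ (pol _ _)) (rot _ (pol _ _)) = _
  rw [rot_pol, rot_pol]
  congr 2
  · ring
  · push_cast; ring

def VV (n : ℕ) (ρ : ℕ → ℝ) (ε b b' : ℝ) (i : ℕ) : Set ℍ :=
  {c | 0 < π - b - b' ∧ (Tv n ρ (i + 1)).f c ∈ Sec (b' - π / 2) (π / 2 - b) ε}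

lemma VV_meas (ε b b' : ℝ) (i : ℕ) : MeasurableSet (VV n ρ ε b b' i) := by
  have h : MeasurableSet ((Tv n ρ (i + 1)).f ⁻¹' Sec (b' - π / 2) (π / 2 - b) ε) :=
    (Tv n ρ (i + 1)).hc.measurable (measurable_Sec _ _ _)
  by_cases h0 : 0 < π - b - b'
  · convert h using 1
    ext c; simp [VV, h0]
  · convert MeasurableSet.empty using 1
    ext c; simp [VV, h0]

lemma VV_area {ε b b' : ℝ} (hε : 0 ≤ ε) (hb : 0 < b) (hb' : 0 < b') (i : ℕ) :
    ENNReal.ofReal ((π - b - b') * (Real.cosh ε - 1)) ≤ hypAreaMeasure (VV n ρ ε b b' i) := by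
  have hc := Real.one_le_cosh ε
  by_cases h0 : 0 < π - b - b'
  · have h1 : VV n ρ ε b b' i = (Tv n ρ (i + 1)).f ⁻¹' Sec (b' - π / 2) (π / 2 - b) ε := by
      ext c; simp [VV, h0]
    rw [h1, (Tv n ρ (i + 1)).hμ _ (measurable_Sec _ _ _)]
    refine le_trans (le_of_eq ?_) (Sec_area (by linarith) hε)
    congr 2; ring
  · rw [ENNReal.ofReal_of_nonpos]
    · exact zero_le
    · exact mul_nonpos_of_nonpos_of_nonneg (by linarith) (by linarith)

lemma VV_foot {ε b b' l l' : ℝ} (hε : 0 < ε) (hb : 0 < b) (hb' : 0 < b') (hl : 0 < l) (hl' : 0 < l')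
    {i : ℕ} {c : ℍ} (hnext : (Tv n ρ (i + 1)).f (vx n ρ (i + 2)) = pol l' (π - b))
    (hprev : (Tv n ρ (i + 1)).f (vx n ρ i) = pol l (π + b')) (hc : c ∈ VV n ρ ε b b' i) :
    dist c (vx n ρ (i + 1)) < ε ∧ Nrm (PQ n ρ) c (vx n ρ (i + 1)) := by
  obtain ⟨h0, h1, h2, h3⟩ := hc
  have hself := Tv_self (n := n) (ρ := ρ) (i + 1)
  set T := Tv n ρ (i + 1)
  have hBc : B c (vx n ρ (i + 1)) = tt (T.f c) := by
    rw [← T.hB, hself]; simp [B]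
  have hsl := Real.sinh_pos_iff.2 hl
  have hsl' := Real.sinh_pos_iff.2 hl'
  refine ⟨?_, ?_, ?_⟩
  · rw [dist_lt_iff' hε.le, hBc]; exact h3
  · rw [hBc]
    by_contra hh; push Not at hh
    have ht := tt_sq (T.f c)
    have := tt_pos (T.f c)
    have ha : aa (T.f c) = 0 := by nlinarith [sq_nonneg (aa (T.f c)), sq_nonneg (bb (T.f c))]
    have hb0 : bb (T.f c) = 0 := by nlinarith [sq_nonneg (aa (T.f c)), sq_nonneg (bb (T.f c))]
    rw [ha, hb0] at h1; simp at h1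
  · intro y hy
    have e1 : B (vx n ρ (i + 1)) y = tt (T.f y) := by rw [← T.hB, hself]; simp [B]
    rw [hBc, e1, ← T.hB c y]
    have d1 := hy (i + 1)
    rw [← T.hD, hself, hnext] at d1
    have d2 := hy i
    rw [← T.hD, hself, hprev] at d2
    simp only [D, aa_o, bb_o, tt_o, aa_pol, bb_pol, tt_pol] at d1 d2
    rw [Real.cos_pi_sub, Real.sin_pi_sub] at d1
    rw [show cos (π + b') = - cos b' by rw [add_comm, Real.cos_add_pi], show sin (π + b') = - sin b' by rw [add_comm, Real.sin_add_pi]] at d2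
    have u2 : sin b * aa (T.f y) + cos b * bb (T.f y) ≤ 0 := by
      by_contra hh; push Not at hh
      nlinarith [mul_pos hsl' hh]
    have u1 : sin b' * aa (T.f y) - cos b' * bb (T.f y) ≤ 0 := by
      by_contra hh; push Not at hh
      nlinarith [mul_pos hsl hh]
    rw [Real.cos_sub_pi_div_two, Real.sin_sub_pi_div_two] at h1
    rw [Real.sin_pi_div_two_sub, Real.cos_pi_div_two_sub] at h2
    have hsin : 0 < sin (b + b') := Real.sin_pos_of_pos_of_lt_pi (by linarith) (by linarith)
    have hcomb : sin (b + b') * (aa (T.f c) * aa (T.f y) + bb (T.f c) * bb (T.f y)) =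
       (cos b * aa (T.f c) - sin b * bb (T.f c)) * (sin b' * aa (T.f y) - cos b' * bb (T.f y))
       + (sin b' * bb (T.f c) - (-cos b') * aa (T.f c)) * (sin b * aa (T.f y) + cos b * bb (T.f y)) := by
      rw [sin_add]; ring
    have hneg : aa (T.f c) * aa (T.f y) + bb (T.f c) * bb (T.f y) ≤ 0 := by
      by_contra hh; push Not at hh
      have t1 := mul_pos hsin hh
      have t2 := mul_nonneg h2.le (neg_nonneg.2 u1)
      have t3 := mul_nonneg h1.le (neg_nonneg.2 u2)
      nlinarith
    unfold B; linarith

lemma ball_preconn (c : ℍ) (ε : ℝ) : IsPreconnected (ball c ε) := by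
  rw [← UpperHalfPlane.isEmbedding_coe.isInducing.isPreconnected_image, UpperHalfPlane.image_coe_ball]
  exact (convex_ball _ _).isPreconnected

/-- inner parallel set -/
def Gq (Q : Set ℍ) (ε : ℝ) : Set ℍ := {c | ball c ε ⊆ Q}

lemma isClosed_Gq (Q : Set ℍ) (ε : ℝ) : IsClosed (Gq Q ε) := by
  have : Gq Q ε = ⋂ y ∈ Qᶜ, {c | ε ≤ dist y c} := by
    ext c
    simp only [Gq, Set.mem_ofPred_eq, Set.mem_iInter, Set.mem_compl_iff]
    constructor
    · intro h y hy
      by_contra hh; push Not at hh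
      exact hy (h hh)
    · intro h y hy
      by_contra hh
      have := h y hh
      rw [mem_ball] at hy; linarith
  rw [this]
  exact isClosed_biInter fun y _ => isClosed_le continuous_const (continuous_const.dist continuous_id)

lemma Poly.cover (P : Poly n ρ) {ε : ℝ} (hε : 0 < ε) {c x0 : ℍ} {k : ℕ} (hx : x0 ∈ edge (vx n ρ k) (vx n ρ (k + 1)))
    (h1 : dist c x0 < ε) (hfar : ∃ j, ε ≤ dist c (vx n ρ j)) :
    ∃ i < n, c ∈ EE ε (vx n ρ i) (vx n ρ (i + 1)) := by
  have hn : 0 < n := by have := P.n3; omega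
  have hper : ∀ k m : ℕ, vx n ρ (m + n * k) = vx n ρ m := by
    intro k
    induction k with
    | zero => intro m; simp
    | succ k ih => intro m; rw [mul_add, mul_one, ← add_assoc, P.vx_per, ih]
  have hex : ∃ m, ε ≤ dist c (vx n ρ (k + 1 + m)) := by
    obtain ⟨j, hj⟩ := hfar
    have hle : k + 1 ≤ n * (k + 1) := Nat.le_mul_of_pos_left _ hn
    refine ⟨j + n * (k + 1) - (k + 1), ?_⟩
    rw [show k + 1 + (j + n * (k + 1) - (k + 1)) = j + n * (k + 1) by omega, hper]
    exact hj
  have key : ∃ i, c ∈ EE ε (vx n ρ i) (vx n ρ (i + 1)) := by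
    classical
    have hm := Nat.find_spec hex
    have hmin := fun m' => Nat.find_min (m := m') hex
    generalize Nat.find hex = m at hm hmin
    cases m with
    | zero => exact ⟨k, mem_EE hε hx h1 hm⟩
    | succ m =>
      refine ⟨k + 1 + m, mem_EE hε (x0 := vx n ρ (k + 1 + m)) ⟨1, 0, by norm_num, by norm_num, by simp, by simp, by simp⟩ ?_ hm⟩
      have := hmin m (by omega)
      push Not at this; exact this
  obtain ⟨i, hi⟩ := key
  refine ⟨i % n, Nat.mod_lt _ hn, ?_⟩
  rw [(P.vx_mod i).1, (P.vx_mod i).2]; exact hi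

lemma Poly.dist_pos (P : Poly n ρ) (i : ℕ) : 0 < dist (vx n ρ i) (vx n ρ (i + 1)) := by
  apply _root_.dist_pos.2
  intro h
  have := P.D_o i
  rw [h] at this
  have h2 : D (vx n ρ (i + 1)) (vx n ρ (i + 1)) o = 0 := by unfold D; ring
  linarith

theorem poly_ineq (P : Poly n ρ) {ε : ℝ} (hε : 0 < ε) (hfar : ∀ c, ∃ j, ε ≤ dist c (vx n ρ j)) (b b' : ℕ → ℝ)
    (hb : ∀ i, 0 < b i) (hb' : ∀ i, 0 < b' i)
    (hnext : ∀ i, (Tv n ρ i).f (vx n ρ (i + 1)) = pol (dist (vx n ρ i) (vx n ρ (i + 1))) (π - b i))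
    (hprev : ∀ i, (Tv n ρ (i + 1)).f (vx n ρ i) = pol (dist (vx n ρ i) (vx n ρ (i + 1))) (π + b' i)) :
    hypAreaMeasure (PQ n ρ) + ∑ i ∈ Finset.range n, (ENNReal.ofReal (dist (vx n ρ i) (vx n ρ (i + 1)) * Real.sinh ε)
      + ENNReal.ofReal ((π - b (i + 1) - b' i) * (Real.cosh ε - 1)))
    ≤ hypAreaMeasure (Gq (PQ n ρ) ε) +
      ∑ i ∈ Finset.range n, ENNReal.ofReal (2 * dist (vx n ρ i) (vx n ρ (i + 1)) * Real.sinh ε) := by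
  set Q := PQ n ρ with hQ
  set S : ℕ → Set ℍ := fun i => SS ε (vx n ρ i) (vx n ρ (i + 1)) with hS
  set V : ℕ → Set ℍ := fun i => VV n ρ ε (b (i + 1)) (b' i) i with hV
  set E : ℕ → Set ℍ := fun i => EE ε (vx n ρ i) (vx n ρ (i + 1)) with hE
  have hVfoot : ∀ i c, c ∈ V i → dist c (vx n ρ (i + 1)) < ε ∧ Nrm Q c (vx n ρ (i + 1)) := fun i c hc =>
    VV_foot hε (hb _) (hb' _) (P.dist_pos i) (P.dist_pos (i + 1)) (hnext (i + 1)) (hprev i) hc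
  have hfoot : ∀ i c, c ∈ S i ∪ V i → ∃ f α β, 0 ≤ α ∧ 0 < β ∧ Comb f α (vx n ρ i) β (vx n ρ (i + 1)) ∧
      dist c f < ε ∧ Nrm Q c f := by
    rintro i c (hc | hc)
    · obtain ⟨f, α, β, h1, h2, h3, h4, h5⟩ := SS_foot hε hc
      exact ⟨f, α, β, h1.le, h2, h3, h4, h5⟩
    · obtain ⟨h1, h2⟩ := hVfoot i c hc
      exact ⟨_, 0, 1, le_rfl, one_pos, ⟨by simp, by simp, by simp⟩, h1, h2⟩
  have hfQ : ∀ i f α β, 0 ≤ α → 0 < β → Comb f α (vx n ρ i) β (vx n ρ (i + 1)) → f ∈ Q :=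
    fun i f α β h1 h2 h3 => P.edge_sub i ⟨α, β, h1, h2.le, h3⟩
  have hmS : ∀ i, MeasurableSet (S i) := fun i => SS_meas _ _ _
  have hmV : ∀ i, MeasurableSet (V i) := fun i => VV_meas _ _ _ _
  have hmG : MeasurableSet (Gq Q ε) := (isClosed_Gq Q ε).measurableSet
  have hmQ : MeasurableSet Q := isClosed_PQ.measurableSet
  have hSV : ∀ i, Disjoint (S i) (V i) := by
    intro i
    rw [Set.disjoint_left]
    intro c h1 h2
    obtain ⟨f, α, β, hα, hβ, hf, -, hn⟩ := SS_foot hε h1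
    have hn2 := (hVfoot i c h2).2
    have heq := hn.unique hn2 (hfQ i f α β hα.le hβ hf) (P.vx_mem _)
    rw [heq] at hf
    have h3 := hf.D (vx n ρ (i + 1)) o
    have e1 : D (vx n ρ (i + 1)) o (vx n ρ (i + 1)) = 0 := D_self1 _ _
    have e2 : D (vx n ρ (i + 1)) o (vx n ρ i) = D (vx n ρ i) (vx n ρ (i + 1)) o := by unfold D; ring
    rw [e1, e2, mul_zero, add_zero] at h3
    have := mul_pos hα (P.D_o i)
    linarith
  have hRR : Set.PairwiseDisjoint (↑(Finset.range n)) (fun i => S i ∪ V i) := by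
    intro i hi j hj hij
    rw [Function.onFun, Set.disjoint_left]
    intro c h1 h2
    obtain ⟨f, α, β, hα, hβ, hf, -, hn⟩ := hfoot i c h1
    obtain ⟨f', α', β', hα', hβ', hf', -, hn'⟩ := hfoot j c h2
    have heq := hn.unique hn' (hfQ i f α β hα hβ hf) (hfQ j f' α' β' hα' hβ' hf')
    subst heq
    exact hij (P.half_disj (by simpa using hi) (by simpa using hj) hα hβ hα' hβ' hf hf')
  have hQR : Disjoint (Q \ Gq Q ε) (⋃ i ∈ Finset.range n, (S i ∪ V i)) := by
    rw [Set.disjoint_left]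
    intro c h1 h2
    simp only [Set.mem_iUnion] at h2
    obtain ⟨i, hi, h2⟩ := h2
    obtain ⟨f, α, β, hα, hβ, hf, -, hn⟩ := hfoot i c h2
    exact hn.not_mem h1.1
  have hcov : (Q \ Gq Q ε) ∪ (⋃ i ∈ Finset.range n, (S i ∪ V i)) ⊆ ⋃ i ∈ Finset.range n, E i := by
    have aux : ∀ c x0 k, x0 ∈ edge (vx n ρ k) (vx n ρ (k + 1)) → dist c x0 < ε → c ∈ ⋃ i ∈ Finset.range n, E i := by
      intro c x0 k hx hd
      obtain ⟨i, hi, h⟩ := P.cover hε hx hd (hfar c)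
      simp only [Set.mem_iUnion, Finset.mem_range]
      exact ⟨i, hi, h⟩
    rintro c (h | h)
    · have hns : ¬ ball c ε ⊆ Q := h.2
      obtain ⟨y, hy, hyQ⟩ := Set.not_subset.1 hns
      obtain ⟨x0, hx0, hxf⟩ := preconn_frontier (ball_preconn c ε) ⟨c, mem_ball_self hε, h.1⟩ ⟨y, hy, hyQ⟩
      have := P.frontier_sub hxf
      simp only [Set.mem_iUnion] at this
      obtain ⟨k, hk⟩ := this
      exact aux c x0 k hk (by rw [dist_comm]; exact hx0)
    · simp only [Set.mem_iUnion] at h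
      obtain ⟨i, hi, h2⟩ := h
      obtain ⟨f, α, β, hα, hβ, hf, hd, hn⟩ := hfoot i c h2
      exact aux c f i ⟨α, β, hα, hβ.le, hf⟩ hd
  have hmR : MeasurableSet (⋃ i ∈ Finset.range n, (S i ∪ V i)) :=
    Finset.measurableSet_biUnion _ fun i _ => (hmS i).union (hmV i)
  have m1 : hypAreaMeasure (Q \ Gq Q ε) + ∑ i ∈ Finset.range n, (hypAreaMeasure (S i) + hypAreaMeasure (V i))
      ≤ ∑ i ∈ Finset.range n, hypAreaMeasure (E i) := by
    calc _ = hypAreaMeasure ((Q \ Gq Q ε) ∪ (⋃ i ∈ Finset.range n, (S i ∪ V i))) := by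
          rw [measure_union hQR hmR, measure_biUnion_finset hRR (fun i _ => (hmS i).union (hmV i))]
          congr 1
          apply Finset.sum_congr rfl
          intro i _
          rw [measure_union (hSV i) (hmV i)]
      _ ≤ hypAreaMeasure (⋃ i ∈ Finset.range n, E i) := measure_mono hcov
      _ ≤ _ := measure_biUnion_finset_le _ _
  have m2 : hypAreaMeasure Q ≤ hypAreaMeasure (Gq Q ε) + hypAreaMeasure (Q \ Gq Q ε) := by
    refine le_trans (measure_mono ?_) (measure_union_le _ _)
    intro x hx
    by_cases h : x ∈ Gq Q ε
    · exact Or.inl h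
    · exact Or.inr ⟨hx, h⟩
  calc _ ≤ hypAreaMeasure (Gq Q ε) + hypAreaMeasure (Q \ Gq Q ε) +
        ∑ i ∈ Finset.range n, (hypAreaMeasure (S i) + hypAreaMeasure (V i)) := by
        gcongr with i hi
        · exact (SS_area _ _ _).ge
        · exact VV_area hε.le (hb _) (hb' _) i
    _ ≤ _ := by
        rw [add_assoc]
        gcongr
        refine m1.trans ?_
        gcongr with i hi
        exact EE_area hε.le _ _

/-- real-valued version -/
theorem poly_real (P : Poly n ρ) {ε : ℝ} (hε : 0 < ε) (hfar : ∀ c, ∃ j, ε ≤ dist c (vx n ρ j))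
    (hfin : hypAreaMeasure (PQ n ρ) ≠ ∞) :
    (hypAreaMeasure (PQ n ρ)).toReal + (∑ i ∈ Finset.range n, sin (2 * π / n) * (Real.cosh (ρ i) + Real.cosh (ρ (i + 1)))
      / (Real.cosh (dist (vx n ρ i) (vx n ρ (i + 1))) + 1)) * (Real.cosh ε - 1)
    ≤ (hypAreaMeasure (Gq (PQ n ρ) ε)).toReal + (∑ i ∈ Finset.range n, dist (vx n ρ i) (vx n ρ (i + 1))) * Real.sinh ε := by
  have hex : ∀ r r' : ℝ, ∃ b b' : ℝ, 0 < r → 0 < r' → 0 < b ∧ b < π ∧ 0 < b' ∧ b' < π ∧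
      boost (-r) (pol r' (2 * π / n)) = pol (dist (pol r 0) (pol r' (2 * π / n))) (π - b) ∧
      boost (-r') (pol r (-(2 * π / n))) = pol (dist (pol r 0) (pol r' (2 * π / n))) (π + b') ∧
      sin (2 * π / n) * (Real.cosh r + Real.cosh r') / (Real.cosh (dist (pol r 0) (pol r' (2 * π / n))) + 1) ≤ π - b - b' := by
    intro r r'
    by_cases h : 0 < r ∧ 0 < r'
    · obtain ⟨b, b', hh⟩ := tri h.1 h.2 P.γpos P.γlt
      exact ⟨b, b', fun _ _ => hh⟩
    · exact ⟨0, 0, fun h1 h2 => absurd ⟨h1, h2⟩ h⟩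
  choose β β' hβ using hex
  have hβ := fun i => hβ (ρ i) (ρ (i + 1)) (P.pos _) (P.pos _)
  have main := poly_ineq P hε hfar (fun i => β (ρ i) (ρ (i + 1))) (fun i => β' (ρ i) (ρ (i + 1)))
    (fun i => (hβ i).1) (fun i => (hβ i).2.2.1)
    (fun i => by rw [Tv_next, dist_vx]; exact (hβ i).2.2.2.2.1)
    (fun i => by rw [Tv_prev, dist_vx]; exact (hβ i).2.2.2.2.2.1)
  have hn0 : Gq (PQ n ρ) ε ⊆ PQ n ρ := fun c hc => hc (mem_ball_self hε)
  have hGfin : hypAreaMeasure (Gq (PQ n ρ) ε) ≠ ∞ := ne_top_of_le_ne_top hfin (measure_mono hn0)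
  have hs : 0 ≤ Real.sinh ε := Real.sinh_nonneg_iff.2 hε.le
  have h1 := ENNReal.toReal_mono (by
    exact ENNReal.add_ne_top.2 ⟨hGfin, ENNReal.sum_ne_top.2 fun i _ => ENNReal.ofReal_ne_top⟩) main
  rw [ENNReal.toReal_add hfin (ENNReal.sum_ne_top.2 fun i _ => ENNReal.add_ne_top.2 ⟨ENNReal.ofReal_ne_top, ENNReal.ofReal_ne_top⟩),
    ENNReal.toReal_add hGfin (ENNReal.sum_ne_top.2 fun i _ => ENNReal.ofReal_ne_top),
    ENNReal.toReal_sum (fun i _ => ENNReal.add_ne_top.2 ⟨ENNReal.ofReal_ne_top, ENNReal.ofReal_ne_top⟩),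
    ENNReal.toReal_sum (fun i _ => ENNReal.ofReal_ne_top)] at h1
  have h2 : ∑ i ∈ Finset.range n, (ENNReal.ofReal (2 * dist (vx n ρ i) (vx n ρ (i + 1)) * Real.sinh ε)).toReal
      = 2 * ((∑ i ∈ Finset.range n, dist (vx n ρ i) (vx n ρ (i + 1))) * Real.sinh ε) := by
    rw [Finset.sum_mul, Finset.mul_sum]
    apply Finset.sum_congr rfl
    intro i _
    rw [ENNReal.toReal_ofReal (mul_nonneg (mul_nonneg two_pos.le dist_nonneg) hs)]; ring
  have h3 : (∑ i ∈ Finset.range n, dist (vx n ρ i) (vx n ρ (i + 1))) * Real.sinh ε +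
     (∑ i ∈ Finset.range n, (π - β (ρ (i + 1)) (ρ (i + 1 + 1)) - β' (ρ i) (ρ (i + 1)))) * (Real.cosh ε - 1) ≤
      ∑ i ∈ Finset.range n, (ENNReal.ofReal (dist (vx n ρ i) (vx n ρ (i + 1)) * Real.sinh ε)
      + ENNReal.ofReal ((π - β (ρ (i + 1)) (ρ (i + 1 + 1)) - β' (ρ i) (ρ (i + 1))) * (Real.cosh ε - 1))).toReal := by
    rw [Finset.sum_mul, Finset.sum_mul, ← Finset.sum_add_distrib]
    apply Finset.sum_le_sum
    intro i _
    rw [ENNReal.toReal_add ENNReal.ofReal_ne_top ENNReal.ofReal_ne_top,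
      ENNReal.toReal_ofReal (mul_nonneg dist_nonneg hs)]
    gcongr
    rw [ENNReal.toReal_ofReal']; exact le_max_left _ _
  have h4 : ∑ i ∈ Finset.range n, (π - β (ρ (i + 1)) (ρ (i + 1 + 1)) - β' (ρ i) (ρ (i + 1)))
      = ∑ i ∈ Finset.range n, (π - β (ρ i) (ρ (i + 1)) - β' (ρ i) (ρ (i + 1))) := by
    simp only [Finset.sum_sub_distrib]
    congr 2
    have e := Finset.sum_range_succ' (fun i => β (ρ i) (ρ (i + 1))) n
    rw [Finset.sum_range_succ] at e
    have p0 : ρ n = ρ 0 := by simpa using P.per 0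
    have p1 : ρ (n + 1) = ρ (0 + 1) := by rw [← P.per (0 + 1)]; congr 1; ring
    rw [p0, p1] at e
    linarith
  have h5 : ∑ i ∈ Finset.range n, sin (2 * π / n) * (Real.cosh (ρ i) + Real.cosh (ρ (i + 1)))
      / (Real.cosh (dist (vx n ρ i) (vx n ρ (i + 1))) + 1) ≤ ∑ i ∈ Finset.range n, (π - β (ρ i) (ρ (i + 1)) - β' (ρ i) (ρ (i + 1))) := by
    apply Finset.sum_le_sum
    intro i _
    rw [dist_vx]; exact (hβ i).2.2.2.2.2.2
  have hc := Real.one_le_cosh ε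
  have h6 := mul_le_mul_of_nonneg_right h5 (sub_nonneg.2 hc)
  rw [h4] at h3
  linarith

end
end HB
end

noncomputable section
open MeasureTheory Metric Real UpperHalfPlane
open scoped UpperHalfPlane ENNReal
namespace HB

/-! ### the gauge of `K` in the Klein model -/

def vc (z : ℍ) : ℂ := ⟨aa z, bb z⟩

structure Gau (K : Set ℍ) (G : ℂ → ℝ) (L : NNReal) (m : ℝ) : Prop where
  lip : LipschitzWith L G
  add : ∀ w v, G (w + v) ≤ G w + G v
  hom : ∀ (c : ℝ) w, 0 ≤ c → G ((c : ℂ) * w) = c * G w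
  mem : ∀ z, z ∈ K ↔ G (vc z) ≤ tt z
  m1 : 1 < m
  low : ∀ w, m * ‖w‖ ≤ G w

def kap (z : ℍ) : ℂ := ((tt z)⁻¹ : ℝ) * vc z

lemma continuous_vc : Continuous vc := by
  have : vc = fun z => ((aa z : ℂ) + bb z * Complex.I) := by
    funext z; apply Complex.ext <;> simp [vc]
  rw [this]
  have := continuous_aa; have := continuous_bb
  fun_prop

lemma continuous_kap : Continuous kap := by
  unfold kap
  exact (Complex.continuous_ofReal.comp (continuous_tt.inv₀ (fun z => (tt_pos z).ne'))).mul continuous_vc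

lemma norm_vc_sq (z : ℍ) : ‖vc z‖ ^ 2 = tt z ^ 2 - 1 := by
  rw [tt_sq, Complex.sq_norm, Complex.normSq_apply]; simp [vc]; ring

lemma kap_re (z : ℍ) : (kap z).re = aa z / tt z := by simp [kap, vc]; ring
lemma kap_im (z : ℍ) : (kap z).im = bb z / tt z := by simp [kap, vc]; ring

lemma kap_inj {z w : ℍ} (h : kap z = kap w) : z = w := by
  have ha := congrArg Complex.re h
  have hb := congrArg Complex.im h
  rw [kap_re, kap_re] at ha
  rw [kap_im, kap_im] at hb
  have hz := tt_pos z
  have hw := tt_pos w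
  have hzs := tt_sq z
  have hws := tt_sq w
  have ha' : aa z = aa w / tt w * tt z := by rw [← ha]; field_simp
  have hb' : bb z = bb w / tt w * tt z := by rw [← hb]; field_simp
  have e : tt z = tt w := by
    have : tt z ^ 2 * ((tt w) ^ 2 - aa w ^ 2 - bb w ^ 2) = tt w ^ 2 := by
      rw [ha', hb'] at hzs
      field_simp at hzs
      linarith
    have e2 : tt z ^ 2 = tt w ^ 2 := by
      have : (tt w) ^ 2 - aa w ^ 2 - bb w ^ 2 = 1 := by linarith
      nlinarith
    exact (pow_left_inj₀ hz.le hw.le two_ne_zero).1 e2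
  apply ext'
  · rw [ha', e]; field_simp
  · rw [hb', e]; field_simp

lemma exists_gau {K : Set ℍ} (hK : IsCompact K) (hc : HypConvex K) (ho : o ∈ interior K) :
    ∃ G L m, Gau K G L m := by
  have hconv : Convex ℝ (kap '' K) := by
    rintro _ ⟨p, hp, rfl⟩ _ ⟨q, hq, rfl⟩ α β hα hβ hαβ
    have htp := tt_pos p
    have htq := tt_pos q
    obtain ⟨N, hN, x, hx⟩ := exists_comb p q (α := α / tt p) (β := β / tt q) (by positivity) (by positivity) (by
      rcases hα.eq_or_lt with h | h
      · have : 0 < β := by linarith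
        have : 0 < β / tt q := by positivity
        have : 0 ≤ α / tt p := by positivity
        linarith
      · have : 0 < α / tt p := by positivity
        have : 0 ≤ β / tt q := by positivity
        linarith)
    refine ⟨x, HypConvex.comb hc hp hq hx (by positivity) (by positivity), ?_⟩
    have ht : tt x = 1 / N := by
      rw [hx.t]; field_simp; exact hαβ
    apply Complex.ext
    · rw [kap_re, hx.a, ht, Complex.add_re, Complex.real_smul, Complex.real_smul, Complex.re_ofReal_mul, Complex.re_ofReal_mul, kap_re, kap_re]
      field_simp
    · rw [kap_im, hx.b, ht, Complex.add_im, Complex.real_smul, Complex.real_smul, Complex.im_ofReal_mul, Complex.im_ofReal_mul, kap_im, kap_im]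
      field_simp
  have hcomp : IsCompact (kap '' K) := hK.image continuous_kap
  have hnhds : kap '' K ∈ nhds (0:ℂ) := by
    obtain ⟨δ, hδ, hb⟩ := Metric.mem_nhds_iff.1 (mem_interior_iff_mem_nhds.1 ho)
    have hch := Real.cosh_pos δ
    have hsh := Real.sinh_pos_iff.2 hδ
    rw [Metric.mem_nhds_iff]
    refine ⟨Real.sinh δ / Real.cosh δ, by positivity, ?_⟩
    intro w hw
    rw [mem_ball_zero_iff] at hw
    have hw2 : ‖w‖ ^ 2 < (Real.sinh δ / Real.cosh δ) ^ 2 := by gcongr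
    have hw3 : ‖w‖ ^ 2 = w.re ^ 2 + w.im ^ 2 := by rw [Complex.sq_norm, Complex.normSq_apply]; ring
    rw [div_pow, Real.sinh_sq, hw3] at hw2
    have hw4 : w.re ^ 2 + w.im ^ 2 < 1 - 1 / Real.cosh δ ^ 2 := by
      rw [sub_div, div_self (by positivity)] at hw2; exact hw2
    have : 0 < 1 / Real.cosh δ ^ 2 := by positivity
    obtain ⟨N, hN, hN2, x, h1, h2, h3⟩ := exists_norm (t := 1) (a := w.re) (b := w.im) one_pos (by linarith)
    refine ⟨x, hb ?_, ?_⟩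
    · rw [mem_ball, dist_comm, dist_lt_iff' hδ.le]
      have : B o x = 1 / N := by simp [B, h1]
      rw [this, div_lt_iff₀ hN]
      have : 1 / Real.cosh δ < N := by
        apply lt_of_pow_lt_pow_left₀ 2 hN.le
        rw [hN2, div_pow, one_pow]; linarith
      rw [div_lt_iff₀ hch] at this
      linarith
    · apply Complex.ext
      · rw [kap_re, h1, h2]; field_simp
      · rw [kap_im, h1, h3]; field_simp
  obtain ⟨R0, hR0⟩ := hK.isBounded.subset_closedBall o
  set R := max R0 1
  have hRpos : 0 < R := lt_max_of_lt_right one_pos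
  have hch := Real.cosh_pos R
  have hsh := Real.sinh_pos_iff.2 hRpos
  have hsub : kap '' K ⊆ closedBall 0 (Real.sinh R / Real.cosh R) := by
    rintro _ ⟨z, hz, rfl⟩
    have hzR : dist o z ≤ R := by
      rw [dist_comm]; exact (mem_closedBall.1 (hR0 hz)).trans (le_max_left _ _)
    rw [dist_le_iff' hRpos.le] at hzR
    have e : B o z = tt z := by simp [B]
    rw [e] at hzR
    have htz := tt_pos z
    rw [mem_closedBall_zero_iff]
    apply le_of_sq_le_sq _ (by positivity)
    unfold kap
    rw [norm_mul, mul_pow, norm_vc_sq, div_pow, Real.sinh_sq, Complex.norm_real, Real.norm_eq_abs, sq_abs, inv_pow,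
      ← div_eq_inv_mul, sub_div, sub_div, div_self (by positivity), div_self (by positivity)]
    have : 1 / Real.cosh R ^ 2 ≤ 1 / tt z ^ 2 := by gcongr
    linarith
  obtain ⟨L, hL⟩ := hconv.lipschitz_gauge hnhds
  have habs := absorbent_nhds_zero (𝕜 := ℝ) hnhds
  have hhom : ∀ (c : ℝ) w, 0 ≤ c → gauge (kap '' K) ((c : ℂ) * w) = c * gauge (kap '' K) w := by
    intro c w h
    have := gauge_smul_of_nonneg (s := kap '' K) h w
    rwa [Complex.real_smul, smul_eq_mul] at this
  refine ⟨gauge (kap '' K), L, Real.cosh R / Real.sinh R, hL, gauge_add_le hconv habs, hhom, ?_, ?_, ?_⟩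
  · intro z
    have h1 : z ∈ K ↔ kap z ∈ kap '' K := ⟨fun h => ⟨z, h, rfl⟩, fun ⟨w, hw, e⟩ => kap_inj e ▸ hw⟩
    rw [h1, ← hcomp.isClosed.closure_eq, ← gauge_le_one_iff_mem_closure hconv hnhds]
    rw [hcomp.isClosed.closure_eq]
    have htz := tt_pos z
    have e : kap z = ((tt z)⁻¹ : ℝ) * vc z := rfl
    rw [e, hhom _ _ (by positivity), inv_mul_le_iff₀ htz, mul_one]
  · rw [one_lt_div hsh]; exact Real.sinh_lt_cosh R
  · intro w
    have := le_gauge_of_subset_closedBall habs (by positivity) hsub (x := w)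
    calc _ = ‖w‖ / (Real.sinh R / Real.cosh R) := by field_simp
      _ ≤ _ := this

def ei (θ : ℝ) : ℂ := ⟨cos θ, sin θ⟩

lemma norm_ei (θ) : ‖ei θ‖ = 1 := by
  have : ‖ei θ‖ ^ 2 = 1 := by
    rw [Complex.sq_norm, Complex.normSq_apply]; simp [ei]; nlinarith [sin_sq_add_cos_sq θ]
  exact (pow_eq_one_iff_of_nonneg (norm_nonneg _) two_ne_zero).1 this

lemma vc_pol (s θ : ℝ) : vc (pol s θ) = (Real.sinh s : ℂ) * ei θ := by
  apply Complex.ext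
  · rw [Complex.re_ofReal_mul]; simp [vc, ei]
  · rw [Complex.im_ofReal_mul]; simp [vc, ei]

/-- radial function -/
def rad (G : ℂ → ℝ) (θ : ℝ) : ℝ := Real.arsinh (1 / √(G (ei θ) ^ 2 - 1))

section
variable {K : Set ℍ} {G : ℂ → ℝ} {L : NNReal} {m : ℝ}

lemma Gau.m_le (g : Gau K G L m) (θ : ℝ) : m ≤ G (ei θ) := by
  have := g.low (ei θ); rwa [norm_ei, mul_one] at this

lemma Gau.sqpos (g : Gau K G L m) (θ : ℝ) : 0 < G (ei θ) ^ 2 - 1 := by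
  have := g.m_le θ; have := g.m1; nlinarith

lemma Gau.rad_pos (g : Gau K G L m) (θ : ℝ) : 0 < rad G θ := by
  have := g.sqpos θ
  unfold rad; rw [Real.arsinh_pos_iff]; positivity

lemma rad_per (θ : ℝ) : rad G (θ + 2 * π) = rad G θ := by
  unfold rad ei; simp

lemma Gau.sinh_rad (g : Gau K G L m) (θ : ℝ) : Real.sinh (rad G θ) * G (ei θ) = Real.cosh (rad G θ) := by
  have h := g.sqpos θ
  have hm := g.m_le θ
  have h1 := g.m1
  have hG : 0 < G (ei θ) := by linarith
  have hs : 0 < Real.sinh (rad G θ) := Real.sinh_pos_iff.2 (g.rad_pos θ)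
  have e : Real.sinh (rad G θ) ^ 2 * (G (ei θ) ^ 2 - 1) = 1 := by
    unfold rad; rw [Real.sinh_arsinh, div_pow, one_pow, Real.sq_sqrt h.le]; field_simp
  have hc := Real.cosh_pos (rad G θ)
  refine (pow_left_inj₀ (by positivity) hc.le two_ne_zero).1 ?_
  rw [Real.cosh_sq]; nlinarith

lemma Gau.pol_mem (g : Gau K G L m) {s : ℝ} (hs : 0 ≤ s) (θ : ℝ) : pol s θ ∈ K ↔ s ≤ rad G θ := by
  have hr : 0 < Real.sinh (rad G θ) := Real.sinh_pos_iff.2 (g.rad_pos θ)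
  have hs' := Real.sinh_nonneg_iff.2 hs
  have e := g.sinh_rad θ
  rw [g.mem, vc_pol, g.hom _ _ hs', tt_pol]
  have h1 : s ≤ rad G θ ↔ Real.sinh (s - rad G θ) ≤ 0 := by
    rw [Real.sinh_nonpos_iff, sub_nonpos]
  rw [h1, Real.sinh_sub, ← e, sub_nonpos]
  rw [show Real.sinh s * (Real.sinh (rad G θ) * G (ei θ)) = (Real.sinh s * G (ei θ)) * Real.sinh (rad G θ) by ring]
  exact (mul_le_mul_iff_left₀ hr).symm

/-- boundary curve -/
def bq (G : ℂ → ℝ) (θ : ℝ) : ℍ := pol (rad G θ) θ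

lemma bq_per (θ : ℝ) : bq G (θ + 2 * π) = bq G θ := by unfold bq; rw [rad_per, pol_add_two_pi]

lemma Gau.bq_eq (g : Gau K G L m) (θ : ℝ) : G (vc (bq G θ)) = tt (bq G θ) := by
  unfold bq
  rw [vc_pol, g.hom _ _ (Real.sinh_nonneg_iff.2 (g.rad_pos θ).le), tt_pol, g.sinh_rad]

lemma Gau.bq_mem (g : Gau K G L m) (θ : ℝ) : bq G θ ∈ K := (g.mem _).2 (g.bq_eq θ).le

/-- `dist` is at most the euclidean distance in the coordinates -/
lemma dist_le_euclid (z w : ℍ) : dist z w ≤ ‖vc z - vc w‖ := by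
  apply le_of_sq_le_sq _ (norm_nonneg _)
  have h1 : Real.cosh (dist z w) = B z w := cosh_dist_eq z w
  have h2 : 1 + dist z w ^ 2 / 2 ≤ Real.cosh (dist z w) := by
    have e : Real.cosh (dist z w) = 1 + 2 * Real.sinh (dist z w / 2) ^ 2 := by
      have := Real.cosh_two_mul (dist z w / 2)
      rw [show 2 * (dist z w / 2) = dist z w by ring, Real.cosh_sq] at this
      linarith
    have : dist z w / 2 ≤ Real.sinh (dist z w / 2) := Real.self_le_sinh_iff.2 (by positivity)
    have h0 : 0 ≤ dist z w := dist_nonneg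
    rw [e]; nlinarith
  have h3 : ‖vc z - vc w‖ ^ 2 = (aa z - aa w) ^ 2 + (bb z - bb w) ^ 2 := by
    rw [Complex.sq_norm, Complex.normSq_apply]; simp [vc]; ring
  rw [h3]
  have := tt_sq z
  have := tt_sq w
  have h4 : B z w = tt z * tt w - aa z * aa w - bb z * bb w := rfl
  nlinarith [sq_nonneg (tt z - tt w)]

lemma Gau.exists_lip (g : Gau K G L m) : ∃ C, LipschitzWith C (bq G) := by
  have h1 := g.m1
  set c := √(m ^ 2 - 1) with hcdef
  have hc : 0 < c := Real.sqrt_pos.2 (by nlinarith)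
  have heilip : ∀ x y, ‖ei x - ei y‖ ≤ 2 * |x - y| := by
    intro x y
    calc ‖ei x - ei y‖ ≤ |(ei x - ei y).re| + |(ei x - ei y).im| := Complex.norm_le_abs_re_add_abs_im _
      _ = |cos x - cos y| + |sin x - sin y| := by simp [ei]
      _ ≤ |x - y| + |x - y| := add_le_add (Real.abs_cos_sub_cos_le _ _) (Real.abs_sin_sub_sin_le _ _)
      _ = _ := by ring
  have hGlip : ∀ x y, |G (ei x) - G (ei y)| ≤ L * (2 * |x - y|) := by
    intro x y
    have := g.lip.dist_le_mul (ei x) (ei y)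
    rw [Real.dist_eq, dist_eq_norm] at this
    exact this.trans (by gcongr; exact heilip x y)
  -- upper bound of G on the circle
  have hM : ∀ x, G (ei x) ≤ G 0 + L := by
    intro x
    have := g.lip.dist_le_mul (ei x) 0
    rw [Real.dist_eq, dist_zero_right, norm_ei] at this
    have := (abs_le.1 this).2
    linarith
  set h : ℝ → ℝ := fun x => √(G (ei x) ^ 2 - 1) with hh
  have hcl : ∀ x, c ≤ h x := fun x => Real.sqrt_le_sqrt (by have := g.m_le x; nlinarith)
  have hlip2 : ∀ x y, |1 / h x - 1 / h y| ≤ (G 0 + L) / c ^ 3 * (L * (2 * |x - y|)) := by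
    intro x y
    have hx := hcl x; have hy := hcl y
    have hx0 := hc.trans_le hx; have hy0 := hc.trans_le hy
    have ex : h x ^ 2 = G (ei x) ^ 2 - 1 := Real.sq_sqrt (g.sqpos x).le
    have ey : h y ^ 2 = G (ei y) ^ 2 - 1 := Real.sq_sqrt (g.sqpos y).le
    have e : 1 / h x - 1 / h y = (G (ei y) - G (ei x)) * (G (ei y) + G (ei x)) / (h x * h y * (h x + h y)) := by
      have : (G (ei y) - G (ei x)) * (G (ei y) + G (ei x)) = (h y - h x) * (h y + h x) := by linarith
      rw [this]; field_simp; ring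
    have gx := g.m_le x; have gy := g.m_le y
    have gx' := hM x; have gy' := hM y
    rw [e, abs_div, abs_mul, abs_of_pos (show 0 < h x * h y * (h x + h y) by positivity),
      abs_of_pos (show 0 < G (ei y) + G (ei x) by linarith), abs_sub_comm]
    calc |G (ei x) - G (ei y)| * (G (ei y) + G (ei x)) / (h x * h y * (h x + h y))
        ≤ (L * (2 * |x - y|)) * (2 * (G 0 + L)) / (c * c * (c + c)) := by
          have hG0 : 0 ≤ G 0 + L := by linarith
          gcongr
          · linarith
          · exact hGlip x y
          · linarith
      _ = _ := by field_simp; ring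
  refine ⟨Real.toNNReal ((G 0 + L) / c ^ 3 * (L * 2) + 1 / c * 2), LipschitzWith.of_dist_le_mul ?_⟩
  intro x y
  have hG0 : 0 ≤ G 0 + L := by have := g.m_le 0; have := hM 0; linarith
  rw [Real.coe_toNNReal _ (by positivity)]
  refine (dist_le_euclid _ _).trans ?_
  unfold bq
  rw [vc_pol, vc_pol]
  unfold rad
  rw [Real.sinh_arsinh, Real.sinh_arsinh]
  change ‖((1 / h x : ℝ) : ℂ) * ei x - ((1 / h y : ℝ) : ℂ) * ei y‖ ≤ _
  have e : ((1 / h x : ℝ) : ℂ) * ei x - ((1 / h y : ℝ) : ℂ) * ei y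
     = ((1 / h x - 1 / h y : ℝ) : ℂ) * ei x + ((1 / h y : ℝ) : ℂ) * (ei x - ei y) := by push_cast; ring
  rw [e, Real.dist_eq]
  refine (norm_add_le _ _).trans ?_
  rw [norm_mul, norm_mul, norm_ei, mul_one, Complex.norm_real, Complex.norm_real, Real.norm_eq_abs, Real.norm_eq_abs]
  have hy := hcl y
  have hy0 := hc.trans_le hy
  have b1 : |1 / h y| ≤ 1 / c := by
    rw [abs_of_pos (by positivity)]; gcongr
  calc _ ≤ (G 0 + L) / c ^ 3 * (L * (2 * |x - y|)) + 1 / c * (2 * |x - y|) := by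
        gcongr
        · exact hlip2 x y
        · exact heilip x y
    _ = _ := by ring

lemma Gau.cont (g : Gau K G L m) : Continuous (bq G) := by
  obtain ⟨C, hC⟩ := g.exists_lip; exact hC.continuous

lemma Gau.frontier_sub (g : Gau K G L m) (hcl : IsClosed K) : frontier K ⊆ bq G '' Set.Icc 0 (2 * π) := by
  intro z hz
  have hzK : z ∈ K := hcl.frontier_subset hz
  have hGe : G (vc z) = tt z := by
    refine le_antisymm ((g.mem z).1 hzK) ?_
    by_contra hlt
    push Not at hlt
    have hop : IsOpen {z : ℍ | G (vc z) < tt z} := isOpen_lt (g.lip.continuous.comp continuous_vc) continuous_tt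
    have hsub : {z : ℍ | G (vc z) < tt z} ⊆ K := fun w hw => (g.mem w).2 (le_of_lt hw)
    exact hz.2 (interior_maximal hsub hop hlt)
  obtain ⟨θ, hθ, hzθ⟩ := exists_pol z
  refine ⟨θ, ⟨hθ.1, hθ.2.le⟩, ?_⟩
  set s := dist o z
  have hs : 0 ≤ s := dist_nonneg
  rw [hzθ, vc_pol, g.hom _ _ (Real.sinh_nonneg_iff.2 hs), tt_pol] at hGe
  have hsinh : Real.sinh (s - rad G θ) = 0 := by
    rw [Real.sinh_sub, ← g.sinh_rad θ, ← hGe]; ring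
  have : s = rad G θ := by
    have := Real.sinh_eq_zero.1 hsinh; linarith
  unfold bq; rw [← this, ← hzθ]

lemma continuous_pol (θ : ℝ) : Continuous (fun s => pol s θ) :=
  continuous_mk.comp (by fun_prop : Continuous (fun s : ℝ => (Real.sinh s * cos θ, Real.sinh s * sin θ)))

lemma Gau.bq_frontier (g : Gau K G L m) (θ : ℝ) : bq G θ ∈ frontier K := by
  refine ⟨subset_closure (g.bq_mem θ), fun hint => ?_⟩
  have h1 : ∀ᶠ s in nhds (rad G θ), pol s θ ∈ K :=
    (continuous_pol θ).continuousAt.eventually (mem_interior_iff_mem_nhds.1 hint)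
  obtain ⟨δ, hδ, hb⟩ := Metric.eventually_nhds_iff.1 h1
  have := hb (y := rad G θ + δ / 2) (by rw [Real.dist_eq, add_sub_cancel_left, abs_of_pos (by positivity)]; linarith)
  have hp := g.rad_pos θ
  rw [g.pol_mem (by positivity)] at this
  linarith

lemma Gau.perim_fin (g : Gau K G L m) (hcl : IsClosed K) : μH[1] (frontier K) ≠ ∞ := by
  obtain ⟨C, hC⟩ := g.exists_lip
  have h1 := hC.lipschitzOnWith (s := Set.Icc 0 (2 * π)) |>.hausdorffMeasure_image_le (d := 1) zero_le_one
  refine ((measure_mono (g.frontier_sub hcl)).trans h1).trans_lt ?_ |>.ne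
  rw [hausdorffMeasure_real, Real.volume_Icc]
  apply ENNReal.mul_lt_top _ ENNReal.ofReal_lt_top
  simp

lemma pol_inj {s s' θ θ' : ℝ} (hs : 0 < s) (hs' : 0 < s') (h : pol s θ = pol s' θ') (hlt : |θ - θ'| < 2 * π) : θ = θ' := by
  have ht := congrArg tt h
  rw [tt_pol, tt_pol] at ht
  have e : s = s' := by
    have h1 := Real.cosh_le_cosh.1 ht.le
    have h2 := Real.cosh_le_cosh.1 ht.ge
    rw [abs_of_pos hs, abs_of_pos hs'] at h1 h2
    exact le_antisymm h1 h2
  have ha := congrArg aa h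
  have hb := congrArg bb h
  rw [aa_pol, aa_pol, ← e] at ha
  rw [bb_pol, bb_pol, ← e] at hb
  have hsp := (Real.sinh_pos_iff.2 hs).ne'
  have ha := mul_left_cancel₀ hsp ha
  have hb := mul_left_cancel₀ hsp hb
  have hc : cos (θ - θ') = 1 := by
    rw [cos_sub, ha, hb]; nlinarith [sin_sq_add_cos_sq θ']
  obtain ⟨h1, h2⟩ := abs_lt.1 hlt
  have := (Real.cos_eq_one_iff_of_lt_of_lt h1 h2).1 hc
  linarith

lemma Gau.arc_le (g : Gau K G L m) {a b : ℝ} (hab : a ≤ b) :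
    ENNReal.ofReal (dist (bq G a) (bq G b)) ≤ μH[1] (bq G '' Set.Ico a b) := by
  have hl : LipschitzWith 1 (fun z => dist (bq G a) z) := LipschitzWith.dist_right _
  have h1 := hl.hausdorffMeasure_image_le (d := 1) zero_le_one (bq G '' Set.Ico a b)
  simp only [ENNReal.coe_one, ENNReal.one_rpow, one_mul] at h1
  refine le_trans ?_ h1
  have h2 := intermediate_value_Ico hab (f := fun x => dist (bq G a) (bq G x)) (continuous_const.dist g.cont).continuousOn
  simp only [dist_self] at h2
  rw [Set.image_image]
  refine le_trans ?_ (measure_mono h2)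
  rw [hausdorffMeasure_real, Real.volume_Ico, sub_zero]

lemma Gau.perim_le (g : Gau K G L m) (hcl : IsClosed K) (n : ℕ) (hn : 1 ≤ n) :
    ∑ i ∈ Finset.range n, dist (bq G (i * (2 * π / n))) (bq G ((i + 1 : ℕ) * (2 * π / n))) ≤ hypPerim K := by
  have hn0 : (0:ℝ) < n := by exact_mod_cast hn
  set γ := 2 * π / n with hγ
  have hγ0 : 0 < γ := by positivity
  have hγn : n * γ = 2 * π := by rw [hγ]; field_simp
  set A : ℕ → Set ℍ := fun i => bq G '' Set.Ico (i * γ) ((i + 1 : ℕ) * γ) with hA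
  have hle : ∀ i ∈ Finset.range n, ∀ x ∈ Set.Ico (i * γ) ((i + 1 : ℕ) * γ), 0 ≤ x ∧ x < 2 * π := by
    intro i hi x hx
    have : ((i + 1 : ℕ) : ℝ) ≤ n := by exact_mod_cast Finset.mem_range.1 hi
    refine ⟨le_trans (by positivity) hx.1, hx.2.trans_le ?_⟩
    rw [← hγn]; gcongr
  have hdisj : Set.PairwiseDisjoint (↑(Finset.range n)) A := by
    intro i hi j hj hij
    rw [Function.onFun, Set.disjoint_left]
    rintro _ ⟨x, hx, rfl⟩ ⟨y, hy, he⟩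
    have h1 := hle i hi x hx
    have h2 := hle j hj y hy
    have hxy : y = x := pol_inj (g.rad_pos y) (g.rad_pos x) he (by rw [abs_lt]; constructor <;> linarith)
    subst hxy
    have a1 : (i:ℝ) < (j + 1 : ℕ) := lt_of_mul_lt_mul_right (hx.1.trans_lt hy.2) hγ0.le
    have a2 : (j:ℝ) < (i + 1 : ℕ) := lt_of_mul_lt_mul_right (hy.1.trans_lt hx.2) hγ0.le
    have a1 : i < j + 1 := by exact_mod_cast a1
    have a2 : j < i + 1 := by exact_mod_cast a2
    omega
  have hmeas : ∀ i ∈ Finset.range n, MeasurableSet (A i) := by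
    intro i _
    have : Set.Ico ((i:ℝ) * γ) ((i + 1 : ℕ) * γ) = ⋃ k : ℕ, Set.Icc ((i:ℝ) * γ) ((i + 1 : ℕ) * γ - 1 / (k + 1)) := by
      ext x
      simp only [Set.mem_Ico, Set.mem_iUnion, Set.mem_Icc]
      constructor
      · rintro ⟨h1, h2⟩
        obtain ⟨k, hk⟩ := exists_nat_one_div_lt (sub_pos.2 h2)
        exact ⟨k, h1, by linarith⟩
      · rintro ⟨k, h1, h2⟩
        have : (0:ℝ) < 1 / (k + 1) := by positivity
        exact ⟨h1, by linarith⟩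
    rw [hA]; simp only
    rw [this, Set.image_iUnion]
    exact MeasurableSet.iUnion fun k => (isCompact_Icc.image g.cont).isClosed.measurableSet
  have hsum : ∑ i ∈ Finset.range n, ENNReal.ofReal (dist (bq G (i * γ)) (bq G ((i + 1 : ℕ) * γ))) ≤ μH[1] (frontier K) := by
    calc _ ≤ ∑ i ∈ Finset.range n, μH[1] (A i) := by
          apply Finset.sum_le_sum
          intro i _
          exact g.arc_le (by push_cast; nlinarith)
      _ = μH[1] (⋃ i ∈ Finset.range n, A i) := (measure_biUnion_finset hdisj hmeas).symm
      _ ≤ _ := by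
          apply measure_mono
          intro z hz
          simp only [Set.mem_iUnion] at hz
          obtain ⟨i, _, x, _, rfl⟩ := hz
          exact g.bq_frontier x
  rw [← ENNReal.ofReal_sum_of_nonneg (fun _ _ => dist_nonneg)] at hsum
  exact (ENNReal.ofReal_le_iff_le_toReal (g.perim_fin hcl)).1 hsum

end

end HB
end

noncomputable section
open MeasureTheory Metric Real UpperHalfPlane
open scoped UpperHalfPlane ENNReal
namespace HB

section
variable {K : Set ℍ} {G : ℂ → ℝ} {L : NNReal} {m : ℝ}

/-- vertices radii -/
def rr (G : ℂ → ℝ) (n : ℕ) (i : ℕ) : ℝ := rad G (i * (2 * π / n))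

lemma vx_rr (n i : ℕ) : vx n (rr G n) i = bq G (i * (2 * π / n)) := rfl

lemma vc_lin {z p q : ℍ} {lam mu : ℝ} (ha : aa z = lam * aa p + mu * aa q) (hb : bb z = lam * bb p + mu * bb q) :
    vc z = lam * vc p + mu * vc q := by
  apply Complex.ext
  · rw [Complex.add_re, Complex.re_ofReal_mul, Complex.re_ofReal_mul]; exact ha
  · rw [Complex.add_im, Complex.im_ofReal_mul, Complex.im_ofReal_mul]; exact hb

lemma Gau.ext_pos (g : Gau K G L m) {z p q : ℍ} {lam mu : ℝ} (h : vc z = lam * vc p + mu * vc q)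
    (hz : G (vc z) = tt z) (hp : G (vc p) = tt p) (hq : G (vc q) = tt q) (hl : lam ≤ 0) :
    lam * tt p + mu * tt q ≤ tt z := by
  have htz := tt_pos z; have htp := tt_pos p; have htq := tt_pos q
  rcases le_total mu 0 with hm | hm
  · nlinarith
  · have e : (mu : ℂ) * vc q = vc z + ((-lam : ℝ) : ℂ) * vc p := by rw [h]; push_cast; ring
    have := g.add (vc z) (((-lam : ℝ) : ℂ) * vc p)
    rw [← e, g.hom _ _ hm, g.hom _ _ (by linarith), hz, hp, hq] at this
    linarith

lemma sin_int_cases {n : ℕ} (hn : 1 ≤ n) (k : ℤ) : sin (k * (2 * π / n)) ≤ 0 ∨ sin ((1 - k) * (2 * π / n)) ≤ 0 := by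
  have hn0 : (0:ℝ) < n := by exact_mod_cast hn
  have hnz : (0:ℤ) < n := by exact_mod_cast hn
  set γ := 2 * π / n with hγ
  have hγ0 : 0 < γ := by positivity
  have hγn : n * γ = 2 * π := by rw [hγ]; field_simp
  set k' := k % n
  set d := k / n
  have hk : k = k' + n * d := (Int.emod_add_mul_ediv k n).symm
  have h0 : 0 ≤ k' := Int.emod_nonneg _ hnz.ne'
  have h1 : k' < n := Int.emod_lt_of_pos _ hnz
  have hkR : (k:ℝ) = k' + n * d := by exact_mod_cast congrArg (Int.cast (R := ℝ)) hk
  have e1 : sin (k * γ) = sin (k' * γ) := by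
    rw [hkR, show ((k':ℝ) + n * d) * γ = k' * γ + d * (2 * π) by rw [← hγn]; ring, Real.sin_add_int_mul_two_pi]
  have e2 : sin ((1 - k) * γ) = - sin ((k' - 1) * γ) := by
    rw [hkR, show (1 - ((k':ℝ) + n * d)) * γ = - ((k' - 1) * γ + d * (2 * π)) by rw [← hγn]; ring, Real.sin_neg,
      Real.sin_add_int_mul_two_pi]
  rw [e1, e2]
  have h1R : (k':ℝ) ≤ n := by exact_mod_cast h1.le
  rcases h0.eq_or_lt with h | h
  · left; rw [← h]; simp
  have hR : (1:ℝ) ≤ k' := by exact_mod_cast h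
  rcases le_total (k' * γ) π with hp | hp
  · right
    have : 0 ≤ sin ((k' - 1) * γ) := Real.sin_nonneg_of_nonneg_of_le_pi (by nlinarith) (by nlinarith)
    linarith
  · left
    have : 0 ≤ sin (k' * γ - π) := Real.sin_nonneg_of_nonneg_of_le_pi (by linarith) (by nlinarith)
    rw [Real.sin_sub_pi] at this
    linarith

/-- planar decomposition along two directions -/
lemma dir_decomp {a b α β : ℝ} (hs : sin (β - α) ≠ 0) :
    a = (sin β * a - cos β * b) / sin (β - α) * cos α + (cos α * b - sin α * a) / sin (β - α) * cos β ∧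
    b = (sin β * a - cos β * b) / sin (β - α) * sin α + (cos α * b - sin α * a) / sin (β - α) * sin β := by
  constructor
  · field_simp; rw [sin_sub]; ring
  · field_simp; rw [sin_sub]; ring

lemma div_canc {v w s c : ℝ} (hs : s ≠ 0) : v / (w * s) * (s * c) = v / w * c := by
  field_simp

lemma Gau.poly (g : Gau K G L m) {n : ℕ} (hn : 3 ≤ n) : Poly n (rr G n) := by
  have hn0 : (0:ℝ) < n := by have : 0 < n := by omega
                             exact_mod_cast this
  have hn3 : (3:ℝ) ≤ n := by exact_mod_cast hn
  set γ := 2 * π / n with hγ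
  have hγ0 : 0 < γ := by positivity
  have hγn : n * γ = 2 * π := by rw [hγ]; field_simp
  have hγπ : γ < π := by nlinarith [pi_pos]
  have hsγ : 0 < sin γ := Real.sin_pos_of_pos_of_lt_pi hγ0 hγπ
  refine ⟨hn, fun i => g.rad_pos _, ?_, ?_⟩
  · intro i
    unfold rr
    rw [← hγ, show ((i + n : ℕ) : ℝ) * γ = i * γ + 2 * π by push_cast; rw [← hγn]; ring, rad_per]
  · intro i j
    set p := vx n (rr G n) i with hp
    set q := vx n (rr G n) (i + 1) with hq
    set z := vx n (rr G n) j with hz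
    have hDo : 0 < D p q o := by
      have hr1 := Real.sinh_pos_iff.2 (g.rad_pos (i * γ))
      have hr2 := Real.sinh_pos_iff.2 (g.rad_pos ((i + 1 : ℕ) * γ))
      have : D p q o = Real.sinh (rad G (i * γ)) * Real.sinh (rad G ((i + 1 : ℕ) * γ)) * sin γ := by
        have e : sin γ = sin ((i + 1 : ℕ) * γ - i * γ) := by congr 1; push_cast; ring
        rw [e, sin_sub]
        simp only [D, tt_o, aa_o, bb_o, hp, hq, vx_rr, bq, aa_pol, bb_pol, ← hγ]
        ring
      rw [this]; positivity
    have hsub : sin ((i + 1 : ℕ) * γ - i * γ) = sin γ := by congr 1; push_cast; ring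
    obtain ⟨ea, eb⟩ := dir_decomp (a := aa z) (b := bb z) (α := i * γ) (β := (i + 1 : ℕ) * γ) (by rw [hsub]; exact hsγ.ne')
    rw [hsub] at ea eb
    set v := sin ((i + 1 : ℕ) * γ) * aa z - cos ((i + 1 : ℕ) * γ) * bb z with hv
    set u := cos (i * γ) * bb z - sin (i * γ) * aa z with hu
    have hr1 := Real.sinh_pos_iff.2 (g.rad_pos (i * γ))
    have hr2 := Real.sinh_pos_iff.2 (g.rad_pos ((i + 1 : ℕ) * γ))
    have hr3 := Real.sinh_pos_iff.2 (g.rad_pos (j * γ))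
    set lam := v / (sin γ * Real.sinh (rad G (i * γ))) with hlam
    set mu := u / (sin γ * Real.sinh (rad G ((i + 1 : ℕ) * γ))) with hmu
    have ha : aa z = lam * aa p + mu * aa q := by
      rw [ea]; simp only [hp, hq, vx_rr, bq, aa_pol, ← hγ, hlam, hmu]; rw [div_canc hr1.ne', div_canc hr2.ne']
    have hb : bb z = lam * bb p + mu * bb q := by
      rw [eb]; simp only [hp, hq, vx_rr, bq, bb_pol, ← hγ, hlam, hmu]; rw [div_canc hr1.ne', div_canc hr2.ne']
    have hvc := vc_lin ha hb
    have hkey : lam * tt p + mu * tt q ≤ tt z := by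
      have h1 : v = Real.sinh (rad G (j * γ)) * sin ((1 - (((j:ℤ) - i : ℤ) : ℝ)) * γ) := by
        rw [show (1 - (((j:ℤ) - i : ℤ) : ℝ)) * γ = (i + 1 : ℕ) * γ - j * γ by push_cast; ring, sin_sub, hv]
        simp only [hz, vx_rr, bq, aa_pol, bb_pol, ← hγ]; ring
      have h2 : u = Real.sinh (rad G (j * γ)) * sin ((((j:ℤ) - i : ℤ) : ℝ) * γ) := by
        rw [show ((((j:ℤ) - i : ℤ) : ℝ)) * γ = j * γ - i * γ by push_cast; ring, sin_sub, hu]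
        simp only [hz, vx_rr, bq, aa_pol, bb_pol, ← hγ]; ring
      rcases sin_int_cases (n := n) (by omega) ((j:ℤ) - i) with h | h
      · have hu0 : mu ≤ 0 := by
          apply div_nonpos_of_nonpos_of_nonneg _ (by positivity)
          rw [h2]; exact mul_nonpos_of_nonneg_of_nonpos hr3.le h
        have := g.ext_pos (z := z) (p := q) (q := p) (lam := mu) (mu := lam) (by rw [hvc]; ring) (g.bq_eq _) (g.bq_eq _) (g.bq_eq _) hu0
        linarith
      · have hl0 : lam ≤ 0 := by
          apply div_nonpos_of_nonpos_of_nonneg _ (by positivity)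
          rw [h1]; exact mul_nonpos_of_nonneg_of_nonpos hr3.le h
        exact g.ext_pos hvc (g.bq_eq _) (g.bq_eq _) (g.bq_eq _) hl0
    have := D_lin (p := p) (q := q) (z := z) (x := p) (y := q) (nu := tt z - (lam * tt p + mu * tt q)) (by ring) ha hb
    rw [this, D_self1, D_self2]
    have : 0 ≤ tt z - (lam * tt p + mu * tt q) := by linarith
    have := mul_nonneg this hDo.le
    linarith

lemma Gau.PQ_sub (g : Gau K G L m) {n : ℕ} (hn : 3 ≤ n) : PQ n (rr G n) ⊆ K := by
  intro z hz
  have P := g.poly hn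
  obtain ⟨j, -, lam, mu, nu, hl, hm, ht, ha, hb⟩ := P.decomp z
  have hD := D_lin (p := vx n (rr G n) j) (q := vx n (rr G n) (j + 1)) ht ha hb
  rw [D_self1, D_self2] at hD
  have h1 := hz j
  have hDo := P.D_o j
  have hnu : 0 ≤ nu := by
    by_contra hneg
    push Not at hneg
    nlinarith
  rw [g.mem, vc_lin ha hb]
  refine (g.add _ _).trans ?_
  rw [g.hom _ _ hl, g.hom _ _ hm, vx_rr, vx_rr, g.bq_eq, g.bq_eq, ht, vx_rr, vx_rr]
  linarith

lemma Sec_sub {n : ℕ} {ρ : ℕ → ℝ} (P : Poly n ρ) {η : ℝ} (i : ℕ) (hη : dist (vx n ρ i) (vx n ρ (i + 1)) ≤ η) :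
    Sec (i * (2 * π / n)) ((i + 1 : ℕ) * (2 * π / n)) (max (ρ i - η) 0) ⊆ PQ n ρ := by
  rintro z ⟨hu, hv, ht⟩
  set γ := 2 * π / n with hγ
  have hsγ : 0 < sin γ := P.sinγ
  have hsub : sin ((i + 1 : ℕ) * γ - i * γ) = sin γ := by congr 1; push_cast; ring
  obtain ⟨ea, eb⟩ := dir_decomp (a := aa z) (b := bb z) (α := i * γ) (β := (i + 1 : ℕ) * γ) (by rw [hsub]; exact hsγ.ne')
  rw [hsub] at ea eb
  set v := sin ((i + 1 : ℕ) * γ) * aa z - cos ((i + 1 : ℕ) * γ) * bb z with hv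
  set u := cos (i * γ) * bb z - sin (i * γ) * aa z with hu
  have hr1 := Real.sinh_pos_iff.2 (P.pos i)
  have hr2 := Real.sinh_pos_iff.2 (P.pos (i + 1))
  set lam := v / (sin γ * Real.sinh (ρ i)) with hlam
  set mu := u / (sin γ * Real.sinh (ρ (i + 1))) with hmu
  have hl : 0 < lam := by positivity
  have hm : 0 < mu := by positivity
  set p := vx n ρ i with hp
  set q := vx n ρ (i + 1) with hq
  have ha : aa z = lam * aa p + mu * aa q := by
    rw [ea]; simp only [hp, hq, vx, aa_pol, ← hγ, hlam, hmu]; rw [div_canc hr1.ne', div_canc hr2.ne']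
  have hb : bb z = lam * bb p + mu * bb q := by
    rw [eb]; simp only [hp, hq, vx, bb_pol, ← hγ, hlam, hmu]; rw [div_canc hr1.ne', div_canc hr2.ne']
  have hnu : 0 ≤ tt z - (lam * tt p + mu * tt q) := by
    by_contra hneg
    push Not at hneg
    obtain ⟨N, hN, x, hx⟩ := exists_comb p q hl.le hm.le (by positivity)
    have hxz : Comb x (1 / N) z ((lam * tt p + mu * tt q - tt z) / N) o := by
      refine ⟨?_, ?_, ?_⟩
      · rw [hx.t, tt_o]; field_simp; ring
      · rw [hx.a, ha, aa_o]; field_simp; ring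
      · rw [hx.b, hb, bb_o]; field_simp; ring
    have hb1 := hxz.between (by positivity) (div_nonneg (by linarith) hN.le)
    have hb2 := hx.between (by positivity) (by positivity)
    have h0 : dist o z < max (ρ i - η) 0 := by
      rw [dist_lt_iff' (le_max_right _ _)]; simpa [B] using ht
    have h1 : dist o z < ρ i - η := by
      rcases lt_max_iff.1 h0 with h | h
      · exact h
      · exact absurd h (not_lt.2 dist_nonneg)
    have h2 : dist o p = ρ i := dist_o_pol (P.pos i).le _
    have h3 := dist_triangle o x p
    have h4 : 0 ≤ dist z x := dist_nonneg
    have h5 : 0 ≤ dist x q := dist_nonneg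
    have h6 := dist_comm x o
    have h7 := dist_comm z o
    have h8 := dist_comm p x
    linarith
  intro k
  rw [D_lin (x := p) (y := q) (nu := tt z - (lam * tt p + mu * tt q)) (by ring) ha hb]
  have := mul_nonneg hl.le (P.conv k i)
  have := mul_nonneg hm.le (P.conv k (i + 1))
  have := mul_nonneg hnu (P.D_o k).le
  linarith

lemma ang_mem {n : ℕ} {θ : ℝ} {i : ℕ} (hi : i < n) (hn : 3 ≤ n) (hθ : θ ∈ Set.Ico 0 (2 * π))
    (h1 : 0 < sin (θ - i * (2 * π / n))) (h2 : 0 < sin ((i + 1 : ℕ) * (2 * π / n) - θ)) :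
    i * (2 * π / n) < θ ∧ θ < (i + 1 : ℕ) * (2 * π / n) := by
  have hn3 : (3:ℝ) ≤ n := by exact_mod_cast hn
  have hn0 : (0:ℝ) < n := by linarith
  set γ := 2 * π / n with hγ
  have hγ0 : 0 < γ := by positivity
  have hγn : n * γ = 2 * π := by rw [hγ]; field_simp
  have hγπ : γ < π := by nlinarith [pi_pos]
  have hi1 : ((i + 1 : ℕ) : ℝ) ≤ n := by exact_mod_cast hi
  have hle : ((i + 1 : ℕ) : ℝ) * γ ≤ 2 * π := by rw [← hγn]; gcongr
  have hi0 : 0 ≤ (i:ℝ) * γ := by positivity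
  have e : ((i + 1 : ℕ) : ℝ) * γ = i * γ + γ := by push_cast; ring
  obtain ⟨t0, t1⟩ := hθ
  constructor
  · by_contra h
    push Not at h
    have hlt : θ - i * γ < -π := by
      by_contra h'
      push Not at h'
      have := Real.sin_nonpos_of_nonpos_of_neg_pi_le (x := θ - i * γ) (by linarith) h'
      linarith
    have := Real.sin_nonpos_of_nonpos_of_neg_pi_le (x := (i + 1 : ℕ) * γ - θ - 2 * π) (by linarith) (by linarith)
    rw [Real.sin_sub_two_pi] at this
    linarith
  · by_contra h
    push Not at h
    have hlt : (i + 1 : ℕ) * γ - θ < -π := by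
      by_contra h'
      push Not at h'
      have := Real.sin_nonpos_of_nonpos_of_neg_pi_le (x := (i + 1 : ℕ) * γ - θ) (by linarith) h'
      linarith
    have := Real.sin_nonpos_of_nonpos_of_neg_pi_le (x := θ - i * γ - 2 * π) (by linarith) (by linarith)
    rw [Real.sin_sub_two_pi] at this
    linarith

lemma cosh_low {ρ η : ℝ} (hρ : 0 ≤ ρ) (hη : 0 ≤ η) : Real.exp (-η) * Real.cosh ρ ≤ Real.cosh (max (ρ - η) 0) := by
  rcases le_total (ρ - η) 0 with h | h
  · rw [max_eq_right h, Real.cosh_zero, Real.exp_neg, inv_mul_le_iff₀ (Real.exp_pos _), mul_one]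
    have : Real.cosh ρ ≤ Real.exp ρ := by
      rw [Real.cosh_eq]
      have : Real.exp (-ρ) ≤ Real.exp ρ := Real.exp_le_exp.2 (by linarith)
      linarith
    exact this.trans (Real.exp_le_exp.2 (by linarith))
  · rw [max_eq_left h, Real.cosh_eq, Real.cosh_eq]
    have e1 : Real.exp (ρ - η) = Real.exp (-η) * Real.exp ρ := by rw [← Real.exp_add]; congr 1; ring
    have e2 : Real.exp (-η) * Real.exp (-ρ) ≤ Real.exp (-(ρ - η)) := by
      rw [← Real.exp_add]; apply Real.exp_le_exp.2; linarith
    rw [e1]; linarith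

lemma cosh_up {ρ η : ℝ} (hη : 0 ≤ η) : Real.cosh (ρ + η) ≤ Real.exp η * Real.cosh ρ := by
  rw [Real.cosh_eq, Real.cosh_eq]
  have e1 : Real.exp (ρ + η) = Real.exp η * Real.exp ρ := by rw [← Real.exp_add]; congr 1; ring
  have e2 : Real.exp (-(ρ + η)) ≤ Real.exp η * Real.exp (-ρ) := by
    rw [← Real.exp_add]; apply Real.exp_le_exp.2; linarith
  rw [e1]; linarith

lemma PQ_area {n : ℕ} {ρ : ℕ → ℝ} (P : Poly n ρ) {η : ℝ} (hη : ∀ i, dist (vx n ρ i) (vx n ρ (i + 1)) ≤ η)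
    (hfin : hypAreaMeasure (PQ n ρ) ≠ ∞) :
    Real.exp (-η) * (∑ i ∈ Finset.range n, (2 * π / n) * Real.cosh (ρ i)) - 2 * π ≤ (hypAreaMeasure (PQ n ρ)).toReal := by
  set γ := 2 * π / n with hγ
  have hγ0 : 0 < γ := P.γpos
  set S : ℕ → Set ℍ := fun i => Sec (i * γ) ((i + 1 : ℕ) * γ) (max (ρ i - η) 0) with hS
  have hη0 : 0 ≤ η := dist_nonneg.trans (hη 0)
  have hdisj : Set.PairwiseDisjoint (↑(Finset.range n)) S := by
    intro i hi j hj hij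
    rw [Function.onFun, Set.disjoint_left]
    rintro z ⟨a1, a2, a3⟩ ⟨b1, b2, b3⟩
    obtain ⟨θ, hθ, hz⟩ := exists_pol z
    have hs : 0 ≤ Real.sinh (dist o z) := Real.sinh_nonneg_iff.2 dist_nonneg
    rw [hz] at a1 a2 b1 b2
    simp only [aa_pol, bb_pol] at a1 a2 b1 b2
    have f1 : ∀ k : ℕ, 0 < cos (k * γ) * (Real.sinh (dist o z) * sin θ) - sin (k * γ) * (Real.sinh (dist o z) * cos θ) →
        0 < sin (θ - k * γ) := by
      intro k h
      rw [sin_sub]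
      by_contra h'
      push Not at h'
      have := mul_nonpos_of_nonneg_of_nonpos hs h'
      linarith
    have f2 : ∀ k : ℕ, 0 < sin (k * γ) * (Real.sinh (dist o z) * cos θ) - cos (k * γ) * (Real.sinh (dist o z) * sin θ) →
        0 < sin (k * γ - θ) := by
      intro k h
      rw [sin_sub]
      by_contra h'
      push Not at h'
      have := mul_nonpos_of_nonneg_of_nonpos hs h'
      linarith
    have c1 := ang_mem (Finset.mem_range.1 hi) P.n3 hθ (f1 _ a1) (f2 _ a2)
    have c2 := ang_mem (Finset.mem_range.1 hj) P.n3 hθ (f1 _ b1) (f2 _ b2)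
    have a1 : (i:ℝ) < (j + 1 : ℕ) := lt_of_mul_lt_mul_right (c1.1.trans c2.2) hγ0.le
    have a2 : (j:ℝ) < (i + 1 : ℕ) := lt_of_mul_lt_mul_right (c2.1.trans c1.2) hγ0.le
    have a1 : i < j + 1 := by exact_mod_cast a1
    have a2 : j < i + 1 := by exact_mod_cast a2
    omega
  have hsum : ∑ i ∈ Finset.range n, ENNReal.ofReal (γ * (Real.cosh (max (ρ i - η) 0) - 1)) ≤ hypAreaMeasure (PQ n ρ) := by
    calc _ ≤ ∑ i ∈ Finset.range n, hypAreaMeasure (S i) := by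
          apply Finset.sum_le_sum
          intro i _
          have e : ((i + 1 : ℕ) : ℝ) * γ - i * γ = γ := by push_cast; ring
          have := Sec_area (α := i * γ) (β := (i + 1 : ℕ) * γ) (r := max (ρ i - η) 0) (by rw [e]; exact P.γlt) (le_max_right _ _)
          rwa [e] at this
      _ = hypAreaMeasure (⋃ i ∈ Finset.range n, S i) := (measure_biUnion_finset hdisj (fun i _ => measurable_Sec _ _ _)).symm
      _ ≤ _ := by
          apply measure_mono
          intro z hz
          simp only [Set.mem_iUnion] at hz
          obtain ⟨i, _, hz⟩ := hz
          exact Sec_sub P i (hη i) hz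
  rw [← ENNReal.ofReal_sum_of_nonneg (fun i _ => mul_nonneg hγ0.le (by linarith [Real.one_le_cosh (max (ρ i - η) 0)]))] at hsum
  refine le_trans ?_ ((ENNReal.ofReal_le_iff_le_toReal hfin).1 hsum)
  have e : 2 * π = ∑ i ∈ Finset.range n, γ := by rw [Finset.sum_const, Finset.card_range, nsmul_eq_mul, P.nγ]
  rw [e, Finset.mul_sum, ← Finset.sum_sub_distrib]
  apply Finset.sum_le_sum
  intro i _
  have := cosh_low (η := η) (P.pos i).le hη0
  nlinarith

lemma Gau.area_up (g : Gau K G L m) {n : ℕ} (hn : 3 ≤ n) {η : ℝ} (hη0 : 0 ≤ η)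
    (hη : ∀ x y, |x - y| ≤ 2 * π / n → dist (bq G x) (bq G y) ≤ η) :
    hypArea K + 2 * π ≤ Real.exp η * (∑ i ∈ Finset.range n, (2 * π / n) * Real.cosh (rr G n i)) := by
  have P := g.poly hn
  set γ := 2 * π / n with hγ
  have hγ0 : 0 < γ := P.γpos
  have hcov : K ⊆ ⋃ i ∈ Finset.range n, CSec (i * γ) ((i + 1 : ℕ) * γ) (rr G n i + η) := by
    intro z hz
    obtain ⟨θ, hθ, hzθ⟩ := exists_pol z
    have hd : 0 ≤ dist o z := dist_nonneg
    have hs : 0 ≤ Real.sinh (dist o z) := Real.sinh_nonneg_iff.2 hd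
    set i := ⌊θ / γ⌋₊ with hi
    have h1 : (i:ℝ) * γ ≤ θ := by
      rw [← le_div_iff₀ hγ0]; exact Nat.floor_le (div_nonneg hθ.1 hγ0.le)
    have h2 : θ < (i + 1 : ℕ) * γ := by
      rw [← div_lt_iff₀ hγ0]; push_cast; exact Nat.lt_floor_add_one _
    have hin : i < n := by
      have : (i:ℝ) * γ < n * γ := by rw [hγ, P.nγ, ← hγ]; exact h1.trans_lt hθ.2
      have := lt_of_mul_lt_mul_right this hγ0.le
      exact_mod_cast this
    have e : ((i + 1 : ℕ) : ℝ) * γ = i * γ + γ := by push_cast; ring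
    simp only [Set.mem_iUnion, Finset.mem_range]
    refine ⟨i, hin, ?_⟩
    have hsr : dist o z ≤ rad G θ := by rw [← g.pol_mem hd, ← hzθ]; exact hz
    have hrad : rad G θ ≤ rr G n i + η := by
      have a1 : dist o (bq G θ) = rad G θ := dist_o_pol (g.rad_pos θ).le _
      have a2 : dist o (bq G (i * γ)) = rr G n i := dist_o_pol (g.rad_pos _).le _
      have := dist_triangle o (bq G (i * γ)) (bq G θ)
      have := hη (i * γ) θ (by rw [abs_le]; constructor <;> linarith)
      linarith
    have hγπ : γ < π := P.γlt
    refine ⟨?_, ?_, ?_⟩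
    · rw [hzθ]; simp only [aa_pol, bb_pol]
      have := mul_nonneg hs (Real.sin_nonneg_of_nonneg_of_le_pi (x := θ - i * γ) (by linarith) (by linarith))
      rw [sin_sub] at this; linarith
    · rw [hzθ]; simp only [aa_pol, bb_pol]
      have := mul_nonneg hs (Real.sin_nonneg_of_nonneg_of_le_pi (x := (i + 1 : ℕ) * γ - θ) (by linarith) (by linarith))
      rw [sin_sub] at this; linarith
    · have hr : 0 ≤ rr G n i + η := by linarith
      have := (dist_le_iff' hr (z := o) (w := z)).1 (hsr.trans hrad)
      simpa [B] using this
  have hle : hypAreaMeasure K ≤ ∑ i ∈ Finset.range n, ENNReal.ofReal (γ * (Real.cosh (rr G n i + η) - 1)) := by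
    refine (measure_mono hcov).trans ((measure_biUnion_finset_le _ _).trans ?_)
    apply Finset.sum_le_sum
    intro i _
    have e : ((i + 1 : ℕ) : ℝ) * γ - i * γ = γ := by push_cast; ring
    have := CSec_area (α := i * γ) (β := (i + 1 : ℕ) * γ) (r := rr G n i + η) (by rw [e]; exact hγ0) (by rw [e]; exact P.γlt)
      (add_nonneg (P.pos i).le hη0)
    rwa [e] at this
  rw [← ENNReal.ofReal_sum_of_nonneg (fun i _ => mul_nonneg hγ0.le (by linarith [Real.one_le_cosh (rr G n i + η)]))] at hle
  have hA := ENNReal.toReal_le_of_le_ofReal (Finset.sum_nonneg (fun i _ => mul_nonneg hγ0.le (by linarith [Real.one_le_cosh (rr G n i + η)]))) hle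
  have e : 2 * π = ∑ i ∈ Finset.range n, γ := by rw [Finset.sum_const, Finset.card_range, nsmul_eq_mul, P.nγ]
  change hypArea K ≤ _ at hA
  have hs : ∑ i ∈ Finset.range n, γ * (Real.cosh (rr G n i + η) - 1) + ∑ i ∈ Finset.range n, γ
      ≤ Real.exp η * (∑ i ∈ Finset.range n, γ * Real.cosh (rr G n i)) := by
    rw [← Finset.sum_add_distrib, Finset.mul_sum]
    apply Finset.sum_le_sum
    intro i _
    have := cosh_up (ρ := rr G n i) hη0
    nlinarith
  linarith

lemma Gau.modn (g : Gau K G L m) {η : ℝ} (hη : 0 < η) : ∃ N0 : ℕ, ∀ n ≥ N0, ∀ x y, |x - y| ≤ 2 * π / n →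
    dist (bq G x) (bq G y) ≤ η := by
  obtain ⟨C, hC⟩ := g.exists_lip
  obtain ⟨N0, hN0⟩ := exists_nat_gt (C * (2 * π) / η)
  refine ⟨N0, fun n hn x y hxy => ?_⟩
  have hC0 : (0:ℝ) ≤ C := C.2
  have h1 : C * (2 * π) / η < n := hN0.trans_le (by exact_mod_cast hn)
  have hn0 : (0:ℝ) < n := lt_of_le_of_lt (by positivity) h1
  refine (hC.dist_le_mul x y).trans ?_
  rw [Real.dist_eq]
  calc (C:ℝ) * |x - y| ≤ C * (2 * π / n) := by gcongr
    _ = C * (2 * π) / n := by ring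
    _ ≤ η := by rw [div_le_iff₀ hn0]; rw [div_lt_iff₀ hη] at h1; linarith

lemma circum_le {K : Set ℍ} {z c : ℍ} (hz : z ∈ K) {r : ℝ} (h : K ⊆ closedBall c r) : hypCircumradius K ≤ r := by
  refine csInf_le ⟨0, ?_⟩ ⟨c, h⟩
  rintro R ⟨c', hc'⟩
  exact dist_nonneg.trans (mem_closedBall.1 (hc' hz))

lemma Gau.sub_ball (g : Gau K G L m) {c : ℍ} {r : ℝ} (h : ∀ x, dist c (bq G x) ≤ r) : K ⊆ closedBall c r := by
  have ho : dist c o ≤ r := by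
    have h1 := g.rad_pos 0
    have h2 := g.rad_pos π
    have hs1 := Real.sinh_pos_iff.2 h1
    have hs2 := Real.sinh_pos_iff.2 h2
    have hs3 : 0 < Real.sinh (rad G 0 + rad G π) := Real.sinh_pos_iff.2 (by linarith)
    have : Comb o (Real.sinh (rad G π) / Real.sinh (rad G 0 + rad G π)) (bq G 0)
       (Real.sinh (rad G 0) / Real.sinh (rad G 0 + rad G π)) (bq G π) := by
      refine ⟨?_, ?_, ?_⟩
      · simp only [bq, tt_o, tt_pol]; field_simp; rw [Real.sinh_add]; ring
      · simp only [bq, aa_o, aa_pol, cos_zero, cos_pi]; field_simp; ring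
      · simp [bq]
    exact this.dist_le (by positivity) (by positivity) (h _) (h _)
  intro z hz
  obtain ⟨θ, hθ, hzθ⟩ := exists_pol z
  have hd : 0 ≤ dist o z := dist_nonneg
  have hsr : dist o z ≤ rad G θ := by rw [← g.pol_mem hd, ← hzθ]; exact hz
  have hs := Real.sinh_pos_iff.2 (g.rad_pos θ)
  have : Comb z (Real.sinh (rad G θ - dist o z) / Real.sinh (rad G θ)) o (Real.sinh (dist o z) / Real.sinh (rad G θ)) (bq G θ) := by
    rw [show Comb z = Comb (pol (dist o z) θ) by rw [← hzθ]]
    refine ⟨?_, ?_, ?_⟩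
    · simp only [bq, tt_o, tt_pol]; field_simp; rw [Real.sinh_sub]; ring
    · simp only [bq, aa_o, aa_pol]; field_simp; ring
    · simp only [bq, bb_o, bb_pol]; field_simp; ring
  rw [mem_closedBall, dist_comm]
  exact this.dist_le (div_nonneg (Real.sinh_nonneg_iff.2 (by linarith)) hs.le)
    (div_nonneg (Real.sinh_nonneg_iff.2 hd) hs.le) ho (h _)

lemma Gau.far (g : Gau K G L m) {n : ℕ} (hn : 3 ≤ n) {ε η : ℝ} 
    (hη : ∀ x y, |x - y| ≤ 2 * π / n → dist (bq G x) (bq G y) ≤ η) (hε : ε + η < hypCircumradius K) (c : ℍ) :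
    ∃ j, ε ≤ dist c (vx n (rr G n) j) := by
  by_contra hcon
  push Not at hcon
  have P := g.poly hn
  have hγ0 : 0 < 2 * π / (n:ℝ) := P.γpos
  have hpos : ∀ x, 0 ≤ x → dist c (bq G x) ≤ ε + η := by
    intro x hx
    set i := ⌊x / (2 * π / n)⌋₊ with hi
    have h1 : (i:ℝ) * (2 * π / n) ≤ x := by
      rw [← le_div_iff₀ hγ0]; exact Nat.floor_le (div_nonneg hx hγ0.le)
    have h2 : x < (i + 1) * (2 * π / n) := by
      rw [← div_lt_iff₀ hγ0]; exact Nat.lt_floor_add_one _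
    have h3 := hcon i
    rw [vx_rr] at h3
    have h4 := hη (i * (2 * π / n)) x (by rw [abs_le]; constructor <;> linarith)
    have := dist_triangle c (bq G (i * (2 * π / n))) (bq G x)
    linarith
  have hall : ∀ x, dist c (bq G x) ≤ ε + η := by
    have hk : ∀ (k : ℕ) x, bq G (x + k * (2 * π)) = bq G x := by
      intro k
      induction k with
      | zero => intro x; simp
      | succ k ih => intro x; rw [← ih x, ← bq_per (x + k * (2 * π))]; congr 1; push_cast; ring
    intro x
    obtain ⟨k, hk'⟩ := exists_nat_gt (-x / (2 * π))
    rw [← hk k x]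
    apply hpos
    rw [div_lt_iff₀ (by positivity)] at hk'
    linarith
  have := circum_le (g.bq_mem 0) (g.sub_ball hall)
  linarith

theorem Gau.main (g : Gau K G L m) (hK : IsCompact K) {ε : ℝ} (hε : 0 < ε) (hεR : ε < hypCircumradius K) :
    (hypArea K + 2 * π) * Real.cosh ε - 2 * π ≤ hypPerim K * Real.sinh ε + (hypAreaMeasure (Gq K ε)).toReal := by
  have hKfin : hypAreaMeasure K ≠ ∞ := by
    obtain ⟨R0, hR0⟩ := hK.isBounded.subset_closedBall o
    have : K ⊆ closedBall o (max R0 0) := hR0.trans (closedBall_subset_closedBall (le_max_left _ _))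
    exact ((measure_mono this).trans (ball_area o (le_max_right _ _))).trans_lt ENNReal.ofReal_lt_top |>.ne
  have hGqK : Gq K ε ⊆ K := fun c hc => hc (mem_ball_self hε)
  have hA0 : 0 ≤ hypArea K := ENNReal.toReal_nonneg
  set a := hypArea K + 2 * π with ha
  have ha0 : 0 ≤ a := by positivity
  have hce : 0 ≤ Real.cosh ε - 1 := by linarith [Real.one_le_cosh ε]
  -- the approximate inequality
  have key : ∀ η ∈ Set.Ioo 0 (hypCircumradius K - ε), Real.exp (-η) * (Real.exp (-η) * a) - 2 * π
      + Real.exp (-η) * (2 * (Real.exp (-η) * a) / (Real.cosh η + 1)) * (Real.cosh ε - 1)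
      ≤ hypPerim K * Real.sinh ε + (hypAreaMeasure (Gq K ε)).toReal := by
    rintro η ⟨hη, hηR⟩
    obtain ⟨N0, hN0⟩ := g.modn hη
    have hsin : ∀ᶠ n : ℕ in Filter.atTop, Real.exp (-η) * (2 * π / n) ≤ sin (2 * π / n) := by
      have h1 : Filter.Tendsto (fun n : ℕ => 2 * π / (n:ℝ)) Filter.atTop (nhds 0) :=
        tendsto_const_div_atTop_nhds_zero_nat _
      have h2 : Filter.Tendsto (fun n : ℕ => Real.sinc (2 * π / (n:ℝ))) Filter.atTop (nhds 1) := by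
        have := (Real.continuous_sinc.tendsto 0).comp h1
        rwa [Real.sinc_zero] at this
      have h3 : Real.exp (-η) < 1 := by rw [Real.exp_lt_one_iff]; linarith
      filter_upwards [h2.eventually (lt_mem_nhds h3), Filter.eventually_gt_atTop 0] with n hn hn0
      have hn0 : (0:ℝ) < n := by exact_mod_cast hn0
      have hp : 0 < 2 * π / (n:ℝ) := by positivity
      rw [Real.sinc_of_ne_zero hp.ne', lt_div_iff₀ hp] at hn
      exact hn.le
    obtain ⟨n, hns, hnN, hn3⟩ := (hsin.and ((Filter.eventually_ge_atTop N0).and (Filter.eventually_ge_atTop 3))).exists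
    have hmod := hN0 n hnN
    have P := g.poly hn3
    have hγ0 : 0 < 2 * π / (n:ℝ) := P.γpos
    have hell : ∀ i, dist (vx n (rr G n) i) (vx n (rr G n) (i + 1)) ≤ η := by
      intro i
      rw [vx_rr, vx_rr]
      apply hmod
      rw [abs_sub_comm, show ((i + 1 : ℕ) : ℝ) * (2 * π / n) - i * (2 * π / n) = 2 * π / n by push_cast; ring, abs_of_pos hγ0]
    have hPK := g.PQ_sub hn3
    have hPfin : hypAreaMeasure (PQ n (rr G n)) ≠ ∞ := ((measure_mono hPK).trans_lt hKfin.lt_top).ne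
    have hreal := poly_real P hε (g.far hn3 hmod (by linarith)) hPfin
    have hlow := PQ_area P hell hPfin
    have hup := g.area_up hn3 hη.le hmod
    set X := ∑ i ∈ Finset.range n, (2 * π / n) * Real.cosh (rr G n i) with hX
    have hXa : Real.exp (-η) * a ≤ X := by
      rw [Real.exp_neg, inv_mul_le_iff₀ (Real.exp_pos _)]; exact hup
    have hX0 : 0 ≤ X := le_trans (by positivity) hXa
    have hGm : (hypAreaMeasure (Gq (PQ n (rr G n)) ε)).toReal ≤ (hypAreaMeasure (Gq K ε)).toReal := by
      apply ENNReal.toReal_mono ((measure_mono hGqK).trans_lt hKfin.lt_top).ne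
      exact measure_mono (fun c hc => Set.Subset.trans hc hPK)
    have hPer : ∑ i ∈ Finset.range n, dist (vx n (rr G n) i) (vx n (rr G n) (i + 1)) ≤ hypPerim K := by
      have := g.perim_le hK.isClosed n (by omega)
      exact this
    have hang : Real.exp (-η) * (2 * X / (Real.cosh η + 1)) ≤ ∑ i ∈ Finset.range n,
        sin (2 * π / n) * (Real.cosh (rr G n i) + Real.cosh (rr G n (i + 1)))
          / (Real.cosh (dist (vx n (rr G n) i) (vx n (rr G n) (i + 1))) + 1) := by
      have hshift : ∑ i ∈ Finset.range n, Real.cosh (rr G n (i + 1)) = ∑ i ∈ Finset.range n, Real.cosh (rr G n i) := by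
        have h1 := Finset.sum_range_succ' (fun i => Real.cosh (rr G n i)) n
        have h2 := Finset.sum_range_succ (fun i => Real.cosh (rr G n i)) n
        have h3 : rr G n n = rr G n 0 := by have := P.per 0; rwa [zero_add] at this
        rw [h3] at h2
        linarith
      calc Real.exp (-η) * (2 * X / (Real.cosh η + 1))
          = ∑ i ∈ Finset.range n, (Real.exp (-η) * (2 * π / n)) * (Real.cosh (rr G n i) + Real.cosh (rr G n (i + 1))) / (Real.cosh η + 1) := by
            rw [← Finset.sum_div, ← Finset.mul_sum, Finset.sum_add_distrib, hshift, hX, ← Finset.mul_sum]; ring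
        _ ≤ _ := by
            apply Finset.sum_le_sum
            intro i _
            have hc1 := Real.cosh_pos (rr G n i)
            have hc2 := Real.cosh_pos (rr G n (i + 1))
            have hc3 := Real.cosh_pos (dist (vx n (rr G n) i) (vx n (rr G n) (i + 1)))
            have : Real.cosh (dist (vx n (rr G n) i) (vx n (rr G n) (i + 1))) ≤ Real.cosh η := by
              rw [Real.cosh_le_cosh, abs_of_nonneg dist_nonneg, abs_of_pos hη]; exact hell i
            have hsγ := P.sinγ
            gcongr
    have hsh : 0 ≤ Real.sinh ε := Real.sinh_nonneg_iff.2 hε.le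
    have hch := Real.cosh_pos η
    have s1 : Real.exp (-η) * (Real.exp (-η) * a) ≤ Real.exp (-η) * X := by gcongr
    have s2 : Real.exp (-η) * (2 * (Real.exp (-η) * a) / (Real.cosh η + 1)) * (Real.cosh ε - 1)
        ≤ Real.exp (-η) * (2 * X / (Real.cosh η + 1)) * (Real.cosh ε - 1) := by gcongr
    have s3 := mul_le_mul_of_nonneg_right hang hce
    have s4 := mul_le_mul_of_nonneg_right hPer hsh
    linarith
  have hcont : ContinuousAt (fun η : ℝ => Real.exp (-η) * (Real.exp (-η) * a) - 2 * π
      + Real.exp (-η) * (2 * (Real.exp (-η) * a) / (Real.cosh η + 1)) * (Real.cosh ε - 1)) 0 := by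
    apply Continuous.continuousAt
    have : ∀ η : ℝ, Real.cosh η + 1 ≠ 0 := fun η => by have := Real.cosh_pos η; positivity
    fun_prop (disch := assumption)
  have hlim := (hcont.tendsto.mono_left (nhdsWithin_le_nhds (s := Set.Ioi 0)))
  have hfin := le_of_tendsto hlim (by
    filter_upwards [Ioo_mem_nhdsGT (show (0:ℝ) < hypCircumradius K - ε by linarith)] with η hη
    exact key η hη)
  simp only [neg_zero, Real.exp_zero, one_mul, Real.cosh_zero] at hfin
  refine le_trans (le_of_eq ?_) hfin
  ring

end
end HB
end

noncomputable section
open MeasureTheory Metric Real UpperHalfPlane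
open scoped UpperHalfPlane ENNReal
namespace HB

def Mot.iso (T : Mot) : ℍ ≃ᵢ ℍ where
  toFun := T.f
  invFun := T.g
  left_inv := T.gf
  right_inv := T.fg
  isometry_toFun := Isometry.of_dist_eq T.dist_f

/-- Moving the set into a position where the base point is interior. -/
lemma main_int {K : Set ℍ} (hK : IsCompact K) (hc : HypConvex K) (hi : (interior K).Nonempty) {ε : ℝ}
    (hε : 0 < ε) (hεR : ε < hypCircumradius K) :
    (hypArea K + 2 * π) * Real.cosh ε - 2 * π ≤
      hypPerim K * Real.sinh ε + (hypAreaMeasure (Gq K ε)).toReal := by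
  obtain ⟨c, hci⟩ := hi
  obtain ⟨T, hT⟩ := exists_mot c
  have hK' : IsCompact (T.f '' K) := hK.image T.hc
  have hpre : ∀ S : Set ℍ, T.f ⁻¹' (T.f '' S) = S := fun S => Set.preimage_image_eq _ (fun z w h => T.inj h)
  have hmem : ∀ (S : Set ℍ) z, z ∈ T.f '' S ↔ T.g z ∈ S := by
    intro S z
    constructor
    · rintro ⟨w, hw, rfl⟩; rwa [T.gf]
    · intro h; exact ⟨_, h, T.fg z⟩
  have hc' : HypConvex (T.f '' K) := by
    intro x hx y hy z hz
    rw [hmem] at *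
    exact hc _ hx _ hy _ (by simpa only [T.dist_g] using hz)
  have hcl : ∀ S : Set ℍ, MeasurableSet (T.f '' S) → hypAreaMeasure (T.f '' S) = hypAreaMeasure S := by
    intro S hS
    rw [← T.hμ _ hS, hpre]
  have hint : o ∈ interior (T.f '' K) := by
    have : T.iso.toHomeomorph '' interior K = interior (T.iso.toHomeomorph '' K) := T.iso.toHomeomorph.image_interior K
    rw [show T.f '' K = T.iso.toHomeomorph '' K from rfl, ← this]
    exact ⟨c, hci, hT⟩
  have hA : hypArea (T.f '' K) = hypArea K := by
    unfold hypArea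
    rw [hcl _ hK'.isClosed.measurableSet]
  have hP : hypPerim (T.f '' K) = hypPerim K := by
    unfold hypPerim
    have : T.iso.toHomeomorph '' frontier K = frontier (T.iso.toHomeomorph '' K) := T.iso.toHomeomorph.image_frontier K
    rw [show T.f '' K = T.iso.toHomeomorph '' K from rfl, ← this]
    have := T.iso.hausdorffMeasure_image 1 (frontier K)
    rw [show (T.iso.toHomeomorph '' frontier K) = (T.iso '' frontier K) from rfl, this]
  have hR : hypCircumradius (T.f '' K) = hypCircumradius K := by
    unfold hypCircumradius
    congr 1
    ext R
    constructor
    · rintro ⟨d, hd⟩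
      refine ⟨T.g d, fun x hx => ?_⟩
      have := hd ⟨x, hx, rfl⟩
      rw [mem_closedBall] at *
      rwa [← T.dist_f, T.fg]
    · rintro ⟨d, hd⟩
      refine ⟨T.f d, ?_⟩
      rintro _ ⟨x, hx, rfl⟩
      rw [mem_closedBall, T.dist_f]
      exact hd hx
  have hG : Gq (T.f '' K) ε = T.f '' Gq K ε := by
    ext z
    rw [hmem]
    constructor
    · intro h x hx
      have : T.f x ∈ T.f '' K := h (by rw [mem_ball] at *; rwa [← T.dist_g, T.gf])
      rwa [hmem, T.gf] at this
    · intro h x hx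
      rw [hmem]
      exact h (by rw [mem_ball] at *; rwa [T.dist_g])
  obtain ⟨G, L, m, g⟩ := exists_gau hK' hc' hint
  have := g.main hK' hε (by rwa [hR])
  rw [hA, hP, hG, hcl _ (by rw [← hG]; exact (isClosed_Gq _ _).measurableSet)] at this
  exact this

lemma extend (p c : ℍ) {t : ℝ} (ht : 0 ≤ t) : ∃ x, dist x c = t ∧ dist x p = dist c p + t := by
  obtain ⟨T, hp, hc⟩ := exists_mot2 p c
  refine ⟨T.g (pol (dist p c + t) 0), ?_, ?_⟩
  · have h : Real.cosh (dist (T.g (pol (dist p c + t) 0)) c) = Real.cosh t := by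
      rw [← T.dist_f, T.fg, hc, cosh_dist_eq, show t = (dist p c + t) - dist p c by ring, Real.cosh_sub]
      simp [B]
    have h1 := Real.cosh_le_cosh.1 h.le
    have h2 := Real.cosh_le_cosh.1 h.ge
    rw [abs_of_nonneg dist_nonneg, abs_of_nonneg ht] at h1 h2
    exact le_antisymm h1 h2
  · rw [← T.dist_f, T.fg, hp, dist_comm, dist_o_pol (by positivity), dist_comm c p]

lemma Gq_sub {K : Set ℍ} {p : ℍ} {R ε : ℝ} (hK : K ⊆ closedBall p R) (hε : 0 < ε) :
    Gq K ε ⊆ closedBall p (R - ε) := by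
  intro c hc
  rw [mem_closedBall]
  by_contra! h
  obtain ⟨t, ht1, ht2⟩ : ∃ t, max 0 (R - dist c p) < t ∧ t < ε := exists_between (max_lt hε (by linarith))
  obtain ⟨x, h1, h2⟩ := extend p c ((le_max_left _ _).trans ht1.le)
  have := hK (hc (show x ∈ ball c ε by rw [mem_ball]; linarith))
  rw [mem_closedBall] at this
  have := le_max_right 0 (R - dist c p)
  linarith

lemma inr_le {K : Set ℍ} {p c : ℍ} {R r : ℝ} (hK : K ⊆ closedBall p R) (hc : closedBall c r ⊆ K) (hr : 0 ≤ r) : r ≤ R := by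
  obtain ⟨x, h1, h2⟩ := extend p c hr
  have := hK (hc (show x ∈ closedBall c r by rw [mem_closedBall]; linarith))
  rw [mem_closedBall] at this
  have : 0 ≤ dist c p := dist_nonneg
  linarith

lemma final_alg {A P s1 s2 : ℝ} (hA : 0 ≤ A) (hP : 0 ≤ P)
    (h1 : 0 ≤ s1) (h2 : 0 ≤ s2)
    (e1 : (A + 2 * π) * Real.cosh s1 - 2 * π ≤ P * Real.sinh s1)
    (e2 : (A + 2 * π) * Real.cosh s2 - 2 * π ≤ P * Real.sinh s2) :
    P ^ 2 - A * (4 * π + A) ≥ min (4 * π ^ 2)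
      ((Real.sinh s2 - Real.sinh s1) ^ 2 * ((2 * π + A) ^ 2 - P ^ 2) ^ 2 / (4 * (2 * π + A) ^ 2)) := by
  have hpi := pi_pos
  rcases le_total (2 * π + A) P with h | h
  · refine (min_le_left _ _).trans ?_
    nlinarith
  · refine (min_le_right _ _).trans ?_
    have key : ∀ s, 0 ≤ s → (A + 2 * π) * Real.cosh s - 2 * π ≤ P * Real.sinh s →
        (((2 * π + A) ^ 2 - P ^ 2) * Real.sinh s - 2 * π * P) ^ 2 ≤ (2 * π + A) ^ 2 * (P ^ 2 - A * (4 * π + A)) := by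
      intro s hs e
      have hs' := Real.sinh_nonneg_iff.2 hs
      have hc := Real.cosh_sq s
      have hc1 := Real.one_le_cosh s
      have hsq : ((A + 2 * π) * Real.cosh s) ^ 2 ≤ (P * Real.sinh s + 2 * π) ^ 2 := by
        apply pow_le_pow_left₀ (by positivity); linarith
      have hk : 0 ≤ (2 * π + A) ^ 2 - P ^ 2 := by nlinarith
      have : ((2 * π + A) ^ 2 - P ^ 2) * Real.sinh s ^ 2 - 4 * π * P * Real.sinh s + (2 * π + A) ^ 2 - 4 * π ^ 2 ≤ 0 := by
        rw [mul_pow, hc] at hsq; nlinarith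
      nlinarith [mul_nonneg hk (neg_nonneg.2 this)]
    have k1 := key s1 h1 e1
    have k2 := key s2 h2 e2
    rw [div_le_iff₀ (by positivity)]
    nlinarith [sq_nonneg ((((2 * π + A) ^ 2 - P ^ 2) * Real.sinh s1 - 2 * π * P) + (((2 * π + A) ^ 2 - P ^ 2) * Real.sinh s2 - 2 * π * P))]

theorem bonn {K : Set ℍ} (hK : IsCompact K) (hc : HypConvex K) (hi : (interior K).Nonempty) :
    ∃ s1 s2, 0 ≤ s1 ∧ 0 ≤ s2 ∧ s1 = hypInradius K ∧ s2 = hypCircumradius K ∧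
    (hypArea K + 2 * π) * Real.cosh s1 - 2 * π ≤ hypPerim K * Real.sinh s1 ∧
    (hypArea K + 2 * π) * Real.cosh s2 - 2 * π ≤ hypPerim K * Real.sinh s2 := by
  obtain ⟨c0, hc0⟩ := hi
  have hi : (interior K).Nonempty := ⟨c0, hc0⟩
  obtain ⟨d, hd, hdK⟩ := nhds_basis_closedBall.mem_iff.1 (mem_interior_iff_mem_nhds.1 hc0)
  obtain ⟨R0, hR0⟩ := hK.isBounded.subset_closedBall c0
  set R := hypCircumradius K with hR
  set r := hypInradius K with hr
  have hbdd : BddAbove {r : ℝ | ∃ c : ℍ, closedBall c r ⊆ K} := by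
    refine ⟨max R0 0, ?_⟩
    rintro t ⟨c, hct⟩
    rcases le_total 0 t with h | h
    · exact (inr_le hR0 hct h).trans (le_max_left _ _)
    · exact h.trans (le_max_right _ _)
  have hdr : d ≤ r := le_csSup hbdd (show d ∈ {r : ℝ | ∃ c : ℍ, closedBall c r ⊆ K} from ⟨c0, hdK⟩)
  have happ : ∀ R', R < R' → ∃ p, K ⊆ closedBall p R' := by
    intro R' h
    obtain ⟨t, ⟨p, hp⟩, ht⟩ := exists_lt_of_csInf_lt (s := {R : ℝ | ∃ c : ℍ, K ⊆ closedBall c R}) ⟨R0, c0, hR0⟩ h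
    exact ⟨p, hp.trans (closedBall_subset_closedBall ht.le)⟩
  have hrR : r ≤ R := by
    apply csSup_le (s := {r : ℝ | ∃ c : ℍ, closedBall c r ⊆ K}) ⟨d, c0, hdK⟩
    rintro t ⟨c, hct⟩
    rcases le_total 0 t with h | h
    · refine le_csInf (s := {R : ℝ | ∃ c : ℍ, K ⊆ closedBall c R}) ⟨R0, c0, hR0⟩ ?_
      rintro R' ⟨p, hp⟩
      exact inr_le hp hct h
    · refine h.trans ?_
      refine le_csInf (s := {R : ℝ | ∃ c : ℍ, K ⊆ closedBall c R}) ⟨R0, c0, hR0⟩ ?_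
      rintro R' ⟨p, hp⟩
      exact hd.le.trans (inr_le hp hdK hd.le)
  have hr0 : 0 < r := hd.trans_le hdr
  have hR0' : 0 < R := hr0.trans_le hrR
  have main := fun ε (h1 : 0 < ε) (h2 : ε < R) => main_int hK hc hi h1 h2
  have hstarR : (hypArea K + 2 * π) * Real.cosh R - 2 * π ≤ hypPerim K * Real.sinh R := by
    have h : ∀ ε ∈ Set.Ioo 0 R, (hypArea K + 2 * π) * Real.cosh ε - 2 * π ≤
        hypPerim K * Real.sinh ε + 2 * π * (Real.cosh (2 * (R - ε)) - 1) := by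
      rintro ε ⟨h1, h2⟩
      obtain ⟨p, hp⟩ := happ (2 * R - ε) (by linarith)
      have hs := (measure_mono (μ := hypAreaMeasure) (Gq_sub hp h1)).trans (ball_area p (by linarith))
      have := ENNReal.toReal_mono ENNReal.ofReal_ne_top hs
      rw [ENNReal.toReal_ofReal (mul_nonneg (by positivity) (by linarith [Real.one_le_cosh (2 * R - ε - ε)])),
        show 2 * R - ε - ε = 2 * (R - ε) by ring] at this
      linarith [main ε h1 h2]
    have hcl : R ∈ closure (Set.Ioo 0 R) := by
      rw [closure_Ioo hR0'.ne]; exact ⟨hR0'.le, le_rfl⟩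
    have := le_on_closure (f := fun ε => (hypArea K + 2 * π) * Real.cosh ε - 2 * π)
      (g := fun ε => hypPerim K * Real.sinh ε + 2 * π * (Real.cosh (2 * (R - ε)) - 1)) h
      (by fun_prop) (by fun_prop) hcl
    simpa using this
  refine ⟨r, R, hr0.le, hR0'.le, rfl, rfl, ?_, hstarR⟩
  rcases hrR.eq_or_lt with he | hlt
  · rw [he]; exact hstarR
  · have h : ∀ ε ∈ Set.Ioo r R, (hypArea K + 2 * π) * Real.cosh ε - 2 * π ≤ hypPerim K * Real.sinh ε := by
      rintro ε ⟨h1, h2⟩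
      have he : Gq K ε = ∅ := by
        rw [Set.eq_empty_iff_forall_notMem]
        intro c hcc
        obtain ⟨t, ht1, ht2⟩ := exists_between h1
        have : t ≤ r := le_csSup hbdd ⟨c, (closedBall_subset_ball ht2).trans hcc⟩
        linarith
      have := main ε (hr0.trans h1) h2
      rw [he] at this
      simpa using this
    have hcl : r ∈ closure (Set.Ioo r R) := by
      rw [closure_Ioo hlt.ne]; exact ⟨le_rfl, hlt.le⟩
    exact le_on_closure (f := fun ε => (hypArea K + 2 * π) * Real.cosh ε - 2 * π)
      (g := fun ε => hypPerim K * Real.sinh ε) h (by fun_prop) (by fun_prop) hcl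

end HB
end

/-- Unconditional Bonnesen-type inequality for the hyperbolic plane `H²`. -/
theorem bonnesen_inequality_hyperbolic_unconditional (K : Set ℍ)
    (hKcomp : IsCompact K) (hKconv : HypConvex K) (hKint : (interior K).Nonempty) :
    hypPerim K ^ 2 - hypArea K * (4 * π + hypArea K) ≥
      min (4 * π ^ 2)
        ((Real.sinh (hypCircumradius K) - Real.sinh (hypInradius K)) ^ 2 *
          ((2 * π + hypArea K) ^ 2 - hypPerim K ^ 2) ^ 2 /
          (4 * (2 * π + hypArea K) ^ 2)) := by
  obtain ⟨s1, s2, h1, h2, e1, e2, i1, i2⟩ := HB.bonn hKcomp hKconv hKint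
  rw [← e1, ← e2]
  exact HB.final_alg ENNReal.toReal_nonneg ENNReal.toReal_nonneg h1 h2 i1 i2
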